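/- Let σ∈(0,1) and 0<ν≤N. There exists ε>0 depending only on ν, N, σ such that the following holds. Suppose h satisfies the uniform ellipticity bounds with constants ν, N and the asymptotic flatness bounds with parameters σ, C_I, C_h where C_I ≤ ε and C_h ≤ ε. Then for every η₁, η₂ > 0 there is a constant C = C(η₁,η₂,ν,N,σ) > 0 such that for every m ≥ 0, every continuous φ:[0,∞)→(0,∞), every operator H as in the context, and every smooth u:[0,∞)×ℝ³→ℂ⁴ which is Schwartz in x at each time, solves iφ(t)∂ₜu = Hu, and has u(0,·)=u₀, one has ∫₀^∞ φ(t)^{-1} ∫_{ℝ³} ( ⟨x⟩^{−3−2η₁}|u(t,x)|² + ⟨x⟩^{−1−2η₂}|∇ₓu(t,x)|² ) √(det h(x)) dx dt ≤ C ‖Hu₀‖²_{L²(M_h)}, where ∇ₓ is the Euclidean spatial gradient. -/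

import Mathlib

noncomputable section
open MeasureTheory Real Set

abbrev Eu (n : ℕ) : Type := EuclideanSpace ℝ (Fin n)

def pd {n : ℕ} {F : Type*} [NormedAddCommGroup F] [NormedSpace ℝ F]
    (j : Fin n) (f : Eu n → F) (x : Eu n) : F :=
  fderiv ℝ f x (EuclideanSpace.single j 1)

def Chr {n : ℕ} (h : Eu n → Matrix (Fin n) (Fin n) ℝ) (i j k : Fin n) (x : Eu n) : ℝ :=
  (1/2) * ∑ l, (h x)⁻¹ i l *
    (pd j (fun y => h y l k) x + pd k (fun y => h y j l) x - pd l (fun y => h y j k) x)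

def Rscal {n : ℕ} (h : Eu n → Matrix (Fin n) (Fin n) ℝ) (x : Eu n) : ℝ :=
  ∑ j, ∑ k, (h x)⁻¹ j k *
    ((∑ i, pd i (fun y => Chr h i j k y) x) - (∑ i, pd k (fun y => Chr h i j i y) x)
      + (∑ i, ∑ l, Chr h l j k x * Chr h i i l x) - (∑ i, ∑ l, Chr h l j i x * Chr h i k l x))

def sdet {n : ℕ} (h : Eu n → Matrix (Fin n) (Fin n) ℝ) (x : Eu n) : ℝ := Real.sqrt (h x).det

def lapR {n : ℕ} (h : Eu n → Matrix (Fin n) (Fin n) ℝ) (f : Eu n → ℝ) (x : Eu n) : ℝ :=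
  (sdet h x)⁻¹ * ∑ j, pd j (fun y => sdet h y * ∑ k, (h y)⁻¹ j k * pd k f y) x

def lapC {n : ℕ} (h : Eu n → Matrix (Fin n) (Fin n) ℝ) (f : Eu n → ℂ) (x : Eu n) : ℂ :=
  ((sdet h x : ℝ) : ℂ)⁻¹ *
    ∑ j, pd j (fun y => ((sdet h y : ℝ) : ℂ) * ∑ k, (((h y)⁻¹ j k : ℝ) : ℂ) * pd k f y) x

def jap {n : ℕ} (x : Eu n) : ℝ := Real.sqrt (1 + ‖x‖ ^ 2)

def Hop (A : Fin 3 → Eu 3 → Fin 4 → Fin 4 → ℂ) (B : Eu 3 → Fin 4 → Fin 4 → ℂ)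
    (f : Eu 3 → Fin 4 → ℂ) (x : Eu 3) : Fin 4 → ℂ :=
  fun i => (∑ j, ∑ k, A j x i k * pd j f x k) + ∑ k, B x i k * f x k

def Elliptic (h : Eu 3 → Matrix (Fin 3) (Fin 3) ℝ) (ν N : ℝ) : Prop :=
  ∀ x : Eu 3, ∀ ξ : Fin 3 → ℝ,
    ν * (∑ j, ξ j ^ 2) ≤ (∑ j, ∑ k, (h x)⁻¹ j k * ξ j * ξ k) ∧
      (∑ j, ∑ k, (h x)⁻¹ j k * ξ j * ξ k) ≤ N * (∑ j, ξ j ^ 2)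

def opNorm {n : ℕ} (A : Matrix (Fin n) (Fin n) ℝ) : ℝ :=
  ‖LinearMap.toContinuousLinearMap (Matrix.toEuclideanLin A)‖

def pdM {n : ℕ} (j : Fin n) (H : Eu n → Matrix (Fin n) (Fin n) ℝ) (x : Eu n) :
    Matrix (Fin n) (Fin n) ℝ :=
  Matrix.of fun a b => pd j (fun y => H y a b) x

def AFlat (h : Eu 3 → Matrix (Fin 3) (Fin 3) ℝ) (σ CI Ch : ℝ) : Prop :=
  (∀ x : Eu 3, opNorm ((h x)⁻¹ - 1) ≤ CI * jap x ^ (-σ)) ∧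
  (∀ x : Eu 3,
    (∑ j, opNorm (pdM j (fun y => (h y)⁻¹) x))
      + ‖x‖ * (∑ j, ∑ k, opNorm (pdM j (pdM k (fun y => (h y)⁻¹)) x))
      + ‖x‖ ^ 2 * (∑ j, ∑ k, ∑ l, opNorm (pdM j (pdM k (pdM l (fun y => (h y)⁻¹))) x))
    ≤ Ch * jap x ^ (-(1 + σ)))

def sphInt (f : Eu 3 → ℝ) (R : ℝ) : ℝ :=
  R ^ 2 * ∫ ω : Metric.sphere (0 : Eu 3) 1, f (R • (ω : Eu 3)) ∂(volume.toSphere)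

def innC4 (h : Eu 3 → Matrix (Fin 3) (Fin 3) ℝ) (f g : Eu 3 → Fin 4 → ℂ) : ℂ :=
  ∫ x : Eu 3, (∑ i, (starRingEnd ℂ) (f x i) * g x i) * ((sdet h x : ℝ) : ℂ)

/-! ### Calculus of coordinate derivatives -/

/-- Smoothness of functions on Euclidean space. -/
abbrev Smooth {n : ℕ} {F : Type*} [NormedAddCommGroup F] [NormedSpace ℝ F] (f : Eu n → F) : Prop :=
  ContDiff ℝ (⊤ : ℕ∞) f

section Calculus

variable {n : ℕ} {F : Type*} [NormedAddCommGroup F] [NormedSpace ℝ F]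
  {R : Type*} [NormedCommRing R] [NormedAlgebra ℝ R]

lemma Smooth.diff {f : Eu n → F} (hf : Smooth f) (x : Eu n) : DifferentiableAt ℝ f x :=
  hf.differentiable (by simp) x

lemma Smooth.pd {f : Eu n → F} (hf : Smooth f) (j : Fin n) : Smooth (fun x => pd j f x) := by
  unfold _root_.pd
  exact (hf.fderiv_right (m := (⊤ : ℕ∞)) (by simp)).clm_apply contDiff_const

lemma Smooth.mul {f g : Eu n → R} (hf : Smooth f) (hg : Smooth g) :
    Smooth (fun x => f x * g x) := ContDiff.mul hf hg

lemma Smooth.add {f g : Eu n → F} (hf : Smooth f) (hg : Smooth g) :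
    Smooth (fun x => f x + g x) := ContDiff.add hf hg

lemma Smooth.sum {ι : Type*} {s : Finset ι} {f : ι → Eu n → F} (hf : ∀ i, Smooth (f i)) :
    Smooth (fun x => ∑ i ∈ s, f i x) := ContDiff.sum fun i _ => hf i

lemma Smooth.const (c : F) : Smooth (fun _ : Eu n => c) := contDiff_const

lemma smooth_coord (l : Fin n) : Smooth (fun x : Eu n => x l) := by
  unfold Smooth; fun_prop

lemma pd_mul {f g : Eu n → R} (hf : Smooth f) (hg : Smooth g) (j : Fin n) (x : Eu n) :
    pd j (fun y => f y * g y) x = pd j f x * g x + f x * pd j g x := by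
  unfold pd
  rw [fderiv_fun_mul (hf.diff x) (hg.diff x)]
  simp [mul_comm]; ring

lemma pd_smul {f : Eu n → ℝ} {g : Eu n → F} (hf : Smooth f) (hg : Smooth g) (j : Fin n)
    (x : Eu n) : pd j (fun y => f y • g y) x = pd j f x • g x + f x • pd j g x := by
  unfold pd
  rw [fderiv_fun_smul (hf.diff x) (hg.diff x)]
  simp [add_comm]

lemma pd_add {f g : Eu n → F} (hf : Smooth f) (hg : Smooth g) (j : Fin n) (x : Eu n) :
    pd j (fun y => f y + g y) x = pd j f x + pd j g x := by
  unfold pd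
  rw [fderiv_fun_add (hf.diff x) (hg.diff x)]
  simp

lemma pd_sub {f g : Eu n → F} (hf : Smooth f) (hg : Smooth g) (j : Fin n) (x : Eu n) :
    pd j (fun y => f y - g y) x = pd j f x - pd j g x := by
  unfold pd
  rw [fderiv_fun_sub (hf.diff x) (hg.diff x)]
  simp

lemma pd_sum {ι : Type*} {s : Finset ι} {f : ι → Eu n → F} (hf : ∀ i, Smooth (f i)) (j : Fin n)
    (x : Eu n) : pd j (fun y => ∑ i ∈ s, f i y) x = ∑ i ∈ s, pd j (f i) x := by
  unfold pd
  rw [fderiv_fun_sum fun i _ => (hf i).diff x]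
  simp

lemma pd_const (c : F) (j : Fin n) (x : Eu n) : pd j (fun _ : Eu n => c) x = 0 := by
  simp [pd]

lemma pd_const_mul {f : Eu n → R} (hf : Smooth f) (c : R) (j : Fin n) (x : Eu n) :
    pd j (fun y => c * f y) x = c * pd j f x := by
  rw [pd_mul (Smooth.const c) hf, pd_const]; simp

lemma pd_clm {F' : Type*} [NormedAddCommGroup F'] [NormedSpace ℝ F'] (L : F →L[ℝ] F')
    {f : Eu n → F} (hf : Smooth f) (j : Fin n) (x : Eu n) :
    pd j (fun y => L (f y)) x = L (pd j f x) := by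
  have h : HasFDerivAt (fun y => L (f y)) (L.comp (fderiv ℝ f x)) x :=
    L.hasFDerivAt.comp x (hf.diff x).hasFDerivAt
  rw [pd, h.fderiv]
  rfl

lemma pd_coord (j l : Fin n) (x : Eu n) :
    pd j (fun y : Eu n => y l) x = if j = l then 1 else 0 := by
  have h : HasFDerivAt (fun y : Eu n => y l) (EuclideanSpace.proj (𝕜 := ℝ) l) x :=
    (EuclideanSpace.proj (𝕜 := ℝ) l).hasFDerivAt
  rw [pd, h.fderiv]
  simp [eq_comm]

lemma pd_comm {f : Eu n → F} (hf : Smooth f) (j k : Fin n) (x : Eu n) :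
    pd j (fun y => pd k f y) x = pd k (fun y => pd j f y) x := by
  have hs : IsSymmSndFDerivAt ℝ f x :=
    hf.contDiffAt.isSymmSndFDerivAt (by
      rw [minSmoothness_of_isRCLikeNormedField]; exact WithTop.coe_le_coe.2 (le_top : (2 : ℕ∞) ≤ ⊤))
  have hd : DifferentiableAt ℝ (fderiv ℝ f) x :=
    (hf.fderiv_right (m := (⊤ : ℕ∞)) (by simp)).differentiable (by simp) x
  have key : ∀ a b : Fin n, pd a (fun y => pd b f y) x
      = fderiv ℝ (fderiv ℝ f) x (EuclideanSpace.single a 1) (EuclideanSpace.single b 1) := by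
    intro a b
    unfold pd
    rw [fderiv_clm_apply hd (by fun_prop)]
    simp
  rw [key, key, hs]

lemma norm_pd_le (f : Eu n → F) (j : Fin n) (x : Eu n) : ‖pd j f x‖ ≤ ‖fderiv ℝ f x‖ := by
  unfold pd
  refine (ContinuousLinearMap.le_opNorm _ _).trans ?_
  simp

lemma pd_eq_zero_of_notMem_tsupport {f : Eu n → F} (j : Fin n) {x : Eu n} (hx : x ∉ tsupport f) :
    pd j f x = 0 := by
  rw [pd, fderiv_of_notMem_tsupport ℝ hx]; rfl

lemma hasCompactSupport_pd {f : Eu n → F} (hf : HasCompactSupport f) (j : Fin n) :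
    HasCompactSupport (fun x => pd j f x) :=
  HasCompactSupport.intro hf fun _ hx => pd_eq_zero_of_notMem_tsupport j hx

/-- The divergence theorem for compactly supported functions, one coordinate at a time. -/
lemma integral_pd_eq_zero {f : Eu n → ℝ} (hf : Smooth f) (hc : HasCompactSupport f) (j : Fin n) :
    ∫ x, pd j f x = 0 := by
  have h := integral_mul_fderiv_eq_neg_fderiv_mul_of_integrable (μ := (volume : Measure (Eu n)))
    (f := fun _ => (1 : ℝ)) (g := f) (v := EuclideanSpace.single j 1) (by simp)
    (by simpa [pd] using
      (hf.pd j).continuous.integrable_of_hasCompactSupport (hasCompactSupport_pd hc j))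
    (by simpa using hf.continuous.integrable_of_hasCompactSupport hc)
    (by fun_prop) (fun x _ => hf.diff x)
  simpa [pd] using h

lemma integral_div_eq_zero {Z : Fin n → Eu n → ℝ} (hZ : ∀ j, Smooth (Z j))
    (hc : ∀ j, HasCompactSupport (Z j)) : ∫ x, ∑ j, pd j (Z j) x = 0 := by
  rw [integral_finsetSum]
  · simp [integral_pd_eq_zero (hZ _) (hc _)]
  · exact fun j _ => ((hZ j).pd j).continuous.integrable_of_hasCompactSupport
      (hasCompactSupport_pd (hc j) j)

/-- Integrating a pointwise inequality that holds up to a compactly supported divergence. -/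
lemma integral_le_of_le_add_div {Z : Fin n → Eu n → ℝ} (hZ : ∀ j, Smooth (Z j))
    (hc : ∀ j, HasCompactSupport (Z j)) {f g : Eu n → ℝ} (hf : Integrable f) (hg : Integrable g)
    (h : ∀ x, f x ≤ g x + ∑ j, pd j (Z j) x) : ∫ x, f x ≤ ∫ x, g x := by
  have hi : Integrable (fun x => ∑ j, pd j (Z j) x) :=
    integrable_finsetSum _ fun j _ => ((hZ j).pd j).continuous.integrable_of_hasCompactSupport
      (hasCompactSupport_pd (hc j) j)
  calc ∫ x, f x ≤ ∫ x, (g x + ∑ j, pd j (Z j) x) := integral_mono hf (hg.add hi) h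
    _ = ∫ x, g x := by rw [integral_add hg hi, integral_div_eq_zero hZ hc, add_zero]

end Calculus

/-! ### Japanese brackets -/

section Jap

variable {n : ℕ}

lemma jap_sq (x : Eu n) : jap x ^ 2 = 1 + ‖x‖ ^ 2 := Real.sq_sqrt (by positivity)

lemma one_le_jap (x : Eu n) : 1 ≤ jap x := by
  rw [jap, Real.one_le_sqrt]; nlinarith [sq_nonneg ‖x‖]

lemma jap_pos (x : Eu n) : 0 < jap x := one_pos.trans_le (one_le_jap x)

lemma norm_le_jap (x : Eu n) : ‖x‖ ≤ jap x :=
  Real.le_sqrt_of_sq_le (by linarith)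

lemma norm_sq_eq (x : Eu n) : ‖x‖ ^ 2 = ∑ l, x l ^ 2 := by
  rw [EuclideanSpace.norm_sq_eq]; simp

lemma abs_coord_le (x : Eu n) (l : Fin n) : |x l| ≤ ‖x‖ := by
  simpa using PiLp.norm_apply_le x l

lemma smooth_jap : Smooth (jap : Eu n → ℝ) := by
  unfold jap
  refine ContDiff.sqrt ?_ fun x => by positivity
  exact contDiff_const.add (contDiff_norm_sq ℝ)

lemma smooth_jap_rpow (s : ℝ) : Smooth (fun x : Eu n => jap x ^ s) :=
  smooth_jap.rpow_const_of_ne fun x => (jap_pos x).ne'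

lemma pd_jap (x : Eu n) (k : Fin n) : pd k (jap : Eu n → ℝ) x = x k * (jap x)⁻¹ := by
  have h1 : pd k (fun y : Eu n => jap y * jap y) x = 2 * x k := by
    have : (fun y : Eu n => jap y * jap y) = fun y => 1 + ∑ l, y l * y l := by
      ext y; rw [← sq, jap_sq, norm_sq_eq]; simp [sq]
    rw [this, pd_add (Smooth.const 1) (Smooth.sum fun l => (smooth_coord l).mul (smooth_coord l)),
      pd_const, pd_sum (fun l => (smooth_coord l).mul (smooth_coord l))]
    simp_rw [pd_mul (smooth_coord _) (smooth_coord _), pd_coord]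
    simp [Finset.sum_add_distrib]; ring
  rw [pd_mul smooth_jap smooth_jap] at h1
  have := jap_pos x
  field_simp; linarith

lemma pd_jap_rpow (s : ℝ) (x : Eu n) (k : Fin n) :
    pd k (fun y : Eu n => jap y ^ s) x = s * x k * jap x ^ (s - 2) := by
  have h : HasFDerivAt (fun y : Eu n => jap y ^ s) ((s * jap x ^ (s - 1)) • fderiv ℝ jap x) x :=
    (smooth_jap.diff x).hasFDerivAt.rpow_const (Or.inl (jap_pos x).ne')
  have h2 := pd_jap x k
  unfold pd at h2
  rw [pd, h.fderiv]
  simp only [smul_apply, smul_eq_mul]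
  rw [h2, show s - 2 = s - 1 - 1 by ring, Real.rpow_sub_one (jap_pos x).ne' (s - 1)]
  field_simp

end Jap

/-! ### The Morawetz multiplier -/

section Multiplier

/-- The inverse Japanese bracket `⟨x⟩⁻¹`. -/
def ji (x : Eu 3) : ℝ := jap x ^ (-1 : ℝ)

/-- The weight `⟨x⟩^{-δ}`. -/
def jd (δ : ℝ) (x : Eu 3) : ℝ := jap x ^ (-δ)

/-- The multiplier vector field `x (4⟨x⟩⁻¹ - ⟨x⟩^{-1-δ})`. -/
def morA (δ : ℝ) (l : Fin 3) (x : Eu 3) : ℝ := x l * (4 * jap x ^ (-1 : ℝ) - jap x ^ (-1 - δ))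

/-- Half the Euclidean divergence of `morA δ`. -/
def morQ (δ : ℝ) (x : Eu 3) : ℝ :=
  4 * jap x ^ (-1 : ℝ) + 2 * jap x ^ (-3 : ℝ) + (-(1 / 2) * (2 - δ)) * jap x ^ (-1 - δ)
    + (-(1 / 2) * (1 + δ)) * jap x ^ (-3 - δ)

/-- The radial coefficient of the gradient of `morQ δ`. -/
def morK (δ : ℝ) (x : Eu 3) : ℝ :=
  (-4) * jap x ^ (-3 : ℝ) + (-6) * jap x ^ (-5 : ℝ)
    + (1 / 2 * (2 - δ) * (1 + δ)) * jap x ^ (-3 - δ)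
    + (1 / 2 * (1 + δ) * (3 + δ)) * jap x ^ (-5 - δ)

lemma ji_pos (x : Eu 3) : 0 < ji x := Real.rpow_pos_of_pos (jap_pos x) _

lemma jd_pos (δ : ℝ) (x : Eu 3) : 0 < jd δ x := Real.rpow_pos_of_pos (jap_pos x) _

lemma ji_le_one (x : Eu 3) : ji x ≤ 1 :=
  Real.rpow_le_one_of_one_le_of_nonpos (one_le_jap x) (by norm_num)

lemma jd_le_one {δ : ℝ} (hδ : 0 ≤ δ) (x : Eu 3) : jd δ x ≤ 1 :=
  Real.rpow_le_one_of_one_le_of_nonpos (one_le_jap x) (by linarith)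

lemma ji_eq (x : Eu 3) : ji x = (jap x)⁻¹ := Real.rpow_neg_one _

lemma ji_sq (x : Eu 3) : ‖x‖ ^ 2 * ji x ^ 2 = 1 - ji x ^ 2 := by
  have h := jap_sq x
  have := jap_pos x
  rw [ji_eq]; field_simp; linarith

lemma norm_mul_ji_le (x : Eu 3) : ‖x‖ * ji x ≤ 1 := by
  rw [ji_eq, ← div_eq_mul_inv, div_le_one (jap_pos x)]
  exact norm_le_jap x

lemma jap_rpow_sub (k : ℕ) (s : ℝ) (x : Eu 3) : jap x ^ (-(k : ℝ) - s) = ji x ^ k * jd s x := by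
  rw [ji, jd, ← Real.rpow_natCast, ← Real.rpow_mul (jap_pos x).le, ← Real.rpow_add (jap_pos x)]
  congr 1; ring

lemma jap_rpow_neg (k : ℕ) (x : Eu 3) : jap x ^ (-(k : ℝ)) = ji x ^ k := by
  rw [ji, ← Real.rpow_natCast, ← Real.rpow_mul (jap_pos x).le]
  congr 1; ring

lemma smooth_ji : Smooth ji := smooth_jap_rpow _

lemma smooth_morA (δ : ℝ) (l : Fin 3) : Smooth (morA δ l) :=
  (smooth_coord l).mul ((contDiff_const.mul (smooth_jap_rpow _)).sub (smooth_jap_rpow _))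

lemma smooth_const_jap (c s : ℝ) : Smooth (fun x : Eu 3 => c * jap x ^ s) :=
  (Smooth.const c).mul (smooth_jap_rpow s)

lemma smooth_morQ (δ : ℝ) : Smooth (morQ δ) :=
  (((smooth_const_jap _ _).add (smooth_const_jap _ _)).add (smooth_const_jap _ _)).add
    (smooth_const_jap _ _)

lemma smooth_morK (δ : ℝ) : Smooth (morK δ) :=
  (((smooth_const_jap _ _).add (smooth_const_jap _ _)).add (smooth_const_jap _ _)).add
    (smooth_const_jap _ _)

lemma pd_four_jap (c₁ c₂ c₃ c₄ s₁ s₂ s₃ s₄ : ℝ) (j : Fin 3) (x : Eu 3) :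
    pd j (fun y : Eu 3 => c₁ * jap y ^ s₁ + c₂ * jap y ^ s₂ + c₃ * jap y ^ s₃ + c₄ * jap y ^ s₄) x
      = x j * (c₁ * s₁ * jap x ^ (s₁ - 2) + c₂ * s₂ * jap x ^ (s₂ - 2)
        + c₃ * s₃ * jap x ^ (s₃ - 2) + c₄ * s₄ * jap x ^ (s₄ - 2)) := by
  have h := smooth_const_jap
  rw [pd_add (((h _ _).add (h _ _)).add (h _ _)) (h _ _), pd_add ((h _ _).add (h _ _)) (h _ _),
    pd_add (h _ _) (h _ _)]
  simp only [pd_const_mul (smooth_jap_rpow _), pd_jap_rpow]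
  ring

lemma pd_morA (δ : ℝ) (j l : Fin 3) (x : Eu 3) :
    pd j (morA δ l) x = (if j = l then 1 else 0) * (ji x * (4 - jd δ x))
      + x j * x l * (ji x ^ 3 * (-4 + (1 + δ) * jd δ x)) := by
  have h := smooth_const_jap
  unfold morA
  rw [pd_mul (smooth_coord l) ((h _ _).sub (smooth_jap_rpow _)), pd_coord,
    pd_sub (h _ _) (smooth_jap_rpow _), pd_const_mul (smooth_jap_rpow _), pd_jap_rpow, pd_jap_rpow]
  have e1 : jap x ^ (-1 - δ) = ji x ^ 1 * jd δ x := by simpa using jap_rpow_sub 1 δ x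
  have e2 : jap x ^ (-1 - δ - 2) = ji x ^ 3 * jd δ x := by
    rw [← jap_rpow_sub]; congr 1; push_cast; ring
  have e3 : jap x ^ (-1 - 2 : ℝ) = ji x ^ 3 := by
    rw [← jap_rpow_neg]; congr 1; push_cast; ring
  rw [e1, e2, e3, ← ji]
  ring

lemma morQ_eq (δ : ℝ) (x : Eu 3) :
    morQ δ x = 4 * ji x + 2 * ji x ^ 3 - 1 / 2 * (2 - δ) * ji x * jd δ x
      - 1 / 2 * (1 + δ) * ji x ^ 3 * jd δ x := by
  have e1 : jap x ^ (-1 - δ) = ji x ^ 1 * jd δ x := by simpa using jap_rpow_sub 1 δ x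
  have e2 : jap x ^ (-3 - δ) = ji x ^ 3 * jd δ x := by simpa using jap_rpow_sub 3 δ x
  have e3 : jap x ^ (-3 : ℝ) = ji x ^ 3 := by simpa using jap_rpow_neg 3 x
  rw [morQ, e1, e2, e3, ← ji]; ring

lemma morK_eq (δ : ℝ) (x : Eu 3) :
    morK δ x = -4 * ji x ^ 3 - 6 * ji x ^ 5 + 1 / 2 * (2 - δ) * (1 + δ) * (ji x ^ 3 * jd δ x)
      + 1 / 2 * (1 + δ) * (3 + δ) * (ji x ^ 5 * jd δ x) := by
  have e1 : jap x ^ (-3 - δ) = ji x ^ 3 * jd δ x := by simpa using jap_rpow_sub 3 δ x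
  have e2 : jap x ^ (-5 - δ) = ji x ^ 5 * jd δ x := by simpa using jap_rpow_sub 5 δ x
  have e3 : jap x ^ (-3 : ℝ) = ji x ^ 3 := by simpa using jap_rpow_neg 3 x
  have e4 : jap x ^ (-5 : ℝ) = ji x ^ 5 := by simpa using jap_rpow_neg 5 x
  rw [morK, e1, e2, e3, e4]; ring

lemma sum_pd_morA (δ : ℝ) (x : Eu 3) : ∑ l, pd l (morA δ l) x = 2 * morQ δ x := by
  have h := ji_sq x
  rw [norm_sq_eq, Fin.sum_univ_three] at h
  simp only [pd_morA, morQ_eq, Fin.sum_univ_three, if_true]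
  linear_combination (ji x * (-4 + (1 + δ) * jd δ x)) * h

lemma pd_morQ (δ : ℝ) (j : Fin 3) (x : Eu 3) : pd j (morQ δ) x = x j * morK δ x := by
  unfold morQ
  rw [pd_four_jap, morK]
  rw [show (-1 - 2 : ℝ) = -3 by norm_num, show (-3 - 2 : ℝ) = -5 by norm_num,
    show -1 - δ - 2 = -3 - δ by ring, show -3 - δ - 2 = -5 - δ by ring]
  ring

lemma sum_pd_pd_morQ_le {δ : ℝ} (h0 : 0 ≤ δ) (h1 : δ ≤ 1) (x : Eu 3) :
    ∑ j, pd j (fun y => pd j (morQ δ) y) x ≤ -(1 / 2) * δ * (ji x ^ 3 * jd δ x) := by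
  have e1 : jap x ^ (-3 - δ - 2) = ji x ^ 5 * jd δ x := by
    rw [← jap_rpow_sub]; congr 1; push_cast; ring
  have e2 : jap x ^ (-5 - δ - 2) = ji x ^ 7 * jd δ x := by
    rw [← jap_rpow_sub]; congr 1; push_cast; ring
  have e3 : jap x ^ (-3 - 2 : ℝ) = ji x ^ 5 := by
    rw [← jap_rpow_neg]; congr 1; push_cast; ring
  have e4 : jap x ^ (-5 - 2 : ℝ) = ji x ^ 7 := by
    rw [← jap_rpow_neg]; congr 1; push_cast; ring
  have hk : ∀ j, pd j (morK δ) x = x j * (12 * ji x ^ 5 + 30 * ji x ^ 7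
      - 1 / 2 * (2 - δ) * (1 + δ) * (3 + δ) * (ji x ^ 5 * jd δ x)
      - 1 / 2 * (1 + δ) * (3 + δ) * (5 + δ) * (ji x ^ 7 * jd δ x)) := by
    intro j
    unfold morK
    rw [pd_four_jap, e1, e2, e3, e4]; ring
  have hd : ∀ j, pd j (fun y => pd j (morQ δ) y) x = morK δ x + x j * pd j (morK δ) x := by
    intro j
    simp_rw [pd_morQ]
    rw [pd_mul (smooth_coord j) (smooth_morK δ), pd_coord]; simp
  have h := ji_sq x
  rw [norm_sq_eq, Fin.sum_univ_three] at h
  have hi := ji_pos x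
  have hd1 := jd_le_one h0 x
  have hd0 := jd_pos δ x
  have key : ∑ j, pd j (fun y => pd j (morQ δ) y) x =
      -(1 / 2) * δ * ((1 + δ) * (2 - δ)) * (ji x ^ 3 * jd δ x)
      - δ * (1 + δ) * (3 + δ) * (ji x ^ 5 * jd δ x)
      - ji x ^ 7 * (30 - 1 / 2 * ((1 + δ) * (3 + δ) * (5 + δ)) * jd δ x) := by
    simp only [hd, hk, morK_eq, Fin.sum_univ_three]
    linear_combination (ji x ^ 3 * (12 + 30 * ji x ^ 2
      - 1 / 2 * (2 - δ) * (1 + δ) * (3 + δ) * jd δ x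
      - 1 / 2 * (1 + δ) * (3 + δ) * (5 + δ) * (ji x ^ 2 * jd δ x))) * h
  have h3 : 0 < ji x ^ 3 * jd δ x := by positivity
  have h5 : 0 ≤ δ * (1 + δ) * (3 + δ) * (ji x ^ 5 * jd δ x) := by positivity
  have h7 : 0 ≤ ji x ^ 7 * (30 - 1 / 2 * ((1 + δ) * (3 + δ) * (5 + δ)) * jd δ x) := by
    have hp : (1 + δ) * (3 + δ) * (5 + δ) ≤ 2 * 4 * 6 := by gcongr <;> linarith
    have hp0 : 0 ≤ (1 + δ) * (3 + δ) * (5 + δ) := by positivity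
    have : 0 ≤ 30 - 1 / 2 * ((1 + δ) * (3 + δ) * (5 + δ)) * jd δ x := by nlinarith
    positivity
  have h12 : δ ≤ δ * ((1 + δ) * (2 - δ)) := le_mul_of_one_le_right h0 (by nlinarith)
  rw [key]
  nlinarith

lemma morA_coercive {δ : ℝ} (h0 : 0 ≤ δ) (h1 : δ ≤ 1) (x : Eu 3) (ξ : Fin 3 → ℝ) :
    δ * (ji x * jd δ x) * ∑ j, ξ j ^ 2 ≤ ∑ j, ∑ l, ξ j * pd j (morA δ l) x * ξ l := by
  have h := ji_sq x
  have hi := ji_pos x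
  have hd1 := jd_le_one h0 x
  have hd0 := jd_pos δ x
  have hcs : (∑ j, x j * ξ j) ^ 2 ≤ ‖x‖ ^ 2 * ∑ j, ξ j ^ 2 := by
    rw [norm_sq_eq]; exact Finset.sum_mul_sq_le_sq_mul_sq _ _ _
  have hS : 0 ≤ ∑ j, ξ j ^ 2 := by positivity
  have hr : 0 ≤ ji x ^ 3 * (4 - (1 + δ) * jd δ x) := by
    have : 0 ≤ 4 - (1 + δ) * jd δ x := by nlinarith
    positivity
  have key : ∑ j, ∑ l, ξ j * pd j (morA δ l) x * ξ l
      = ji x * (4 - jd δ x) * ∑ j, ξ j ^ 2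
        - ji x ^ 3 * (4 - (1 + δ) * jd δ x) * (∑ j, x j * ξ j) ^ 2 := by
    simp [pd_morA, Fin.sum_univ_three]; ring
  have h2 := mul_le_mul_of_nonneg_left hcs hr
  have h3 : ji x ^ 3 * (4 - (1 + δ) * jd δ x) * (‖x‖ ^ 2 * ∑ j, ξ j ^ 2)
      = ji x * (1 - ji x ^ 2) * (4 - (1 + δ) * jd δ x) * ∑ j, ξ j ^ 2 := by
    linear_combination ji x * (4 - (1 + δ) * jd δ x) * (∑ j, ξ j ^ 2) * h
  rw [h3] at h2
  have h4 : 0 ≤ ji x ^ 3 * (4 - (1 + δ) * jd δ x) * ∑ j, ξ j ^ 2 := by positivity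
  rw [key]
  linear_combination h2 + h4

lemma abs_morA_le {δ : ℝ} (h0 : 0 ≤ δ) (l : Fin 3) (x : Eu 3) :
    |morA δ l x| ≤ 4 * (ji x * |x l|) := by
  have hi := ji_pos x
  have hd1 := jd_le_one h0 x
  have hd0 := jd_pos δ x
  have e1 : jap x ^ (-1 - δ) = ji x ^ 1 * jd δ x := by simpa using jap_rpow_sub 1 δ x
  have : morA δ l x = x l * (ji x * (4 - jd δ x)) := by
    rw [morA, e1, ← ji]; ring
  rw [this, abs_mul, abs_mul, abs_of_pos hi, abs_of_nonneg (by linarith : 0 ≤ 4 - jd δ x)]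
  have : 0 ≤ |x l| * ji x := by positivity
  nlinarith

lemma abs_coord_mul_ji_le (l : Fin 3) (x : Eu 3) : ji x * |x l| ≤ 1 := by
  have h1 := norm_mul_ji_le x
  have h2 := mul_le_mul_of_nonneg_left (abs_coord_le x l) (ji_pos x).le
  linarith

lemma abs_morA_le_four {δ : ℝ} (h0 : 0 ≤ δ) (l : Fin 3) (x : Eu 3) : |morA δ l x| ≤ 4 :=
  (abs_morA_le h0 l x).trans (by linarith [abs_coord_mul_ji_le l x])

lemma abs_pd_morA_le {δ : ℝ} (h0 : 0 ≤ δ) (h1 : δ ≤ 1) (j l : Fin 3) (x : Eu 3) :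
    |pd j (morA δ l) x| ≤ 8 * ji x := by
  have hi := ji_pos x
  have hd1 := jd_le_one h0 x
  have hd0 := jd_pos δ x
  rw [pd_morA]
  have a1 : |(if j = l then 1 else 0) * (ji x * (4 - jd δ x))| ≤ 4 * ji x := by
    have : 0 ≤ ji x * (4 - jd δ x) := mul_nonneg hi.le (by linarith)
    split_ifs
    · rw [one_mul, abs_of_nonneg this]; nlinarith
    · simp only [zero_mul, abs_zero]; linarith
  have a2 : |x j * x l * (ji x ^ 3 * (-4 + (1 + δ) * jd δ x))| ≤ 4 * ji x := by
    have e : x j * x l * (ji x ^ 3 * (-4 + (1 + δ) * jd δ x))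
        = (ji x * x j) * (ji x * x l) * (ji x * (-4 + (1 + δ) * jd δ x)) := by ring
    rw [e, abs_mul, abs_mul, abs_mul (ji x) (x j), abs_mul (ji x) (x l), abs_of_pos hi, abs_mul,
      abs_of_pos hi]
    have b1 := abs_coord_mul_ji_le j x
    have b2 := abs_coord_mul_ji_le l x
    have b3 : |-4 + (1 + δ) * jd δ x| ≤ 4 := by
      rw [abs_le]; constructor <;> nlinarith
    calc (ji x * |x j|) * (ji x * |x l|) * (ji x * |-4 + (1 + δ) * jd δ x|)
        ≤ 1 * 1 * (ji x * 4) := by gcongr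
      _ = 4 * ji x := by ring
  calc _ ≤ _ := abs_add_le _ _
    _ ≤ 8 * ji x := by linarith

lemma abs_morQ_le {δ : ℝ} (h0 : 0 ≤ δ) (h1 : δ ≤ 1) (x : Eu 3) : |morQ δ x| ≤ 12 * ji x := by
  have h := sum_pd_morA δ x
  have a := fun l => abs_pd_morA_le h0 h1 l l x
  rw [Fin.sum_univ_three] at h
  have a0 := abs_le.1 (a 0)
  have a1 := abs_le.1 (a 1)
  have a2 := abs_le.1 (a 2)
  rw [abs_le]
  constructor <;> linarith

lemma abs_pd_morQ_le {δ : ℝ} (h0 : 0 ≤ δ) (h1 : δ ≤ 1) (j : Fin 3) (x : Eu 3) :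
    |pd j (morQ δ) x| ≤ 15 * ji x ^ 2 := by
  have hi := ji_pos x
  have hi1 := ji_le_one x
  have hd1 := jd_le_one h0 x
  have hd0 := jd_pos δ x
  have b1 := abs_coord_mul_ji_le j x
  have e : pd j (morQ δ) x = (ji x * x j) * (ji x ^ 2 * (-4 - 6 * ji x ^ 2
      + (1 / 2 * (2 - δ) * (1 + δ)) * jd δ x
      + (1 / 2 * (1 + δ) * (3 + δ)) * (ji x ^ 2 * jd δ x))) := by
    rw [pd_morQ, morK_eq]; ring
  have hi2 : ji x ^ 2 ≤ 1 := pow_le_one₀ hi.le hi1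
  have hi20 : 0 < ji x ^ 2 := by positivity
  have c1 : (1 / 2 * (2 - δ) * (1 + δ)) * jd δ x ≤ (1 / 2 * 2 * 2) * 1 := by
    have : 0 ≤ 2 - δ := by linarith
    gcongr <;> linarith
  have c10 : 0 ≤ (1 / 2 * (2 - δ) * (1 + δ)) * jd δ x := by
    have : 0 ≤ 2 - δ := by linarith
    positivity
  have c2 : (1 / 2 * (1 + δ) * (3 + δ)) * (ji x ^ 2 * jd δ x) ≤ (1 / 2 * 2 * 4) * (1 * 1) := by
    gcongr <;> linarith
  have c20 : 0 ≤ (1 / 2 * (1 + δ) * (3 + δ)) * (ji x ^ 2 * jd δ x) := by positivity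
  rw [e, abs_mul, abs_mul, abs_mul (ji x ^ 2), abs_of_pos hi, abs_of_pos hi20]
  have b3 : |-4 - 6 * ji x ^ 2 + (1 / 2 * (2 - δ) * (1 + δ)) * jd δ x
      + (1 / 2 * (1 + δ) * (3 + δ)) * (ji x ^ 2 * jd δ x)| ≤ 15 := by
    rw [abs_le]; constructor <;> linarith
  calc (ji x * |x j|) * (ji x ^ 2 * _) ≤ 1 * (ji x ^ 2 * 15) := by gcongr
    _ = _ := by ring

end Multiplier

/-! ### Quantitative asymptotically flat coefficients -/

/-- Coefficients `p` (inverse metric), `w` (volume density) with logarithmic gradient `ℓ`, and a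
curvature term `R` which is a divergence `∂ⱼVⱼ` up to a quadratically decaying error, all of which
are `κ`-close to their flat counterparts. -/
structure Geo (κ σ : ℝ) (p : Fin 3 → Fin 3 → Eu 3 → ℝ) (w : Eu 3 → ℝ) (ℓ V : Fin 3 → Eu 3 → ℝ)
    (R : Eu 3 → ℝ) : Prop where
  κ0 : 0 ≤ κ
  κ1 : κ ≤ 1 / 100
  σ0 : 0 < σ
  σ1 : σ < 1
  sp : ∀ j k, Smooth (p j k)
  sw : Smooth w
  sℓ : ∀ j, Smooth (ℓ j)
  sV : ∀ j, Smooth (V j)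
  cR : Continuous R
  symm : ∀ j k x, p j k x = p k j x
  p_near : ∀ j k x, |p j k x - if j = k then 1 else 0| ≤ κ * jd σ x
  pd_p : ∀ l j k x, |pd l (p j k) x| ≤ κ * (ji x * jd σ x)
  w_near : ∀ x, |w x - 1| ≤ κ * jd σ x
  pd_w : ∀ k x, pd k w x = w x * ℓ k x
  ℓ_le : ∀ k x, |ℓ k x| ≤ κ * (ji x * jd σ x)
  pd_ℓ_le : ∀ j k x, ‖x‖ * |pd j (ℓ k) x| ≤ κ * (ji x * jd σ x)
  V_le : ∀ k x, |V k x| ≤ κ * (ji x * jd σ x)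
  R_le : ∀ x, ‖x‖ * |R x| ≤ κ * (ji x * jd σ x)
  R_div : ∀ x, |R x - ∑ k, pd k (V k) x| ≤ κ * (ji x ^ 2 * jd σ x)

lemma abs_sum3_le {f : Fin 3 → ℝ} {c : ℝ} (h : ∀ i, |f i| ≤ c) : |∑ i, f i| ≤ 3 * c := by
  refine (Finset.abs_sum_le_sum_abs _ _).trans ?_
  rw [Fin.sum_univ_three]; linarith [h 0, h 1, h 2]

lemma abs_mul_le' {a b A B : ℝ} (ha : |a| ≤ A) (hb : |b| ≤ B) : |a * b| ≤ A * B := by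
  rw [abs_mul]; exact mul_le_mul ha hb (abs_nonneg _) ((abs_nonneg _).trans ha)

lemma div_sq_morQ (δ : ℝ) {f χ : Eu 3 → ℝ} (hf : Smooth f) (hχ : Smooth χ) (x : Eu 3) :
    ∑ j, pd j (fun y => χ y * (f y * f y) * pd j (morQ δ) y) x
      = (∑ j, pd j χ x * pd j (morQ δ) x) * f x ^ 2
        + 2 * χ x * f x * (∑ j, pd j f x * pd j (morQ δ) x)
        + χ x * f x ^ 2 * ∑ j, pd j (fun y => pd j (morQ δ) y) x := by
  simp_rw [pd_mul (hχ.mul (hf.mul hf)) ((smooth_morQ δ).pd _), pd_mul hχ (hf.mul hf),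
    pd_mul hf hf, Fin.sum_univ_three]
  ring

section Virial

variable {κ σ : ℝ} {p : Fin 3 → Fin 3 → Eu 3 → ℝ} {w : Eu 3 → ℝ} {ℓ V : Fin 3 → Eu 3 → ℝ}
  {R : Eu 3 → ℝ}

/-- The flux `w p ∇f`. -/
def flux (p : Fin 3 → Fin 3 → Eu 3 → ℝ) (w : Eu 3 → ℝ) (f : Eu 3 → ℝ) (j : Fin 3) (x : Eu 3) : ℝ :=
  w x * ∑ k, p j k x * pd k f x

/-- The energy density `p ∇f · ∇f`. -/
def enden (p : Fin 3 → Fin 3 → Eu 3 → ℝ) (f : Eu 3 → ℝ) (x : Eu 3) : ℝ :=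
  ∑ j, ∑ k, p j k x * (pd j f x * pd k f x)

/-- The correction to `morQ` making the Morawetz operator skew with respect to `w dx`. -/
def morE (δ : ℝ) (ℓ : Fin 3 → Eu 3 → ℝ) (x : Eu 3) : ℝ := 1 / 2 * ∑ l, morA δ l x * ℓ l x

/-- The zeroth order coefficient of the Morawetz operator. -/
def morQE (δ : ℝ) (ℓ : Fin 3 → Eu 3 → ℝ) (x : Eu 3) : ℝ := morQ δ x + morE δ ℓ x

/-- The Morawetz operator. -/
def morB (δ : ℝ) (ℓ : Fin 3 → Eu 3 → ℝ) (f : Eu 3 → ℝ) (x : Eu 3) : ℝ :=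
  (∑ l, morA δ l x * pd l f x) + morQE δ ℓ x * f x

namespace Geo

variable (G : Geo κ σ p w ℓ V R)
include G

lemma smooth_flux {f : Eu 3 → ℝ} (hf : Smooth f) (j : Fin 3) : Smooth (flux p w f j) :=
  G.sw.mul (Smooth.sum fun k => (G.sp j k).mul (hf.pd k))

lemma smooth_enden {f : Eu 3 → ℝ} (hf : Smooth f) : Smooth (enden p f) :=
  Smooth.sum fun j => Smooth.sum fun k => (G.sp j k).mul ((hf.pd j).mul (hf.pd k))

lemma smooth_morE (δ : ℝ) : Smooth (morE δ ℓ) :=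
  (Smooth.const _).mul (Smooth.sum fun l => (smooth_morA δ l).mul (G.sℓ l))

lemma smooth_morQE (δ : ℝ) : Smooth (morQE δ ℓ) := (smooth_morQ δ).add (G.smooth_morE δ)

lemma smooth_morB (δ : ℝ) {f : Eu 3 → ℝ} (hf : Smooth f) : Smooth (morB δ ℓ f) :=
  (Smooth.sum fun l => (smooth_morA δ l).mul (hf.pd l)).add ((G.smooth_morQE δ).mul hf)

lemma pd_morE (δ : ℝ) (j : Fin 3) (x : Eu 3) :
    pd j (morE δ ℓ) x
      = 1 / 2 * ∑ l, (pd j (morA δ l) x * ℓ l x + morA δ l x * pd j (ℓ l) x) := by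
  unfold morE
  rw [pd_const_mul (Smooth.sum fun l => (smooth_morA δ l).mul (G.sℓ l)),
    pd_sum (fun l => (smooth_morA δ l).mul (G.sℓ l))]
  simp_rw [pd_mul (smooth_morA δ _) (G.sℓ _)]

lemma pd_morQE (δ : ℝ) (j : Fin 3) (x : Eu 3) :
    pd j (morQE δ ℓ) x = pd j (morQ δ) x + pd j (morE δ ℓ) x := by
  unfold morQE
  rw [pd_add (smooth_morQ δ) (G.smooth_morE δ)]

lemma pd_morB (δ : ℝ) {f : Eu 3 → ℝ} (hf : Smooth f) (j : Fin 3) (x : Eu 3) :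
    pd j (morB δ ℓ f) x
      = (∑ l, (pd j (morA δ l) x * pd l f x + morA δ l x * pd j (fun y => pd l f y) x))
        + pd j (morQE δ ℓ) x * f x + morQE δ ℓ x * pd j f x := by
  unfold morB
  rw [pd_add (Smooth.sum fun l => (smooth_morA δ l).mul (hf.pd l)) ((G.smooth_morQE δ).mul hf),
    pd_sum (fun l => (smooth_morA δ l).mul (hf.pd l)), pd_mul (G.smooth_morQE δ) hf]
  simp_rw [pd_mul (smooth_morA δ _) (hf.pd _)]
  ring

lemma sum_pd_w_morA (δ : ℝ) (x : Eu 3) :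
    ∑ l, (pd l w x * morA δ l x + w x * pd l (morA δ l) x) = 2 * w x * morQE δ ℓ x := by
  have h := sum_pd_morA δ x
  simp only [G.pd_w, morQE, morE, Fin.sum_univ_three] at h ⊢
  linear_combination w x * h

lemma pd_enden {f : Eu 3 → ℝ} (hf : Smooth f) (l : Fin 3) (x : Eu 3) :
    pd l (enden p f) x = (∑ j, ∑ k, pd l (p j k) x * (pd j f x * pd k f x))
      + 2 * ∑ j, ∑ k, p j k x * pd k f x * pd j (fun y => pd l f y) x := by
  unfold enden
  have hs : ∀ j k, Smooth (fun x => p j k x * (pd j f x * pd k f x)) :=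
    fun j k => (G.sp j k).mul ((hf.pd j).mul (hf.pd k))
  rw [pd_sum (fun j => Smooth.sum (hs j))]
  simp_rw [pd_sum (hs _), pd_mul (G.sp _ _) ((hf.pd _).mul (hf.pd _)), pd_mul (hf.pd _) (hf.pd _),
    fun j => pd_comm hf j l x]
  simp only [Fin.sum_univ_three, G.symm 1 0, G.symm 2 0, G.symm 2 1]
  ring

lemma flux_mul_pd_morB (δ : ℝ) {f : Eu 3 → ℝ} (hf : Smooth f) (x : Eu 3) :
    2 * ∑ j, flux p w f j x * pd j (morB δ ℓ f) x
      = 2 * (∑ j, ∑ l, flux p w f j x * pd j (morA δ l) x * pd l f x)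
        + w x * ∑ l, morA δ l x * pd l (enden p f) x
        - w x * (∑ l, ∑ j, ∑ k, morA δ l x * (pd l (p j k) x * (pd j f x * pd k f x)))
        + 2 * f x * (∑ j, flux p w f j x * pd j (morQE δ ℓ) x)
        + 2 * w x * morQE δ ℓ x * enden p f x := by
  simp_rw [G.pd_enden hf, G.pd_morB δ hf, enden, flux, Fin.sum_univ_three]
  ring

lemma div_flux_morB (δ : ℝ) {f χ : Eu 3 → ℝ} (hf : Smooth f) (hχ : Smooth χ) (x : Eu 3) :
    χ x * (∑ j, pd j (flux p w f j) x) * morB δ ℓ f x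
      = (∑ j, pd j (fun y => χ y * flux p w f j y * morB δ ℓ f y) x)
        - (∑ j, pd j χ x * flux p w f j x) * morB δ ℓ f x
        - χ x * ∑ j, flux p w f j x * pd j (morB δ ℓ f) x := by
  simp_rw [pd_mul (hχ.mul (G.smooth_flux hf _)) (G.smooth_morB δ hf),
    pd_mul hχ (G.smooth_flux hf _), Fin.sum_univ_three]
  ring

lemma div_morA_mul (δ : ℝ) {g χ : Eu 3 → ℝ} (hg : Smooth g) (hχ : Smooth χ) (x : Eu 3) :
    ∑ l, pd l (fun y => χ y * (w y * morA δ l y) * g y) x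
      = (∑ l, pd l χ x * morA δ l x) * w x * g x + χ x * (2 * w x * morQE δ ℓ x) * g x
        + χ x * w x * ∑ l, morA δ l x * pd l g x := by
  have hs := fun l => G.sw.mul (smooth_morA δ l)
  simp_rw [pd_mul (hχ.mul (hs _)) hg, pd_mul hχ (hs _), pd_mul G.sw (smooth_morA δ _),
    ← G.sum_pd_w_morA, Fin.sum_univ_three]
  ring

lemma div_V (δ : ℝ) {f χ : Eu 3 → ℝ} (hf : Smooth f) (hχ : Smooth χ) (x : Eu 3) :
    ∑ j, pd j (fun y => χ y * (w y * morQE δ ℓ y) * (f y * f y) * V j y) x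
      = χ x * w x * morQE δ ℓ x * f x ^ 2 * (∑ j, pd j (V j) x)
        + (∑ j, V j x * pd j χ x) * w x * morQE δ ℓ x * f x ^ 2
        + χ x * w x * ∑ j, V j x * (ℓ j x * morQE δ ℓ x * f x ^ 2
            + pd j (morQE δ ℓ) x * f x ^ 2 + 2 * morQE δ ℓ x * f x * pd j f x) := by
  have hs := G.sw.mul (G.smooth_morQE δ)
  simp_rw [pd_mul ((hχ.mul hs).mul (hf.mul hf)) (G.sV _), pd_mul (hχ.mul hs) (hf.mul hf),
    pd_mul hχ hs, pd_mul G.sw (G.smooth_morQE δ), pd_mul hf hf, G.pd_w, Fin.sum_univ_three]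
  ring

/-- The flux of the virial identity. -/
lemma virial_identity (δ m : ℝ) {f χ : Eu 3 → ℝ} (hf : Smooth f) (hχ : Smooth χ) (x : Eu 3) :
    χ x * ((∑ j, pd j (flux p w f j) x) - w x * (m ^ 2 + R x / 4) * f x) * morB δ ℓ f x
      = (∑ j, pd j (fun y => χ y * flux p w f j y * morB δ ℓ f y) x)
        + (-1 / 2) * (∑ j, pd j (fun y => χ y * (w y * morA δ j y) * enden p f y) x)
        + (-1 / 2) * (∑ j, pd j (fun y => χ y * (f y * f y) * pd j (morQ δ) y) x)
        + (-m ^ 2 / 2) * (∑ j, pd j (fun y => χ y * (w y * morA δ j y) * (f y * f y)) x)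
        + (-1 / 4) * (∑ j, pd j (fun y => χ y * (w y * morQE δ ℓ y) * (f y * f y) * V j y) x)
        + χ x * (-(∑ j, ∑ l, pd j f x * pd j (morA δ l) x * pd l f x)
            + 1 / 2 * f x ^ 2 * ∑ j, pd j (fun y => pd j (morQ δ) y) x)
        + χ x * (-(∑ j, ∑ l, (flux p w f j x - pd j f x) * pd j (morA δ l) x * pd l f x)
            + 1 / 2 * w x * (∑ l, ∑ j, ∑ k, morA δ l x * (pd l (p j k) x * (pd j f x * pd k f x)))
            - f x * (∑ j, (flux p w f j x - pd j f x) * pd j (morQ δ) x)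
            - f x * (∑ j, flux p w f j x * pd j (morE δ ℓ) x)
            - 1 / 4 * w x * f x * (∑ l, R x * morA δ l x * pd l f x)
            - 1 / 4 * w x * morQE δ ℓ x * (R x - ∑ j, pd j (V j) x) * f x ^ 2
            + 1 / 4 * w x * ∑ j, V j x * (ℓ j x * morQE δ ℓ x * f x ^ 2
              + pd j (morQE δ ℓ) x * f x ^ 2 + 2 * morQE δ ℓ x * f x * pd j f x))
        + (-(∑ j, pd j χ x * flux p w f j x) * morB δ ℓ f x
            + 1 / 2 * ((∑ l, pd l χ x * morA δ l x) * w x * enden p f x)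
            + 1 / 2 * ((∑ j, pd j χ x * pd j (morQ δ) x) * f x ^ 2)
            + 1 / 2 * m ^ 2 * ((∑ l, pd l χ x * morA δ l x) * w x * f x ^ 2)
            + 1 / 4 * ((∑ j, V j x * pd j χ x) * w x * morQE δ ℓ x * f x ^ 2)) := by
  have h1 := G.div_flux_morB δ hf hχ x
  have h2 := G.div_morA_mul δ (G.smooth_enden hf) hχ x
  have h3 := div_sq_morQ δ hf hχ x
  have h4 := G.div_morA_mul δ (hf.mul hf) hχ x
  have h5 := G.div_V δ hf hχ x
  have h6 := G.flux_mul_pd_morB δ hf x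
  have h7 : morB δ ℓ f x = (∑ l, morA δ l x * pd l f x) + morQE δ ℓ x * f x := rfl
  rw [h2, h3, h4, h5]
  simp_rw [pd_mul hf hf]
  simp_rw [G.pd_morQE] at h6 ⊢
  simp only [Fin.sum_univ_three] at *
  linear_combination h1 - χ x / 2 * h6 - χ x * w x * (m ^ 2 + R x / 4) * f x * h7

end Geo

end Virial

/-! ### Bounds for the error terms of the virial identity -/

/-- The Euclidean length of the gradient. -/
def gradN (f : Eu 3 → ℝ) (x : Eu 3) : ℝ := √(∑ j, pd j f x ^ 2)

lemma gradN_sq (f : Eu 3 → ℝ) (x : Eu 3) : gradN f x ^ 2 = ∑ j, pd j f x ^ 2 :=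
  Real.sq_sqrt (by positivity)

lemma gradN_nonneg (f : Eu 3 → ℝ) (x : Eu 3) : 0 ≤ gradN f x := Real.sqrt_nonneg _

lemma abs_pd_le_gradN (f : Eu 3 → ℝ) (j : Fin 3) (x : Eu 3) : |pd j f x| ≤ gradN f x := by
  rw [gradN, ← Real.sqrt_sq_eq_abs]
  exact Real.sqrt_le_sqrt (Finset.single_le_sum (f := fun j => pd j f x ^ 2)
    (fun _ _ => sq_nonneg _) (Finset.mem_univ j))

/-- The weighted density controlled by the virial identity. -/
def morS (δ : ℝ) (f : Eu 3 → ℝ) (x : Eu 3) : ℝ :=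
  ji x * jd δ x * gradN f x ^ 2 + ji x ^ 3 * jd δ x * f x ^ 2

lemma continuous_gradN {f : Eu 3 → ℝ} (hf : Smooth f) : Continuous (gradN f) :=
  Real.continuous_sqrt.comp (continuous_finsetSum _ fun j _ => (hf.pd j).continuous.pow 2)

lemma smooth_jd (δ : ℝ) : Smooth (jd δ) := smooth_jap_rpow _

lemma continuous_morS (δ : ℝ) {f : Eu 3 → ℝ} (hf : Smooth f) : Continuous (morS δ f) := by
  have := continuous_gradN hf
  have := (smooth_jd δ).continuous
  have := smooth_ji.continuous
  have := hf.continuous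
  unfold morS
  fun_prop

lemma morS_nonneg (δ : ℝ) (f : Eu 3 → ℝ) (x : Eu 3) : 0 ≤ morS δ f x := by
  have := ji_pos x
  have := jd_pos δ x
  unfold morS; positivity

section Virial

variable {κ σ : ℝ} {p : Fin 3 → Fin 3 → Eu 3 → ℝ} {w : Eu 3 → ℝ} {ℓ V : Fin 3 → Eu 3 → ℝ}
  {R : Eu 3 → ℝ}

namespace Geo

variable (G : Geo κ σ p w ℓ V R)
include G

lemma κβ_le (x : Eu 3) : κ * jd σ x ≤ 1 / 100 := by
  have := jd_le_one G.σ0.le x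
  have := jd_pos σ x
  nlinarith [G.κ0, G.κ1]

lemma abs_p_le (j k : Fin 3) (x : Eu 3) : |p j k x| ≤ 2 := by
  have h := abs_le.1 (G.p_near j k x)
  have := G.κβ_le x
  rw [abs_le]
  split_ifs at h <;> constructor <;> linarith

lemma w_le (x : Eu 3) : w x ≤ 2 := by
  linarith [(abs_le.1 (G.w_near x)).2, G.κβ_le x]

lemma le_w (x : Eu 3) : 1 / 2 ≤ w x := by
  linarith [(abs_le.1 (G.w_near x)).1, G.κβ_le x]

lemma abs_w_le (x : Eu 3) : |w x| ≤ 2 := by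
  rw [abs_of_nonneg (by linarith [G.le_w x])]; exact G.w_le x

lemma abs_flux_sub_le (f : Eu 3 → ℝ) (j : Fin 3) (x : Eu 3) :
    |flux p w f j x - pd j f x| ≤ 9 * (κ * jd σ x) * gradN f x := by
  have e : flux p w f j x - pd j f x
      = ∑ k, ((w x - 1) * p j k x + (p j k x - if j = k then 1 else 0)) * pd k f x := by
    simp only [flux, add_mul, sub_mul, Finset.sum_add_distrib, Finset.sum_sub_distrib, ite_mul,
      one_mul, zero_mul, Finset.sum_ite_eq, Finset.mem_univ, if_true, mul_assoc,
      ← Finset.mul_sum]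
    ring
  rw [e]
  refine (abs_sum3_le (c := 3 * (κ * jd σ x) * gradN f x) fun k => ?_).trans (by linarith)
  refine abs_mul_le' ?_ (abs_pd_le_gradN f k x)
  refine (abs_add_le _ _).trans ?_
  have := abs_mul_le' (G.w_near x) (G.abs_p_le j k x)
  linarith [G.p_near j k x]

lemma abs_flux_le (f : Eu 3 → ℝ) (j : Fin 3) (x : Eu 3) : |flux p w f j x| ≤ 2 * gradN f x := by
  have h1 := G.abs_flux_sub_le f j x
  have h2 := abs_pd_le_gradN f j x
  have h3 := abs_add_le (flux p w f j x - pd j f x) (pd j f x)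
  have h4 : 9 * (κ * jd σ x) * gradN f x ≤ 1 * gradN f x :=
    mul_le_mul_of_nonneg_right (by linarith [G.κβ_le x]) (gradN_nonneg f x)
  rw [sub_add_cancel] at h3
  linarith

lemma abs_enden_le (f : Eu 3 → ℝ) (x : Eu 3) : |enden p f x| ≤ 18 * gradN f x ^ 2 := by
  unfold enden
  have h := fun j k => abs_mul_le' (G.abs_p_le j k x)
    (abs_mul_le' (abs_pd_le_gradN f j x) (abs_pd_le_gradN f k x))
  exact (abs_sum3_le fun j => abs_sum3_le (h j)).trans (by linarith)

lemma iβ_le (x : Eu 3) : κ * (ji x * jd σ x) ≤ 1 / 100 * ji x := by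
  nlinarith [G.κβ_le x, ji_pos x]

lemma abs_morE_le {δ : ℝ} (h0 : 0 ≤ δ) (x : Eu 3) : |morE δ ℓ x| ≤ ji x := by
  unfold morE
  have h := abs_mul_le' (a := 1 / 2) le_rfl
    (abs_sum3_le fun l => abs_mul_le' (abs_morA_le_four h0 l x) (G.ℓ_le l x))
  rw [abs_of_pos (by norm_num : (0 : ℝ) < 1 / 2)] at h
  linarith [G.iβ_le x, ji_pos x]

lemma abs_pd_morE_le {δ : ℝ} (h0 : 0 ≤ δ) (h1 : δ ≤ 1) (j : Fin 3) (x : Eu 3) :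
    |pd j (morE δ ℓ) x| ≤ 18 * (κ * (ji x ^ 2 * jd σ x)) := by
  rw [G.pd_morE]
  have hi := ji_pos x
  have h : ∀ l, |pd j (morA δ l) x * ℓ l x + morA δ l x * pd j (ℓ l) x|
      ≤ 12 * (κ * (ji x ^ 2 * jd σ x)) := by
    intro l
    have a1 := abs_mul_le' (abs_pd_morA_le h0 h1 j l x) (G.ℓ_le l x)
    have a2 : |morA δ l x * pd j (ℓ l) x| ≤ 4 * (ji x * (κ * (ji x * jd σ x))) := by
      rw [abs_mul]
      calc |morA δ l x| * |pd j (ℓ l) x| ≤ (4 * (ji x * ‖x‖)) * |pd j (ℓ l) x| := by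
            refine mul_le_mul_of_nonneg_right ((abs_morA_le h0 l x).trans ?_) (abs_nonneg _)
            have := abs_coord_le x l
            gcongr
        _ = 4 * (ji x * (‖x‖ * |pd j (ℓ l) x|)) := by ring
        _ ≤ _ := by have := G.pd_ℓ_le j l x; gcongr
    refine (abs_add_le _ _).trans ((add_le_add a1 a2).trans (le_of_eq ?_))
    ring
  have h' := abs_mul_le' (a := 1 / 2) le_rfl (abs_sum3_le h)
  rw [abs_of_pos (by norm_num : (0 : ℝ) < 1 / 2)] at h'
  linarith

lemma abs_morQE_le {δ : ℝ} (h0 : 0 ≤ δ) (h1 : δ ≤ 1) (x : Eu 3) : |morQE δ ℓ x| ≤ 13 * ji x := by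
  unfold morQE
  refine (abs_add_le _ _).trans ?_
  linarith [abs_morQ_le h0 h1 x, G.abs_morE_le h0 x]

lemma abs_pd_morQE_le {δ : ℝ} (h0 : 0 ≤ δ) (h1 : δ ≤ 1) (j : Fin 3) (x : Eu 3) :
    |pd j (morQE δ ℓ) x| ≤ 16 * ji x ^ 2 := by
  rw [G.pd_morQE]
  refine (abs_add_le _ _).trans ?_
  have := abs_pd_morQ_le h0 h1 j x
  have := G.abs_pd_morE_le h0 h1 j x
  have : 18 * (κ * (ji x ^ 2 * jd σ x)) ≤ ji x ^ 2 := by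
    nlinarith [G.κβ_le x, sq_nonneg (ji x)]
  linarith

lemma abs_morB_le {δ : ℝ} (h0 : 0 ≤ δ) (h1 : δ ≤ 1) (f : Eu 3 → ℝ) (x : Eu 3) :
    |morB δ ℓ f x| ≤ 12 * gradN f x + 13 * (ji x * |f x|) := by
  unfold morB
  have a1 := abs_sum3_le fun l => abs_mul_le' (abs_morA_le_four h0 l x) (abs_pd_le_gradN f l x)
  have a2 := abs_mul_le' (G.abs_morQE_le h0 h1 x) (le_refl |f x|)
  refine (abs_add_le _ _).trans ?_
  linarith

/-- The bulk error in the virial identity. -/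
lemma virial_err_le {δ : ℝ} (h0 : 0 ≤ δ) (h1 : δ ≤ 1) (f : Eu 3 → ℝ) (x : Eu 3) :
    -(∑ j, ∑ l, (flux p w f j x - pd j f x) * pd j (morA δ l) x * pd l f x)
            + 1 / 2 * w x * (∑ l, ∑ j, ∑ k, morA δ l x * (pd l (p j k) x * (pd j f x * pd k f x)))
            - f x * (∑ j, (flux p w f j x - pd j f x) * pd j (morQ δ) x)
            - f x * (∑ j, flux p w f j x * pd j (morE δ ℓ) x)
            - 1 / 4 * w x * f x * (∑ l, R x * morA δ l x * pd l f x)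
            - 1 / 4 * w x * morQE δ ℓ x * (R x - ∑ j, pd j (V j) x) * f x ^ 2
            + 1 / 4 * w x * ∑ j, V j x * (ℓ j x * morQE δ ℓ x * f x ^ 2
              + pd j (morQE δ ℓ) x * f x ^ 2 + 2 * morQE δ ℓ x * f x * pd j f x)
      ≤ 2000 * κ * (ji x * jd σ x * gradN f x ^ 2 + ji x ^ 3 * jd σ x * f x ^ 2) := by
  set i := ji x with hi
  set β := jd σ x with hβ
  set s := gradN f x with hs
  have hi0 : 0 < i := ji_pos x
  have hi1 : i ≤ 1 := ji_le_one x
  have hβ0 : 0 < β := jd_pos σ x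
  have hβ1 : β ≤ 1 := jd_le_one G.σ0.le x
  have hs0 : 0 ≤ s := gradN_nonneg f x
  have hκ0 := G.κ0
  have hκ1 := G.κ1
  have hf0 := abs_nonneg (f x)
  have half : |(1 / 2 : ℝ)| ≤ 1 / 2 := (abs_of_pos (by norm_num)).le
  have quart : |(1 / 4 : ℝ)| ≤ 1 / 4 := (abs_of_pos (by norm_num)).le
  have hff : |f x ^ 2| ≤ |f x| ^ 2 := by rw [abs_pow]
  have e1 := abs_sum3_le fun j => abs_sum3_le fun l =>
    abs_mul_le' (abs_mul_le' (G.abs_flux_sub_le f j x) (abs_pd_morA_le h0 h1 j l x))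
      (abs_pd_le_gradN f l x)
  have e2 := abs_mul_le' (abs_mul_le' half (G.abs_w_le x))
    (abs_sum3_le fun l => abs_sum3_le fun j => abs_sum3_le fun k =>
      abs_mul_le' (abs_morA_le_four h0 l x) (abs_mul_le' (G.pd_p l j k x)
        (abs_mul_le' (abs_pd_le_gradN f j x) (abs_pd_le_gradN f k x))))
  have e3 := abs_mul_le' (le_refl |f x|) (abs_sum3_le fun j =>
    abs_mul_le' (G.abs_flux_sub_le f j x) (abs_pd_morQ_le h0 h1 j x))
  have e4 := abs_mul_le' (le_refl |f x|) (abs_sum3_le fun j =>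
    abs_mul_le' (G.abs_flux_le f j x) (G.abs_pd_morE_le h0 h1 j x))
  have hRa : ∀ l, |R x * morA δ l x| ≤ 4 * (i * (κ * (i * β))) := by
    intro l
    rw [abs_mul]
    calc |R x| * |morA δ l x| ≤ |R x| * (4 * (i * ‖x‖)) := by
          refine mul_le_mul_of_nonneg_left ((abs_morA_le h0 l x).trans ?_) (abs_nonneg _)
          have := abs_coord_le x l
          gcongr
      _ = 4 * (i * (‖x‖ * |R x|)) := by ring
      _ ≤ _ := by have := G.R_le x; gcongr
  have e5 := abs_mul_le' (abs_mul_le' (abs_mul_le' quart (G.abs_w_le x)) (le_refl |f x|))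
    (abs_sum3_le fun l => abs_mul_le' (hRa l) (abs_pd_le_gradN f l x))
  have e6 := abs_mul_le' (abs_mul_le' (abs_mul_le' (abs_mul_le' quart (G.abs_w_le x))
    (G.abs_morQE_le h0 h1 x)) (G.R_div x)) hff
  have hℓ : ∀ j, |ℓ j x| ≤ i := fun j => (G.ℓ_le j x).trans (by linarith [G.iβ_le x])
  have two : |(2 : ℝ)| ≤ 2 := (abs_of_pos (by norm_num)).le
  have e7 := abs_mul_le' (abs_mul_le' quart (G.abs_w_le x)) (abs_sum3_le fun j =>
    abs_mul_le' (G.V_le j x) ((abs_add_le _ _).trans (add_le_add ((abs_add_le _ _).trans (add_le_add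
      (abs_mul_le' (abs_mul_le' (hℓ j) (G.abs_morQE_le h0 h1 x)) hff)
      (abs_mul_le' (G.abs_pd_morQE_le h0 h1 j x) hff)))
      (abs_mul_le' (abs_mul_le' (abs_mul_le' two (G.abs_morQE_le h0 h1 x)) (le_refl |f x|))
        (abs_pd_le_gradN f j x)))))
  have b1 := neg_le_of_abs_le e1
  have b2 := le_of_abs_le e2
  have b3 := neg_le_of_abs_le e3
  have b4 := neg_le_of_abs_le e4
  have b5 := neg_le_of_abs_le e5
  have b6 := neg_le_of_abs_le e6
  have b7 := le_of_abs_le e7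
  simp only [← hi, ← hβ, ← hs] at b1 b2 b3 b4 b5 b6 b7
  have hX : 0 ≤ κ * (i * β * s ^ 2) := by positivity
  have hY : 0 ≤ κ * (i ^ 3 * β * |f x| ^ 2) := by positivity
  have hm : 2 * (κ * (i ^ 2 * β * (|f x| * s)))
      ≤ κ * (i * β * s ^ 2) + κ * (i ^ 3 * β * |f x| ^ 2) := by
    have : 0 ≤ κ * (i * β) * (s - i * |f x|) ^ 2 := by positivity
    linarith
  rw [← sq_abs (f x)]
  rw [← sq_abs (f x)] at b6 b7
  linarith

/-- The cutoff error in the virial identity. -/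
lemma virial_cut_le {δ : ℝ} (h0 : 0 ≤ δ) (h1 : δ ≤ 1) (m : ℝ) (f : Eu 3 → ℝ) {χ : Eu 3 → ℝ} {b : ℝ}
    (x : Eu 3) (hχ : ∀ j, |pd j χ x| ≤ b) :
    -(∑ j, pd j χ x * flux p w f j x) * morB δ ℓ f x
            + 1 / 2 * ((∑ l, pd l χ x * morA δ l x) * w x * enden p f x)
            + 1 / 2 * ((∑ j, pd j χ x * pd j (morQ δ) x) * f x ^ 2)
            + 1 / 2 * m ^ 2 * ((∑ l, pd l χ x * morA δ l x) * w x * f x ^ 2)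
            + 1 / 4 * ((∑ j, V j x * pd j χ x) * w x * morQE δ ℓ x * f x ^ 2)
      ≤ 1000 * b * ((1 + m ^ 2) * f x ^ 2 + gradN f x ^ 2) := by
  have hs0 := gradN_nonneg f x
  set s := gradN f x with hs
  have hi0 : 0 < ji x := ji_pos x
  have hi1 : ji x ≤ 1 := ji_le_one x
  have hb : 0 ≤ b := (abs_nonneg _).trans (hχ 0)
  have hf0 := abs_nonneg (f x)
  have hff : |f x ^ 2| ≤ |f x| ^ 2 := by rw [abs_pow]
  have hB : |morB δ ℓ f x| ≤ 12 * s + 13 * |f x| := by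
    refine (G.abs_morB_le h0 h1 f x).trans ?_
    have : ji x * |f x| ≤ |f x| := mul_le_of_le_one_left hf0 hi1
    linarith
  have hq : |morQE δ ℓ x| ≤ 13 := (G.abs_morQE_le h0 h1 x).trans (by linarith)
  have hq0 : ∀ j, |pd j (morQ δ) x| ≤ 15 := fun j =>
    (abs_pd_morQ_le h0 h1 j x).trans (by nlinarith)
  have hV : ∀ j, |V j x| ≤ 1 := fun j => (G.V_le j x).trans (by linarith [G.iβ_le x])
  have e1 := abs_mul_le' (abs_sum3_le fun j => abs_mul_le' (hχ j) (G.abs_flux_le f j x)) hB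
  have e2 := abs_mul_le' (abs_mul_le' (abs_sum3_le fun l =>
    abs_mul_le' (hχ l) (abs_morA_le_four h0 l x)) (G.abs_w_le x)) (G.abs_enden_le f x)
  have e3 := abs_mul_le' (abs_sum3_le fun j => abs_mul_le' (hχ j) (hq0 j)) hff
  have e4 := abs_mul_le' (abs_mul_le' (abs_sum3_le fun l =>
    abs_mul_le' (hχ l) (abs_morA_le_four h0 l x)) (G.abs_w_le x)) hff
  have e5 := abs_mul_le' (abs_mul_le' (abs_mul_le' (abs_sum3_le fun j =>
    abs_mul_le' (hV j) (hχ j)) (G.abs_w_le x)) hq) hff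
  have b1 := neg_le_of_abs_le e1
  have b2 := le_of_abs_le e2
  have b3 := le_of_abs_le e3
  have b4 := mul_le_mul_of_nonneg_left (le_of_abs_le e4) (by positivity : 0 ≤ 1 / 2 * m ^ 2)
  have b5 := le_of_abs_le e5
  have hX : 0 ≤ b * s ^ 2 := by positivity
  have hY : 0 ≤ b * |f x| ^ 2 := by positivity
  have hZ : 0 ≤ m ^ 2 * (b * |f x| ^ 2) := by positivity
  have hm : 2 * (b * (|f x| * s)) ≤ b * s ^ 2 + b * |f x| ^ 2 := by
    have : 0 ≤ b * (s - |f x|) ^ 2 := by positivity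
    linarith
  rw [← sq_abs (f x)] at *
  simp only [← hs] at *
  linarith

end Geo

end Virial

/-! ### The integrated virial inequality -/

lemma integrable_cutoff_mul {χ g : Eu 3 → ℝ} (hχ : Continuous χ) (hc : HasCompactSupport χ)
    (hg : Continuous g) : Integrable (fun x => χ x * g x) :=
  (hχ.mul hg).integrable_of_hasCompactSupport hc.mul_right

section Virial

variable {κ σ : ℝ} {p : Fin 3 → Fin 3 → Eu 3 → ℝ} {w : Eu 3 → ℝ} {ℓ V : Fin 3 → Eu 3 → ℝ}
  {R : Eu 3 → ℝ}

namespace Geo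

variable (G : Geo κ σ p w ℓ V R)
include G

lemma virial_pointwise {δ : ℝ} (h0 : 0 ≤ δ) (h1 : δ ≤ 1) (m : ℝ) {f χ : Eu 3 → ℝ} (hf : Smooth f)
    (hχ : Smooth χ) (hχ0 : ∀ x, 0 ≤ χ x) {b : ℝ} (hb : ∀ j x, |pd j χ x| ≤ b) (x : Eu 3) :
    χ x * ((∑ j, pd j (flux p w f j) x) - w x * (m ^ 2 + R x / 4) * f x) * morB δ ℓ f x
      ≤ (-(δ / 4) * (χ x * morS δ f x) + 2000 * κ * (χ x * morS σ f x)
          + 1000 * b * ((1 + m ^ 2) * f x ^ 2 + gradN f x ^ 2))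
        + ∑ j, pd j (fun y => χ y * flux p w f j y * morB δ ℓ f y
          + (-1 / 2) * (χ y * (w y * morA δ j y) * enden p f y)
          + (-1 / 2) * (χ y * (f y * f y) * pd j (morQ δ) y)
          + (-m ^ 2 / 2) * (χ y * (w y * morA δ j y) * (f y * f y))
          + (-1 / 4) * (χ y * (w y * morQE δ ℓ y) * (f y * f y) * V j y)) x := by
  have s1 := fun j => (hχ.mul (G.smooth_flux hf j)).mul (G.smooth_morB δ hf)
  have s2 := fun j => (hχ.mul (G.sw.mul (smooth_morA δ j))).mul (G.smooth_enden hf)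
  have s3 := fun j => (hχ.mul (hf.mul hf)).mul ((smooth_morQ δ).pd j)
  have s4 := fun j => (hχ.mul (G.sw.mul (smooth_morA δ j))).mul (hf.mul hf)
  have s5 := fun j => ((hχ.mul (G.sw.mul (G.smooth_morQE δ))).mul (hf.mul hf)).mul (G.sV j)
  have c := fun {g : Eu 3 → ℝ} (a : ℝ) (hg : Smooth g) => (Smooth.const a).mul hg
  simp_rw [pd_add ((((s1 _).add (c _ (s2 _))).add (c _ (s3 _))).add (c _ (s4 _))) (c _ (s5 _)),
    pd_add (((s1 _).add (c _ (s2 _))).add (c _ (s3 _))) (c _ (s4 _)),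
    pd_add ((s1 _).add (c _ (s2 _))) (c _ (s3 _)), pd_add (s1 _) (c _ (s2 _)),
    pd_const_mul (s2 _), pd_const_mul (s3 _), pd_const_mul (s4 _), pd_const_mul (s5 _),
    Finset.sum_add_distrib, ← Finset.mul_sum]
  rw [G.virial_identity δ m hf hχ x]
  have e1 := mul_le_mul_of_nonneg_left (G.virial_err_le h0 h1 f x) (hχ0 x)
  have e2 := G.virial_cut_le h0 h1 m f x (fun j => hb j x)
  have e3 := morA_coercive h0 h1 x (fun j => pd j f x)
  have e4 := mul_le_mul_of_nonneg_left (sum_pd_pd_morQ_le h0 h1 x)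
    (by positivity : 0 ≤ 1 / 2 * f x ^ 2)
  rw [← gradN_sq] at e3
  have hji := ji_pos x
  have hjd := jd_pos δ x
  have hg : 0 ≤ δ * (ji x * jd δ x) * gradN f x ^ 2 := by positivity
  have e5 := mul_le_mul_of_nonneg_left (a := χ x) (show
    (-(∑ j, ∑ l, pd j f x * pd j (morA δ l) x * pd l f x)
            + 1 / 2 * f x ^ 2 * ∑ j, pd j (fun y => pd j (morQ δ) y) x) ≤ -(δ / 4) * morS δ f x by
      unfold morS; linarith) (hχ0 x)
  have e6 : χ x * (2000 * κ * (ji x * jd σ x * gradN f x ^ 2 + ji x ^ 3 * jd σ x * f x ^ 2))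
    = 2000 * κ * (χ x * morS σ f x) := by unfold morS; ring
  linarith

lemma virial {δ : ℝ} (h0 : 0 ≤ δ) (h1 : δ ≤ 1) (m : ℝ) {f χ : Eu 3 → ℝ} (hf : Smooth f)
    (hχ : Smooth χ) (hc : HasCompactSupport χ) (hχ0 : ∀ x, 0 ≤ χ x) {b : ℝ}
    (hb : ∀ j x, |pd j χ x| ≤ b) (hf2 : Integrable (fun x => f x ^ 2))
    (hg2 : Integrable (fun x => gradN f x ^ 2)) :
    ∫ x, χ x * ((∑ j, pd j (flux p w f j) x) - w x * (m ^ 2 + R x / 4) * f x) * morB δ ℓ f x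
      ≤ -(δ / 4) * (∫ x, χ x * morS δ f x) + 2000 * κ * (∫ x, χ x * morS σ f x)
        + 1000 * b * ((1 + m ^ 2) * (∫ x, f x ^ 2) + ∫ x, gradN f x ^ 2) := by
  have i1 := (integrable_cutoff_mul hχ.continuous hc (continuous_morS δ hf)).const_mul (-(δ / 4))
  have i2 := (integrable_cutoff_mul hχ.continuous hc (continuous_morS σ hf)).const_mul (2000 * κ)
  have i3 := ((hf2.const_mul (1 + m ^ 2)).add hg2).const_mul (1000 * b)
  have hL : Integrable (fun x => χ x * ((∑ j, pd j (flux p w f j) x)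
      - w x * (m ^ 2 + R x / 4) * f x) * morB δ ℓ f x) := by
    have c1 : Continuous fun x => ∑ j, pd j (flux p w f j) x :=
      continuous_finsetSum _ fun j _ => ((G.smooth_flux hf j).pd j).continuous
    have c2 := G.sw.continuous
    have c3 := G.cR
    have c4 := hf.continuous
    have c5 := (G.smooth_morB δ hf).continuous
    simp_rw [mul_assoc (χ _)]
    exact integrable_cutoff_mul hχ.continuous hc (by fun_prop)
  have key := integral_le_of_le_add_div ?_ ?_ hL ((i1.add i2).add i3)
    (G.virial_pointwise h0 h1 m hf hχ hχ0 hb)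
  · refine key.trans (le_of_eq ?_)
    simp only [Pi.add_apply] at *
    have i12 : Integrable (fun x => -(δ / 4) * (χ x * morS δ f x)
      + 2000 * κ * (χ x * morS σ f x)) := i1.add i2
    rw [integral_add i12 i3, integral_add i1 i2]
    simp only [integral_const_mul]
    rw [integral_add (hf2.const_mul _) hg2, integral_const_mul]
  · intro j
    have s1 := (hχ.mul (G.smooth_flux hf j)).mul (G.smooth_morB δ hf)
    have s2 := (hχ.mul (G.sw.mul (smooth_morA δ j))).mul (G.smooth_enden hf)
    have s3 := (hχ.mul (hf.mul hf)).mul ((smooth_morQ δ).pd j)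
    have s4 := (hχ.mul (G.sw.mul (smooth_morA δ j))).mul (hf.mul hf)
    have s5 := ((hχ.mul (G.sw.mul (G.smooth_morQE δ))).mul (hf.mul hf)).mul (G.sV j)
    have c := fun {g : Eu 3 → ℝ} (a : ℝ) (hg : Smooth g) => (Smooth.const a).mul hg
    exact (((s1.add (c _ s2)).add (c _ s3)).add (c _ s4)).add (c _ s5)
  · intro j
    refine hc.mono' fun x hx => subset_tsupport _ (Function.mem_support.2 fun h => hx ?_)
    simp [h]

/-- The Morawetz operator is skew-symmetric up to cutoff errors. -/
lemma morB_skew {δ : ℝ} (h0 : 0 ≤ δ) {g χ : Eu 3 → ℝ} (hg : Smooth g)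
    (hχ : Smooth χ) (hc : HasCompactSupport χ) {b : ℝ}
    (hb : ∀ j x, |pd j χ x| ≤ b) (hg2 : Integrable (fun x => w x * g x ^ 2)) :
    ∫ x, χ x * w x * g x * morB δ ℓ g x ≤ 6 * b * ∫ x, w x * g x ^ 2 := by
  rw [← integral_const_mul]
  have hsg : ∀ j, Smooth (fun y => χ y * (w y * morA δ j y) * (g y * g y)) := fun j =>
    (hχ.mul (G.sw.mul (smooth_morA δ j))).mul (hg.mul hg)
  refine integral_le_of_le_add_div (Z := fun j y => 1 / 2 * (χ y * (w y * morA δ j y) * (g y * g y)))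
    (fun j => (Smooth.const _).mul (hsg j)) (fun j => ?_) ?_ (hg2.const_mul _) fun x => ?_
  · refine hc.mono' fun x hx => subset_tsupport _ (Function.mem_support.2 fun h => hx ?_)
    simp [h]
  · simp_rw [mul_assoc (χ _)]
    have c2 := G.sw.continuous
    have c4 := hg.continuous
    have c5 := (G.smooth_morB δ hg).continuous
    exact integrable_cutoff_mul hχ.continuous hc (by fun_prop)
  · have h := G.div_morA_mul δ (hg.mul hg) hχ x
    simp_rw [pd_const_mul (hsg _), ← Finset.mul_sum]
    rw [h]
    simp_rw [pd_mul hg hg]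
    have h2 := abs_sum3_le fun l => abs_mul_le' (hb l x) (abs_morA_le_four h0 l x)
    have h3 : 0 ≤ w x * g x ^ 2 := by have := G.le_w x; positivity
    have h4 := mul_le_mul_of_nonneg_right (neg_le_of_abs_le h2) h3
    have h7 : morB δ ℓ g x = (∑ l, morA δ l x * pd l g x) + morQE δ ℓ x * g x := rfl
    rw [h7]
    simp only [Fin.sum_univ_three] at *
    linarith

end Geo

end Virial

/-! ### Cutoffs and Hardy's inequality -/

/-- A family of cutoffs exhausting space with gradients tending to zero. -/
lemma exists_cutoffs : ∃ M > (0 : ℝ), ∃ χ : ℕ → Eu 3 → ℝ, (∀ n, Smooth (χ n)) ∧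
    (∀ n, HasCompactSupport (χ n)) ∧ (∀ n x, 0 ≤ χ n x) ∧ (∀ n x, χ n x ≤ 1) ∧
    (∀ n j x, |pd j (χ n) x| ≤ M / (n + 1)) ∧
    ∀ x, Filter.Tendsto (fun n => χ n x) Filter.atTop (nhds 1) := by
  let ψ : ContDiffBump (0 : Eu 3) := ⟨1, 2, one_pos, one_lt_two⟩
  have hψ : Smooth ψ := ψ.contDiff
  have hcd : HasCompactSupport (fderiv ℝ ψ) := ψ.hasCompactSupport.fderiv (𝕜 := ℝ)
  obtain ⟨M, hM⟩ := hcd.exists_bound_of_continuous (hψ.continuous_fderiv (by simp))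
  have hM0 : 0 ≤ M := (norm_nonneg _).trans (hM 0)
  refine ⟨M + 1, by linarith, fun n x => ψ ((n + 1 : ℝ)⁻¹ • x), fun n => ?_, fun n => ?_,
    fun n x => ψ.nonneg, fun n x => ψ.le_one, fun n j x => ?_, fun x => ?_⟩
  · exact hψ.comp (contDiff_const_smul _)
  · exact ψ.hasCompactSupport.comp_smul (by positivity)
  · have hn : (0 : ℝ) < n + 1 := by positivity
    have h : HasFDerivAt (fun y : Eu 3 => ψ ((n + 1 : ℝ)⁻¹ • y))
        ((fderiv ℝ ψ ((n + 1 : ℝ)⁻¹ • x)).comp ((n + 1 : ℝ)⁻¹ • ContinuousLinearMap.id ℝ (Eu 3))) x :=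
      (hψ.diff _).hasFDerivAt.comp x ((n + 1 : ℝ)⁻¹ • ContinuousLinearMap.id ℝ (Eu 3)).hasFDerivAt
    rw [pd, h.fderiv]
    simp only [ContinuousLinearMap.comp_apply, smul_apply, ContinuousLinearMap.id_apply, map_smul,
      smul_eq_mul, abs_mul, abs_inv, abs_of_pos hn]
    have h2 := norm_pd_le ψ j ((n + 1 : ℝ)⁻¹ • x)
    rw [Real.norm_eq_abs, pd] at h2
    rw [div_eq_inv_mul]
    exact mul_le_mul_of_nonneg_left (by linarith [hM ((n + 1 : ℝ)⁻¹ • x)]) (by positivity)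
  · refine tendsto_const_nhds.congr' ?_
    filter_upwards [Filter.eventually_ge_atTop ⌈‖x‖⌉₊] with n hn
    refine (ψ.one_of_mem_closedBall ?_).symm
    have h1 : ‖x‖ ≤ n := (Nat.le_ceil _).trans (by exact_mod_cast hn)
    have hn : (0 : ℝ) < n + 1 := by positivity
    rw [mem_closedBall_zero_iff, norm_smul, norm_inv, Real.norm_of_nonneg hn.le,
      inv_mul_le_iff₀ hn]
    linarith

lemma hardy {f χ : Eu 3 → ℝ} (hf : Smooth f) (hχ : Smooth χ) (hc : HasCompactSupport χ)
    (hχ0 : ∀ x, 0 ≤ χ x) {b : ℝ} (hb : ∀ j x, |pd j χ x| ≤ b)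
    (hf2 : Integrable (fun x => f x ^ 2)) :
    ∫ x, χ x * (ji x ^ 2 * f x ^ 2) ≤ 4 * (∫ x, χ x * gradN f x ^ 2) + 6 * b * ∫ x, f x ^ 2 := by
  have hs1 : ∀ j : Fin 3, Smooth (fun y : Eu 3 => y j * jap y ^ (-2 : ℝ)) := fun j =>
    (smooth_coord j).mul (smooth_jap_rpow _)
  have hs := fun j => (hχ.mul (hs1 j)).mul (hf.mul hf)
  have i1 : Integrable (fun x => 4 * (χ x * gradN f x ^ 2)) :=
    (integrable_cutoff_mul hχ.continuous hc ((continuous_gradN hf).pow 2)).const_mul 4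
  have i2 : Integrable (fun x => 6 * b * f x ^ 2) := hf2.const_mul _
  rw [← integral_const_mul, ← integral_const_mul, ← integral_add i1 i2]
  refine integral_le_of_le_add_div
    (Z := fun j y => 2 * (χ y * (y j * jap y ^ (-2 : ℝ)) * (f y * f y)))
    (fun j => (Smooth.const _).mul (hs j)) (fun j => ?_) ?_ (i1.add i2) fun x => ?_
  · refine hc.mono' fun x hx => subset_tsupport _ (Function.mem_support.2 fun h => hx ?_)
    simp [h]
  · have := smooth_ji.continuous
    have := hf.continuous
    exact integrable_cutoff_mul hχ.continuous hc (by fun_prop)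
  · have e1 : jap x ^ (-2 : ℝ) = ji x ^ 2 := by simpa using jap_rpow_neg 2 x
    have e2 : jap x ^ (-2 - 2 : ℝ) = ji x ^ 4 := by
      rw [← jap_rpow_neg]; congr 1; push_cast; ring
    have hj := ji_sq x
    have hi0 := ji_pos x
    have hi1 := ji_le_one x
    rw [norm_sq_eq] at hj
    simp_rw [pd_const_mul (hs _), ← Finset.mul_sum, pd_mul (hχ.mul (hs1 _)) (hf.mul hf),
      pd_mul hχ (hs1 _), pd_mul (smooth_coord _) (smooth_jap_rpow _), pd_mul hf hf, pd_coord,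
      pd_jap_rpow, e1, e2]
    have c1 : ∀ j, |pd j χ x * (ji x ^ 2 * x j)| ≤ b := fun j => by
      have h1 := abs_coord_mul_ji_le j x
      have h2 : |ji x ^ 2 * x j| ≤ 1 := by
        rw [abs_mul, abs_of_pos (by positivity), sq, mul_assoc]
        exact mul_le_one₀ hi1 (by positivity) h1
      simpa using abs_mul_le' (hb j x) h2
    have c2 := mul_le_mul_of_nonneg_right (neg_le_of_abs_le (abs_sum3_le c1)) (sq_nonneg (f x))
    have c3 : 0 ≤ χ x * ∑ j, (2 * pd j f x + f x * (ji x ^ 2 * x j)) ^ 2 :=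
      mul_nonneg (hχ0 x) (Finset.sum_nonneg fun _ _ => sq_nonneg _)
    have c4 : 0 ≤ χ x * ji x ^ 4 * f x ^ 2 := by have := hχ0 x; positivity
    simp only [gradN_sq, Fin.sum_univ_three, if_true] at *
    have hj4 : χ x * f x ^ 2 * ji x ^ 2 * ((x 0 ^ 2 + x 1 ^ 2 + x 2 ^ 2) * ji x ^ 2)
      = χ x * f x ^ 2 * ji x ^ 2 * (1 - ji x ^ 2) := by rw [hj]
    linarith

section Virial

variable {κ σ : ℝ} {p : Fin 3 → Fin 3 → Eu 3 → ℝ} {w : Eu 3 → ℝ} {ℓ V : Fin 3 → Eu 3 → ℝ}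
  {R : Eu 3 → ℝ}

namespace Geo

variable (G : Geo κ σ p w ℓ V R)
include G

lemma flux_coercive (f : Eu 3 → ℝ) (x : Eu 3) :
    1 / 2 * gradN f x ^ 2 ≤ ∑ j, pd j f x * flux p w f j x := by
  have h := abs_sum3_le fun j => abs_mul_le' (abs_pd_le_gradN f j x) (G.abs_flux_sub_le f j x)
  have h2 := neg_le_of_abs_le h
  have h3 : gradN f x ^ 2 * (κ * jd σ x) ≤ gradN f x ^ 2 * (1 / 100) :=
    mul_le_mul_of_nonneg_left (G.κβ_le x) (sq_nonneg _)
  have h4 := gradN_sq f x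
  have h5 := sq_nonneg (gradN f x)
  simp only [Fin.sum_univ_three] at *
  linarith

/-- The curvature term is a small perturbation of the Dirichlet energy. -/
lemma curvature_le {f χ : Eu 3 → ℝ} (hf : Smooth f) (hχ : Smooth χ) (hc : HasCompactSupport χ)
    (hχ0 : ∀ x, 0 ≤ χ x) {b : ℝ} (hb : ∀ j x, |pd j χ x| ≤ b)
    (hf2 : Integrable (fun x => f x ^ 2)) :
    |∫ x, χ x * (w x * R x * f x ^ 2)| ≤ 64 * κ * (∫ x, χ x * gradN f x ^ 2)
      + 20 * b * ∫ x, f x ^ 2 := by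
  have hsw := G.sw
  have cw := hsw.continuous
  have cf := hf.continuous
  have cR := G.cR
  have cg := continuous_gradN hf
  have ci := smooth_ji.continuous
  have hI : Integrable (fun x => χ x * (w x * R x * f x ^ 2)) :=
    integrable_cutoff_mul hχ.continuous hc (by fun_prop)
  have i1 : Integrable (fun x => 6 * κ * (χ x * gradN f x ^ 2)) :=
    (integrable_cutoff_mul hχ.continuous hc (cg.pow 2)).const_mul _
  have i2 : Integrable (fun x => 14 * κ * (χ x * (ji x ^ 2 * f x ^ 2))) :=
    (integrable_cutoff_mul hχ.continuous hc (by fun_prop)).const_mul _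
  have i3 : Integrable (fun x => 10 * b * f x ^ 2) := hf2.const_mul _
  have hs := fun j => ((hχ.mul hsw).mul (hf.mul hf)).mul (G.sV j)
  have hdiv : ∀ x, ∑ j, pd j (fun y => χ y * w y * (f y * f y) * V j y) x
      = χ x * (w x * R x * f x ^ 2) - χ x * w x * (R x - ∑ j, pd j (V j) x) * f x ^ 2
        + w x * f x ^ 2 * (∑ j, V j x * pd j χ x)
        + χ x * w x * ∑ j, V j x * (ℓ j x * f x ^ 2 + 2 * f x * pd j f x) := by
    intro x
    simp_rw [pd_mul ((hχ.mul hsw).mul (hf.mul hf)) (G.sV _), pd_mul (hχ.mul hsw) (hf.mul hf),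
      pd_mul hχ hsw, pd_mul hf hf, G.pd_w, Fin.sum_univ_three]
    ring
  have hbd : ∀ x, |χ x * (w x * R x * f x ^ 2)
      - ∑ j, pd j (fun y => χ y * w y * (f y * f y) * V j y) x|
      ≤ 6 * κ * (χ x * gradN f x ^ 2) + 14 * κ * (χ x * (ji x ^ 2 * f x ^ 2))
        + 10 * b * f x ^ 2 := by
    intro x
    rw [hdiv]
    set s := gradN f x with hs'
    set i := ji x with hi
    have hs0 : 0 ≤ s := gradN_nonneg f x
    have hi0 : 0 < i := ji_pos x
    have hi1 : i ≤ 1 := ji_le_one x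
    have hβ1 := jd_le_one G.σ0.le x
    have hβ0 := jd_pos σ x
    have hκ := G.κ0
    have hf0 := abs_nonneg (f x)
    have hbb : 0 ≤ b := (abs_nonneg _).trans (hb 0 0)
    have hff : |f x ^ 2| ≤ |f x| ^ 2 := by rw [abs_pow]
    have hV : ∀ j, |V j x| ≤ κ * i := fun j => (G.V_le j x).trans (by
      have : i * jd σ x ≤ i := mul_le_of_le_one_right hi0.le hβ1
      gcongr)
    have hV1 : ∀ j, |V j x| ≤ 1 := fun j => (hV j).trans (by nlinarith [G.κ1])
    have hℓ : ∀ j, |ℓ j x| ≤ i := fun j => (G.ℓ_le j x).trans (by linarith [G.iβ_le x])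
    have hG : |R x - ∑ j, pd j (V j) x| ≤ κ * i ^ 2 := (G.R_div x).trans (by
      have : i ^ 2 * jd σ x ≤ i ^ 2 := mul_le_of_le_one_right (by positivity) hβ1
      gcongr)
    have hχa : |χ x| ≤ χ x := (abs_of_nonneg (hχ0 x)).le
    have two : |(2 : ℝ)| ≤ 2 := (abs_of_pos (by norm_num)).le
    have a1 := abs_mul_le' (abs_mul_le' (abs_mul_le' hχa (G.abs_w_le x)) hG) hff
    have a2 := abs_mul_le' (abs_mul_le' (G.abs_w_le x) hff)
      (abs_sum3_le fun j => abs_mul_le' (hV1 j) (hb j x))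
    have a3 := abs_mul_le' (abs_mul_le' hχa (G.abs_w_le x)) (abs_sum3_le fun j =>
      abs_mul_le' (hV j) ((abs_add_le _ _).trans (add_le_add (abs_mul_le' (hℓ j) hff)
        (abs_mul_le' (abs_mul_le' two (le_refl |f x|)) (abs_pd_le_gradN f j x)))))
    have e : χ x * (w x * R x * f x ^ 2) - (χ x * (w x * R x * f x ^ 2)
          - χ x * w x * (R x - ∑ j, pd j (V j) x) * f x ^ 2
          + w x * f x ^ 2 * (∑ j, V j x * pd j χ x)
          + χ x * w x * ∑ j, V j x * (ℓ j x * f x ^ 2 + 2 * f x * pd j f x))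
        = χ x * w x * (R x - ∑ j, pd j (V j) x) * f x ^ 2
          - w x * f x ^ 2 * (∑ j, V j x * pd j χ x)
          - χ x * w x * ∑ j, V j x * (ℓ j x * f x ^ 2 + 2 * f x * pd j f x) := by ring
    rw [e]
    refine (abs_sub _ _).trans ?_
    have a4 := abs_sub (χ x * w x * (R x - ∑ j, pd j (V j) x) * f x ^ 2)
      (w x * f x ^ 2 * (∑ j, V j x * pd j χ x))
    have hx := hχ0 x
    have hX : 0 ≤ κ * (χ x * (s - i * |f x|) ^ 2) := by positivity
    have hY : 0 ≤ κ * (χ x * (i ^ 2 * |f x| ^ 2)) := by positivity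
    have hZ : 0 ≤ b * |f x| ^ 2 := by positivity
    rw [← sq_abs (f x)] at *
    simp only [← hs', ← hi] at *
    linarith
  have hH := hardy hf hχ hc hχ0 hb hf2
  have hsum : ∫ x, (6 * κ * (χ x * gradN f x ^ 2) + 14 * κ * (χ x * (ji x ^ 2 * f x ^ 2))
      + 10 * b * f x ^ 2) ≤ 64 * κ * (∫ x, χ x * gradN f x ^ 2) + 20 * b * ∫ x, f x ^ 2 := by
    have i12 : Integrable (fun x => 6 * κ * (χ x * gradN f x ^ 2)
      + 14 * κ * (χ x * (ji x ^ 2 * f x ^ 2))) := i1.add i2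
    rw [integral_add i12 i3, integral_add i1 i2]
    simp only [integral_const_mul]
    have h12 := mul_le_mul_of_nonneg_left hH (by have := G.κ0; positivity : 0 ≤ 12 * κ)
    have hg0 : 0 ≤ κ * ∫ x, χ x * gradN f x ^ 2 := mul_nonneg G.κ0
      (integral_nonneg fun x => mul_nonneg (hχ0 x) (sq_nonneg _))
    have hbb : 0 ≤ b := (abs_nonneg _).trans (hb 0 0)
    have hf0 : 0 ≤ b * ∫ x, f x ^ 2 := mul_nonneg hbb (integral_nonneg fun x => sq_nonneg _)
    have : κ * (b * ∫ x, f x ^ 2) ≤ 1 / 100 * (b * ∫ x, f x ^ 2) :=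
      mul_le_mul_of_nonneg_right G.κ1 hf0
    linarith
  refine abs_le.2 ⟨?_, le_trans ?_ hsum⟩
  · rw [neg_le, ← integral_neg]
    refine le_trans ?_ hsum
    refine integral_le_of_le_add_div (Z := fun j y => -1 * (χ y * w y * (f y * f y) * V j y))
      (fun j => (Smooth.const _).mul (hs j)) (fun j => ?_) hI.neg ((i1.add i2).add i3) fun x => ?_
    · refine hc.mono' fun x hx => subset_tsupport _ (Function.mem_support.2 fun h => hx ?_)
      simp [h]
    · simp_rw [pd_const_mul (hs _), ← Finset.mul_sum]
      have := neg_le_of_abs_le (hbd x)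
      linarith
  · refine integral_le_of_le_add_div hs (fun j => ?_) hI ((i1.add i2).add i3) fun x => ?_
    · refine hc.mono' fun x hx => subset_tsupport _ (Function.mem_support.2 fun h => hx ?_)
      simp [h]
    · have := le_of_abs_le (hbd x)
      linarith

/-- Integration by parts against the flux. -/
lemma integral_flux (f : Eu 3 → ℝ) {χ : Eu 3 → ℝ} (hf : Smooth f) (hχ : Smooth χ)
    (hc : HasCompactSupport χ) {b : ℝ} (hb : ∀ j x, |pd j χ x| ≤ b)
    (hf2 : Integrable (fun x => f x ^ 2)) (hg2 : Integrable (fun x => gradN f x ^ 2)) :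
    |(∫ x, χ x * (f x * ∑ j, pd j (flux p w f j) x))
      + ∫ x, χ x * ∑ j, pd j f x * flux p w f j x|
      ≤ 3 * b * ((∫ x, f x ^ 2) + ∫ x, gradN f x ^ 2) := by
  have cf := hf.continuous
  have sF := G.smooth_flux hf
  have c1 : Continuous fun x => f x * ∑ j, pd j (flux p w f j) x :=
    cf.mul (continuous_finsetSum _ fun j _ => ((sF j).pd j).continuous)
  have c2 : Continuous fun x => ∑ j, pd j f x * flux p w f j x :=
    continuous_finsetSum _ fun j _ => (hf.pd j).continuous.mul (sF j).continuous
  have i1 := integrable_cutoff_mul hχ.continuous hc c1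
  have i2 := integrable_cutoff_mul hχ.continuous hc c2
  have i3 := (hf2.add hg2).const_mul (3 * b)
  have hs := fun j => (hχ.mul hf).mul (sF j)
  have hbd : ∀ x, |(χ x * (f x * ∑ j, pd j (flux p w f j) x)
      + χ x * ∑ j, pd j f x * flux p w f j x)
      - ∑ j, pd j (fun y => χ y * f y * flux p w f j y) x|
      ≤ 3 * b * (f x ^ 2 + gradN f x ^ 2) := by
    intro x
    simp_rw [pd_mul (hχ.mul hf) (sF _), pd_mul hχ hf]
    have hbb : 0 ≤ b := (abs_nonneg _).trans (hb 0 0)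
    have a := abs_mul_le' (le_refl |f x|)
      (abs_sum3_le fun j => abs_mul_le' (hb j x) (G.abs_flux_le f j x))
    have e : (χ x * (f x * ∑ j, pd j (flux p w f j) x)
      + χ x * ∑ j, pd j f x * flux p w f j x)
      - ∑ j, ((pd j χ x * f x + χ x * pd j f x) * flux p w f j x
        + χ x * f x * pd j (flux p w f j) x) = -(f x * ∑ j, pd j χ x * flux p w f j x) := by
      simp only [Fin.sum_univ_three]; ring
    rw [e, abs_neg, ← sq_abs (f x)]
    have : 0 ≤ b * (|f x| - gradN f x) ^ 2 := by positivity
    linarith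
  rw [← integral_add i1 i2]
  have e3 : ∫ x, 3 * b * (f x ^ 2 + gradN f x ^ 2)
      = 3 * b * ((∫ x, f x ^ 2) + ∫ x, gradN f x ^ 2) := by
    rw [integral_const_mul, integral_add hf2 hg2]
  rw [← e3]
  have hcs : ∀ j, HasCompactSupport (fun y => χ y * f y * flux p w f j y) := fun j => by
    refine hc.mono' fun x hx => subset_tsupport _ (Function.mem_support.2 fun h => hx ?_)
    simp [h]
  refine abs_le.2 ⟨?_, ?_⟩
  · rw [neg_le, ← integral_neg]
    refine integral_le_of_le_add_div (Z := fun j y => -1 * (χ y * f y * flux p w f j y))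
      (fun j => (Smooth.const _).mul (hs j)) (fun j => (hcs j).mul_left) (i1.add i2).neg i3 fun x => ?_
    simp_rw [pd_const_mul (hs _), ← Finset.mul_sum]
    have := neg_le_of_abs_le (hbd x)
    linarith
  · refine integral_le_of_le_add_div hs hcs (i1.add i2) i3 fun x => ?_
    have := le_of_abs_le (hbd x)
    linarith

/-- The Morawetz pairing is controlled by the energies. -/
lemma abs_pairing_le {δ : ℝ} (h0 : 0 ≤ δ) (h1 : δ ≤ 1) {f g χ : Eu 3 → ℝ} (hf : Smooth f)
    (hg : Smooth g) (hχ : Smooth χ) (hc : HasCompactSupport χ)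
    (hχ0 : ∀ x, 0 ≤ χ x) {b : ℝ} (hb : ∀ j x, |pd j χ x| ≤ b)
    (hf2 : Integrable (fun x => f x ^ 2)) :
    |∫ x, χ x * w x * g x * morB δ ℓ f x| ≤ (∫ x, χ x * (w x * g x ^ 2))
      + 4000 * (∫ x, χ x * gradN f x ^ 2) + 5000 * b * ∫ x, f x ^ 2 := by
  have cw := G.sw.continuous
  have cf := hf.continuous
  have cg := hg.continuous
  have cn := continuous_gradN hf
  have ci := smooth_ji.continuous
  have cB := (G.smooth_morB δ hf).continuous
  have i1 : Integrable (fun x => χ x * (w x * g x ^ 2)) :=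
    integrable_cutoff_mul hχ.continuous hc (by fun_prop)
  have i2 : Integrable (fun x => 576 * (χ x * gradN f x ^ 2)) :=
    (integrable_cutoff_mul hχ.continuous hc (by fun_prop)).const_mul _
  have i3 : Integrable (fun x => 676 * (χ x * (ji x ^ 2 * f x ^ 2))) :=
    (integrable_cutoff_mul hχ.continuous hc (by fun_prop)).const_mul _
  have i12 : Integrable (fun x => χ x * (w x * g x ^ 2) + 576 * (χ x * gradN f x ^ 2)) := i1.add i2
  have hbd : ∀ x, ‖χ x * w x * g x * morB δ ℓ f x‖ ≤ χ x * (w x * g x ^ 2)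
      + 576 * (χ x * gradN f x ^ 2) + 676 * (χ x * (ji x ^ 2 * f x ^ 2)) := by
    intro x
    have hx := hχ0 x
    have hw0 := G.le_w x
    have hw1 := G.w_le x
    rw [Real.norm_eq_abs, abs_mul, abs_mul, abs_mul, abs_of_nonneg hx,
      abs_of_nonneg (by linarith : 0 ≤ w x)]
    have hB := G.abs_morB_le h0 h1 f x
    have hB2 : |morB δ ℓ f x| ^ 2 ≤ 288 * gradN f x ^ 2 + 338 * (ji x ^ 2 * f x ^ 2) := by
      rw [← sq_abs (f x)]
      have := pow_le_pow_left₀ (abs_nonneg _) hB 2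
      nlinarith [sq_nonneg (12 * gradN f x - 13 * (ji x * |f x|))]
    have e1 : |g x| * |morB δ ℓ f x| ≤ g x ^ 2 + |morB δ ℓ f x| ^ 2 := by
      rw [← sq_abs (g x)]
      nlinarith [sq_nonneg (|g x| - |morB δ ℓ f x|), sq_nonneg (|g x|),
        sq_nonneg (|morB δ ℓ f x|)]
    have e2 : 0 ≤ 288 * gradN f x ^ 2 + 338 * (ji x ^ 2 * f x ^ 2) := by positivity
    calc χ x * w x * |g x| * |morB δ ℓ f x| = χ x * (w x * (|g x| * |morB δ ℓ f x|)) := by ring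
      _ ≤ χ x * (w x * (g x ^ 2 + (288 * gradN f x ^ 2 + 338 * (ji x ^ 2 * f x ^ 2)))) := by
          have : 0 ≤ w x := by linarith
          gcongr
          exact e1.trans (by linarith)
      _ ≤ χ x * (w x * g x ^ 2 + 2 * (288 * gradN f x ^ 2 + 338 * (ji x ^ 2 * f x ^ 2))) := by
          refine mul_le_mul_of_nonneg_left ?_ hx
          rw [mul_add]
          have := mul_le_mul_of_nonneg_right hw1 e2
          linarith
      _ = _ := by ring
  have hH := hardy hf hχ hc hχ0 hb hf2
  have hn := norm_integral_le_of_norm_le (i12.add i3) (Filter.Eventually.of_forall hbd)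
  rw [Real.norm_eq_abs] at hn
  refine hn.trans ?_
  simp only [Pi.add_apply]
  rw [integral_add i12 i3, integral_add i1 i2, integral_const_mul, integral_const_mul]
  have h0 : 0 ≤ ∫ x, χ x * gradN f x ^ 2 :=
    integral_nonneg fun x => mul_nonneg (hχ0 x) (sq_nonneg _)
  have hbb : 0 ≤ b := (abs_nonneg _).trans (hb 0 0)
  have hf0 : 0 ≤ b * ∫ x, f x ^ 2 := mul_nonneg hbb (integral_nonneg fun x => sq_nonneg _)
  linarith

end Geo

end Virial

/-! ### Real components of spinors -/

/-- Real and imaginary parts of the coordinates of a spinor. -/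
def cpt (c : Fin 4 × Bool) : (Fin 4 → ℂ) →L[ℝ] ℝ :=
  (if c.2 then Complex.reCLM else Complex.imCLM).comp (ContinuousLinearMap.proj c.1)

/-- The real part of the Hermitian inner product of spinors. -/
def ip (v v' : Fin 4 → ℂ) : ℝ := ∑ c, cpt c v * cpt c v'

section Spinor

variable {v v' v'' : Fin 4 → ℂ}

@[simp] lemma cpt_true (i : Fin 4) : cpt (i, true) v = (v i).re := by simp [cpt]

@[simp] lemma cpt_false (i : Fin 4) : cpt (i, false) v = (v i).im := by simp [cpt]

lemma ip_eq : ip v v' = ∑ i, ((v i).re * (v' i).re + (v i).im * (v' i).im) := by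
  simp [ip, Fintype.sum_prod_type]

lemma ip_eq_re : ip v v' = (∑ i, (starRingEnd ℂ) (v i) * v' i).re := by
  simp [ip_eq, Complex.re_sum]

lemma ip_self : ip v v = ∑ i, ‖v i‖ ^ 2 := by
  simp [ip_eq, Complex.sq_norm, Complex.normSq_apply]

lemma ip_self_nonneg : 0 ≤ ip v v := Finset.sum_nonneg fun _ _ => mul_self_nonneg _

lemma ip_comm : ip v v' = ip v' v := by simp [ip, mul_comm]

lemma ip_add_left : ip (v + v') v'' = ip v v'' + ip v' v'' := by
  simp [ip, add_mul, Finset.sum_add_distrib]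

lemma ip_add_right : ip v (v' + v'') = ip v v' + ip v v'' := by
  simp [ip, mul_add, Finset.sum_add_distrib]

lemma ip_smul_left (a : ℝ) : ip (a • v) v' = a * ip v v' := by
  simp [ip, Finset.mul_sum, mul_assoc]

lemma ip_smul_right (a : ℝ) : ip v (a • v') = a * ip v v' := by
  rw [ip_comm, ip_smul_left, ip_comm]

lemma ip_sum_right {ι : Type*} (s : Finset ι) (V : ι → Fin 4 → ℂ) :
    ip v (∑ j ∈ s, V j) = ∑ j ∈ s, ip v (V j) := by
  classical
  induction s using Finset.induction_on with
  | empty => simp [ip]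
  | insert a s ha h => rw [Finset.sum_insert ha, Finset.sum_insert ha, ip_add_right, h]

lemma ip_I_smul_left : ip (Complex.I • v) v' = -ip v (Complex.I • v') := by
  simp [ip_eq, ← Finset.sum_neg_distrib]

lemma ip_I_smul_self : ip (Complex.I • v) (Complex.I • v) = ip v v := by
  simp [ip_eq, add_comm]

lemma abs_ip_le : |ip v v'| ≤ 1 / 2 * (ip v v + ip v' v') := by
  have h1 : 0 ≤ ip (v + v') (v + v') := ip_self_nonneg
  have h2 : 0 ≤ ip (v + (-1 : ℝ) • v') (v + (-1 : ℝ) • v') := ip_self_nonneg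
  simp only [ip_add_left, ip_add_right, ip_smul_left, ip_smul_right, ip_comm (v := v')
    (v' := v)] at h1 h2
  rw [abs_le]; constructor <;> linarith

lemma eq_of_cpt (h : ∀ c, cpt c v = cpt c v') : v = v' := by
  ext i
  exact Complex.ext (by simpa using h (i, true)) (by simpa using h (i, false))

lemma continuous_ip {f g : Eu 3 → Fin 4 → ℂ} (hf : Continuous f) (hg : Continuous g) :
    Continuous fun x => ip (f x) (g x) :=
  continuous_finsetSum _ fun c _ => ((cpt c).continuous.comp hf).mul ((cpt c).continuous.comp hg)

lemma Smooth.cpt {f : Eu 3 → Fin 4 → ℂ} (hf : Smooth f) (c : Fin 4 × Bool) :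
    Smooth (fun x => _root_.cpt c (f x)) := (_root_.cpt c).contDiff.comp hf

lemma Smooth.smul {f : Eu 3 → Fin 4 → ℂ} {a : Eu 3 → ℝ} (ha : Smooth a) (hf : Smooth f) :
    Smooth (fun x => a x • f x) := ContDiff.smul ha hf

end Spinor

/-! ### First order operators -/

section Operator

variable {A : Fin 3 → Eu 3 → Fin 4 → Fin 4 → ℂ} {B : Eu 3 → Fin 4 → Fin 4 → ℂ}

/-- The coefficient matrix of `∂ⱼ` acting on spinors. -/
def symb (A : Fin 3 → Eu 3 → Fin 4 → Fin 4 → ℂ) (j : Fin 3) (x : Eu 3) (v : Fin 4 → ℂ) :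
    Fin 4 → ℂ := fun i => ∑ k, A j x i k * v k

lemma symb_smul (j : Fin 3) (x : Eu 3) (a : ℝ) (v : Fin 4 → ℂ) :
    symb A j x (a • v) = a • symb A j x v := by
  ext i
  simp only [symb, Pi.smul_apply, Finset.smul_sum, mul_smul_comm]

lemma Hop_smul {f : Eu 3 → Fin 4 → ℂ} {a : Eu 3 → ℝ} (ha : Smooth a) (hf : Smooth f) (x : Eu 3) :
    Hop A B (fun y => a y • f y) x = a x • Hop A B f x + ∑ j, pd j a x • symb A j x (f x) := by
  ext i
  simp only [Hop, pd_smul ha hf, Pi.add_apply, Pi.smul_apply, symb, Finset.sum_apply, mul_add,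
    Finset.sum_add_distrib, Finset.smul_sum, smul_add, mul_smul_comm]
  ring

lemma Hop_I_smul {f : Eu 3 → Fin 4 → ℂ} (hf : Smooth f) (x : Eu 3) :
    Hop A B (fun y => Complex.I • f y) x = Complex.I • Hop A B f x := by
  have h : ∀ j, pd j (fun y => Complex.I • f y) x = Complex.I • pd j f x := fun j =>
    pd_clm ((Complex.I : ℂ) • ContinuousLinearMap.id ℝ (Fin 4 → ℂ)) hf j x
  ext i
  simp only [Hop, h, Pi.smul_apply, smul_eq_mul, mul_left_comm _ Complex.I, mul_add,
    Finset.mul_sum]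

lemma Hop_eq_zero_of_notMem_tsupport (f : Eu 3 → Fin 4 → ℂ) {x : Eu 3} (hx : x ∉ tsupport f) :
    Hop A B f x = 0 := by
  ext i
  simp [Hop, pd_eq_zero_of_notMem_tsupport _ hx, image_eq_zero_of_notMem_tsupport hx]

/-- A symmetric first order operator whose square is `m² - Δ + R/4`, in real components. -/
structure DOp (m : ℝ) (p : Fin 3 → Fin 3 → Eu 3 → ℝ) (w R : Eu 3 → ℝ)
    (A : Fin 3 → Eu 3 → Fin 4 → Fin 4 → ℂ) (B : Eu 3 → Fin 4 → Fin 4 → ℂ) : Prop where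
  sA : ∀ j i k, Smooth fun x => A j x i k
  sB : ∀ i k, Smooth fun x => B x i k
  symm : ∀ f g : Eu 3 → Fin 4 → ℂ, Smooth f → Smooth g → HasCompactSupport g →
    ∫ x, w x * ip (Hop A B f x) (g x) = ∫ x, w x * ip (f x) (Hop A B g x)
  sq : ∀ f : Eu 3 → Fin 4 → ℂ, Smooth f → ∀ c x,
    w x * cpt c (Hop A B (Hop A B f) x)
      = w x * (m ^ 2 + R x / 4) * cpt c (f x) - ∑ j, pd j (flux p w (fun y => cpt c (f y)) j) x

variable {κ σ m : ℝ} {p : Fin 3 → Fin 3 → Eu 3 → ℝ} {w : Eu 3 → ℝ} {ℓ V : Fin 3 → Eu 3 → ℝ}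
  {R : Eu 3 → ℝ}

namespace DOp

variable (D : DOp m p w R A B)
include D

lemma smooth_symb (j : Fin 3) {f : Eu 3 → Fin 4 → ℂ} (hf : Smooth f) :
    Smooth fun x => symb A j x (f x) :=
  contDiff_pi.2 fun i => ContDiff.sum fun k _ => (D.sA j i k).mul (contDiff_pi.1 hf k)

lemma smooth_Hop {f : Eu 3 → Fin 4 → ℂ} (hf : Smooth f) : Smooth (Hop A B f) :=
  contDiff_pi.2 fun i => ContDiff.add
    (ContDiff.sum fun j _ => ContDiff.sum fun k _ => (D.sA j i k).mul (contDiff_pi.1 (hf.pd j) k))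
    (ContDiff.sum fun k _ => (D.sB i k).mul (contDiff_pi.1 hf k))

lemma symb_skew_integral (sw : Smooth w) {a : Eu 3 → ℝ} {f g : Eu 3 → Fin 4 → ℂ} (ha : Smooth a)
    (hf : Smooth f) (hg : Smooth g) (hc : HasCompactSupport g) :
    ∫ x, w x * ∑ j, pd j a x * (ip (symb A j x (f x)) (g x) + ip (f x) (symb A j x (g x))) = 0 := by
  have h1 : ∫ x, w x * ip (Hop A B (fun y => a y • f y) x) (g x)
      = ∫ x, w x * ip (a x • f x) (Hop A B g x) := D.symm _ g (ha.smul hf) hg hc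
  have h2 : ∫ x, w x * ip (Hop A B f x) (a x • g x)
      = ∫ x, w x * ip (f x) (Hop A B (fun y => a y • g y) x) :=
    D.symm f _ hf (ha.smul hg) (hc.smul_left (f := a))
  have int : ∀ F : Eu 3 → ℝ, Continuous F → (∀ x, x ∉ tsupport g → F x = 0) → Integrable F :=
    fun F hF h0 => hF.integrable_of_hasCompactSupport (hc.mono' fun x hx => by
      by_contra hn; exact hx (h0 x hn))
  have cw := sw.continuous
  have ch := (D.smooth_Hop hf).continuous
  have ch' := (D.smooth_Hop hg).continuous
  have z : ∀ x, x ∉ tsupport g → g x = 0 := fun x hx => image_eq_zero_of_notMem_tsupport hx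
  have zs : ∀ j x, symb A j x 0 = 0 := fun j x => by ext i; simp [symb]
  have i0 : ∀ v : Fin 4 → ℂ, ip v 0 = 0 := fun v => by simp [ip]
  have i1 : Integrable fun x => w x * ip (Hop A B (fun y => a y • f y) x) (g x) :=
    int _ (cw.mul (continuous_ip (D.smooth_Hop (ha.smul hf)).continuous hg.continuous))
      fun x hx => by simp [z x hx, i0]
  have i2 : Integrable fun x => w x * ip (a x • f x) (Hop A B g x) :=
    int _ (cw.mul (continuous_ip (ha.smul hf).continuous ch'))
      fun x hx => by simp [Hop_eq_zero_of_notMem_tsupport g hx, i0]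
  have i3 : Integrable fun x => w x * ip (Hop A B f x) (a x • g x) :=
    int _ (cw.mul (continuous_ip ch (ha.smul hg).continuous))
      fun x hx => by simp [z x hx, i0]
  have i4 : Integrable fun x => w x * ip (f x) (Hop A B (fun y => a y • g y) x) :=
    int _ (cw.mul (continuous_ip hf.continuous (D.smooth_Hop (ha.smul hg)).continuous))
      fun x hx => by
        simp [Hop_smul ha hg, Hop_eq_zero_of_notMem_tsupport g hx, z x hx, zs, i0]
  have h3 := integral_add ((i1.sub i2).sub i3) i4
  rw [integral_sub' (i1.sub i2) i3, integral_sub' i1 i2] at h3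
  have h4 := h3.trans (by linarith : _ = (0 : ℝ))
  rw [← h4]
  congr 1; ext x
  simp only [Pi.sub_apply]
  rw [Hop_smul ha hf, Hop_smul ha hg, ip_comm, ip_add_right, ip_sum_right, ip_add_right,
    ip_sum_right]
  simp only [ip_smul_right, ip_smul_left, ip_comm (v := g x), mul_add, Finset.sum_add_distrib]
  ring

lemma symb_skew (G : Geo κ σ p w ℓ V R) (j : Fin 3) (x : Eu 3) (v v' : Fin 4 → ℂ) :
    ip (symb A j x v) v' = -ip v (symb A j x v') := by
  have hv : ∀ v : Fin 4 → ℂ, Smooth (fun _ : Eu 3 => v) := fun v => Smooth.const v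
  have cA : ∀ v, Continuous fun x => symb A j x v := fun v => (D.smooth_symb j (hv v)).continuous
  have cF : Continuous fun x => w x * (ip (symb A j x v) v' + ip v (symb A j x v')) :=
    G.sw.continuous.mul ((continuous_ip (cA v) continuous_const).add
      (continuous_ip continuous_const (cA v')))
  have key : ∀ᵐ x, w x * (ip (symb A j x v) v' + ip v (symb A j x v')) = 0 := by
    refine ae_eq_zero_of_integral_contDiff_smul_eq_zero cF.locallyIntegrable fun ψ hψ hc => ?_
    rw [← D.symb_skew_integral G.sw (smooth_coord j) (hv v) (Smooth.smul hψ (hv v'))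
      hc.smul_right]
    congr 1; ext x
    simp only [pd_coord, ite_mul, one_mul, zero_mul, Finset.sum_ite_eq', Finset.mem_univ, if_true,
      symb_smul, ip_smul_right, smul_eq_mul]
    ring
  have h0 := congrFun (cF.ae_eq_iff_eq volume continuous_const |>.1 key) x
  have hw := G.le_w x
  rcases mul_eq_zero.1 h0 with h | h <;> linarith

lemma symb_symb (G : Geo κ σ p w ℓ V R) (j : Fin 3) (x : Eu 3) (v : Fin 4 → ℂ) :
    symb A j x (symb A j x v) = (-p j j x) • v := by
  have hv : Smooth (fun _ : Eu 3 => v) := Smooth.const v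
  have sc : Smooth (fun y : Eu 3 => y j - x j) := (smooth_coord j).sub contDiff_const
  have pdc : ∀ l y, pd l (fun y : Eu 3 => y j - x j) y = if l = j then 1 else 0 := fun l y => by
    rw [pd_sub (smooth_coord j) (Smooth.const _), pd_coord, pd_const, sub_zero]
  have hav := sc.smul hv
  have e1 : Hop A B (fun y => (y j - x j) • ((y j - x j) • v))
      = fun y => (y j - x j) • ((y j - x j) • Hop A B (fun _ => v) y + (2 : ℝ) • symb A j y v) := by
    ext1 y
    simp_rw [Hop_smul sc hav, Hop_smul sc hv, pdc, ite_smul, one_smul, zero_smul,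
      Finset.sum_ite_eq', Finset.mem_univ, if_true, symb_smul]
    module
  have sg : Smooth (fun y => (y j - x j) • Hop A B (fun _ => v) y + (2 : ℝ) • symb A j y v) :=
    (sc.smul (D.smooth_Hop hv)).add ((Smooth.const (2 : ℝ)).smul (D.smooth_symb j hv))
  have e2 : Hop A B (Hop A B (fun y => (y j - x j) • ((y j - x j) • v))) x
      = (2 : ℝ) • symb A j x (symb A j x v) := by
    rw [e1, Hop_smul sc sg]
    simp_rw [pdc, ite_smul, one_smul, zero_smul, Finset.sum_ite_eq', Finset.mem_univ, if_true,
      sub_self, zero_smul, zero_add, symb_smul]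
  refine eq_of_cpt fun c => ?_
  have h := D.sq _ (sc.smul hav) c x
  rw [e2] at h
  have s2 := fun l k => ((G.sw.mul (G.sp l k)).mul sc)
  have e3 : ∀ l, flux p w (fun y => cpt c ((y j - x j) • ((y j - x j) • v))) l
      = fun y => (2 * cpt c v) * (w y * p l j y * (y j - x j)) := by
    intro l; ext y
    have : ∀ k, pd k (fun y : Eu 3 => cpt c ((y j - x j) • ((y j - x j) • v))) y
        = (if k = j then 1 else 0) * (2 * cpt c v * (y j - x j)) := by
      intro k
      have : (fun y : Eu 3 => cpt c ((y j - x j) • ((y j - x j) • v)))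
        = fun y => cpt c v * ((y j - x j) * (y j - x j)) := by
        ext y; simp only [map_smul, smul_eq_mul]; ring
      rw [this, pd_const_mul (sc.mul sc), pd_mul sc sc, pdc]; ring
    simp only [flux, this, ite_mul, one_mul, zero_mul, mul_ite, mul_zero, Finset.sum_ite_eq',
      Finset.mem_univ, if_true]
    ring
  simp_rw [e3, pd_const_mul (s2 _ _), pd_mul (G.sw.mul (G.sp _ _)) sc, pdc] at h
  simp only [sub_self, map_smul, smul_eq_mul, mul_zero, zero_mul, mul_ite, mul_one, zero_add,
    Finset.sum_ite_eq', Finset.mem_univ, if_true, zero_sub] at h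
  have hw := G.le_w x
  have : w x * (cpt c (symb A j x (symb A j x v)) + p j j x * cpt c v) = 0 := by linarith
  rw [map_smul, smul_eq_mul]
  rcases mul_eq_zero.1 this with h | h <;> linarith

lemma ip_symb_self_le (G : Geo κ σ p w ℓ V R) (j : Fin 3) (x : Eu 3) (v : Fin 4 → ℂ) :
    ip (symb A j x v) (symb A j x v) ≤ 2 * ip v v := by
  rw [D.symb_skew G, D.symb_symb G, ip_smul_right]
  have h := le_of_abs_le (G.abs_p_le j j x)
  have := mul_le_mul_of_nonneg_right h (ip_self_nonneg (v := v))
  linarith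

end DOp

end Operator

/-- The squared length of the gradient of a spinor. -/
def gsq (f : Eu 3 → Fin 4 → ℂ) (x : Eu 3) : ℝ := ∑ c, gradN (fun y => cpt c (f y)) x ^ 2

lemma gsq_nonneg (f : Eu 3 → Fin 4 → ℂ) (x : Eu 3) : 0 ≤ gsq f x :=
  Finset.sum_nonneg fun _ _ => sq_nonneg _

lemma continuous_gsq {f : Eu 3 → Fin 4 → ℂ} (hf : Smooth f) : Continuous (gsq f) :=
  continuous_finsetSum _ fun c _ => (continuous_gradN (hf.cpt c)).pow 2

lemma Continuous.mulf {f g : Eu 3 → ℝ} (hf : Continuous f) (hg : Continuous g) :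
    Continuous fun x => f x * g x := hf.mul hg

lemma Continuous.powf {f : Eu 3 → ℝ} (hf : Continuous f) (n : ℕ) :
    Continuous fun x => f x ^ n := hf.pow n

lemma gsq_eq {f : Eu 3 → Fin 4 → ℂ} (hf : Smooth f) (x : Eu 3) :
    gsq f x = ∑ j, ip (pd j f x) (pd j f x) := by
  simp only [gsq, gradN_sq, ip, pd_clm _ hf]
  rw [Finset.sum_comm]
  simp only [sq]

lemma integrable_cpt_sq {f : Eu 3 → Fin 4 → ℂ} (hf : Smooth f)
    (hF : Integrable fun x => ip (f x) (f x)) (c : Fin 4 × Bool) :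
    Integrable fun x => cpt c (f x) ^ 2 :=
  hF.mono' ((hf.cpt c).continuous.pow 2).aestronglyMeasurable <| Filter.Eventually.of_forall
    fun x => by
      rw [Real.norm_of_nonneg (sq_nonneg _), sq]
      exact Finset.single_le_sum (f := fun c => cpt c (f x) * cpt c (f x))
        (fun _ _ => mul_self_nonneg _) (Finset.mem_univ c)

lemma integrable_gradN_sq {f : Eu 3 → Fin 4 → ℂ} (hf : Smooth f) (hG : Integrable (gsq f))
    (c : Fin 4 × Bool) : Integrable fun x => gradN (fun y => cpt c (f y)) x ^ 2 :=
  hG.mono' ((continuous_gradN (hf.cpt c)).pow 2).aestronglyMeasurable <|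
    Filter.Eventually.of_forall fun x => by
      rw [Real.norm_of_nonneg (sq_nonneg _)]
      exact Finset.single_le_sum (f := fun c => gradN (fun y => cpt c (f y)) x ^ 2)
        (fun _ _ => sq_nonneg _) (Finset.mem_univ c)

lemma sum_integral_cpt_sq {f : Eu 3 → Fin 4 → ℂ} (hf : Smooth f)
    (hF : Integrable fun x => ip (f x) (f x)) :
    ∑ c, ∫ x, cpt c (f x) ^ 2 = ∫ x, ip (f x) (f x) := by
  rw [← integral_finsetSum _ fun c _ => integrable_cpt_sq hf hF c]
  simp only [ip, sq]

lemma sum_integral_gradN_sq {f : Eu 3 → Fin 4 → ℂ} (hf : Smooth f) (hG : Integrable (gsq f)) :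
    ∑ c, ∫ x, gradN (fun y => cpt c (f y)) x ^ 2 = ∫ x, gsq f x :=
  (integral_finsetSum _ fun c _ => integrable_gradN_sq hf hG c).symm

section Operator

variable {A : Fin 3 → Eu 3 → Fin 4 → Fin 4 → ℂ} {B : Eu 3 → Fin 4 → Fin 4 → ℂ}
  {κ σ m : ℝ} {p : Fin 3 → Fin 3 → Eu 3 → ℝ} {w : Eu 3 → ℝ} {ℓ V : Fin 3 → Eu 3 → ℝ}
  {R : Eu 3 → ℝ}

namespace DOp

variable (D : DOp m p w R A B)
include D

lemma symm_cutoff (sw : Smooth w) {f g : Eu 3 → Fin 4 → ℂ} {χ : Eu 3 → ℝ} (hf : Smooth f)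
    (hg : Smooth g) (hχ : Smooth χ) (hc : HasCompactSupport χ) :
    ∫ x, χ x * (w x * ip (Hop A B f x) (g x)) = (∫ x, χ x * (w x * ip (f x) (Hop A B g x)))
      + ∫ x, w x * ∑ j, pd j χ x * ip (f x) (symb A j x (g x)) := by
  have h : ∫ x, w x * ip (Hop A B f x) (χ x • g x)
      = ∫ x, w x * ip (f x) (Hop A B (fun y => χ y • g y) x) :=
    D.symm f _ hf (hχ.smul hg) hc.smul_right
  have i1 := integrable_cutoff_mul hχ.continuous hc
    (sw.continuous.mulf (continuous_ip hf.continuous (D.smooth_Hop hg).continuous))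
  have i2 : Integrable fun x => w x * ∑ j, pd j χ x * ip (f x) (symb A j x (g x)) := by
    simp only [Finset.mul_sum]
    refine integrable_finsetSum _ fun j _ => ?_
    refine (integrable_cutoff_mul (hχ.pd j).continuous (hasCompactSupport_pd hc j)
      (sw.continuous.mulf (continuous_ip hf.continuous (D.smooth_symb j hg).continuous))).congr
      (Filter.Eventually.of_forall fun x => ?_)
    simp only; ring
  rw [← integral_add i1 i2]
  refine Eq.trans (integral_congr_ae (Filter.Eventually.of_forall fun x => ?_))
    (h.trans (integral_congr_ae (Filter.Eventually.of_forall fun x => ?_)))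
  · simp only [ip_smul_right]; ring
  · simp only [Hop_smul hχ hg, ip_add_right, ip_smul_right, ip_sum_right]; ring

lemma abs_ip_symb_le (G : Geo κ σ p w ℓ V R) (j : Fin 3) (x : Eu 3) (v v' : Fin 4 → ℂ) :
    |ip v (symb A j x v')| ≤ 1 / 2 * ip v v + ip v' v' := by
  have h1 := abs_ip_le (v := v) (v' := symb A j x v')
  have h2 := D.ip_symb_self_le G j x v'
  linarith

lemma sum_flux_eq {f : Eu 3 → Fin 4 → ℂ} (hf : Smooth f) (x : Eu 3) :
    ∑ c, cpt c (f x) * ∑ j, pd j (flux p w (fun y => cpt c (f y)) j) x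
      = w x * (m ^ 2 + R x / 4) * ip (f x) (f x)
        - w x * ip (f x) (Hop A B (Hop A B f) x) := by
  simp only [ip, Finset.mul_sum, ← Finset.sum_sub_distrib]
  refine Finset.sum_congr rfl fun c _ => ?_
  have h := D.sq f hf c x
  rw [← Finset.mul_sum]
  linear_combination (cpt c (f x)) * h

lemma energy_identity (G : Geo κ σ p w ℓ V R) {f : Eu 3 → Fin 4 → ℂ} (hf : Smooth f)
    {χ : Eu 3 → ℝ} (hχ : Smooth χ) (hc : HasCompactSupport χ)
    (h0 : ∀ x, 0 ≤ χ x) (h1 : ∀ x, χ x ≤ 1) {b : ℝ} (hb : ∀ j x, |pd j χ x| ≤ b)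
    (hF : Integrable fun x => ip (f x) (f x)) (hG : Integrable (gsq f)) :
    |(∫ x, χ x * χ x * (w x * ip (Hop A B f x) (Hop A B f x)))
      - (∑ c, ∫ x, χ x * χ x * ∑ j, pd j (fun y => cpt c (f y)) x
          * flux p w (fun y => cpt c (f y)) j x)
      - m ^ 2 * (∫ x, χ x * χ x * (w x * ip (f x) (f x)))|
    ≤ 16 * κ * (∫ x, χ x * χ x * gsq f x) + 30 * b * ((∫ x, ip (f x) (f x)) + ∫ x, gsq f x)
      + 6 * b * (∫ x, χ x * χ x * (w x * ip (Hop A B f x) (Hop A B f x))) := by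
  have hζ : Smooth fun x => χ x * χ x := hχ.mul hχ
  have hcζ : HasCompactSupport fun x => χ x * χ x := hc.mul_left
  have hζ0 : ∀ x, 0 ≤ χ x * χ x := fun x => mul_self_nonneg _
  have hpd : ∀ j x, pd j (fun x => χ x * χ x) x = 2 * χ x * pd j χ x := fun j x => by
    rw [pd_mul hχ hχ]; ring
  have hbζ : ∀ j x, |pd j (fun x => χ x * χ x) x| ≤ 2 * b := fun j x => by
    rw [hpd, abs_mul, abs_mul, abs_two, abs_of_nonneg (h0 x)]
    nlinarith [h1 x, h0 x, hb j x, abs_nonneg (pd j χ x)]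
  have sH := D.smooth_Hop hf
  have sHH := D.smooth_Hop sH
  have cw := G.sw.continuous
  have cR := G.cR
  set X := ∫ x, χ x * χ x * (w x * ip (Hop A B f x) (Hop A B f x)) with hX
  set F := ∫ x, ip (f x) (f x) with hFd
  set Gs := ∫ x, gsq f x with hGd
  have int : ∀ {g : Eu 3 → ℝ}, Continuous g → Integrable fun x => χ x * χ x * g x := fun hg =>
    integrable_cutoff_mul hζ.continuous hcζ hg
  have e1 := D.symm_cutoff G.sw hf sH hζ hcζ
  -- the error from commuting with the cutoff
  have iX := int (cw.mulf (continuous_ip sH.continuous sH.continuous))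
  have e2 : |∫ x, w x * ∑ j, pd j (fun x => χ x * χ x) x * ip (f x) (symb A j x (Hop A B f x))|
      ≤ 6 * b * F + 6 * b * X := by
    rw [hX, hFd, ← integral_const_mul, ← integral_const_mul, ← integral_add (hF.const_mul _)
      (iX.const_mul _), ← Real.norm_eq_abs]
    refine norm_integral_le_of_norm_le ((hF.const_mul _).add (iX.const_mul _))
      (Filter.Eventually.of_forall fun x => ?_)
    have hw := G.w_le x
    have hw' := G.le_w x
    have hj : ∀ j, |pd j (fun x => χ x * χ x) x * ip (f x) (symb A j x (Hop A B f x))|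
        ≤ b * (ip (f x) (f x) + 2 * (χ x * χ x * ip (Hop A B f x) (Hop A B f x))) := fun j => by
      have := D.abs_ip_symb_le G j x (f x) (χ x • Hop A B f x)
      rw [symb_smul, ip_smul_right, ip_smul_right, ip_smul_left] at this
      rw [hpd, show 2 * χ x * pd j χ x * ip (f x) (symb A j x (Hop A B f x))
        = pd j χ x * (2 * (χ x * ip (f x) (symb A j x (Hop A B f x)))) by ring, abs_mul,
        abs_mul, abs_two]
      refine mul_le_mul (hb j x) (by linarith) (by positivity) ((abs_nonneg _).trans (hb j x))
    have h3 := abs_sum3_le hj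
    rw [Real.norm_eq_abs, abs_mul, abs_of_nonneg (show 0 ≤ w x by linarith)]
    have hb0 : 0 ≤ b := (abs_nonneg _).trans (hb 0 x)
    have i0 : 0 ≤ ip (f x) (f x) := ip_self_nonneg
    have hbi := mul_nonneg hb0 i0
    nlinarith [mul_le_mul_of_nonneg_left h3 (show 0 ≤ w x by linarith),
      mul_le_mul_of_nonneg_right hw hbi]
  have e3 : ∫ x, χ x * χ x * (w x * ip (f x) (Hop A B (Hop A B f) x))
      = m ^ 2 * (∫ x, χ x * χ x * (w x * ip (f x) (f x)))
        + 1 / 4 * (∑ c, ∫ x, χ x * χ x * (w x * R x * cpt c (f x) ^ 2))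
        - ∑ c, ∫ x, χ x * χ x
          * (cpt c (f x) * ∑ j, pd j (flux p w (fun y => cpt c (f y)) j) x) := by
    have cc := fun c => (hf.cpt c).continuous
    have j1 : ∀ c ∈ (Finset.univ : Finset (Fin 4 × Bool)),
        Integrable fun x => χ x * χ x * (w x * R x * cpt c (f x) ^ 2) :=
      fun c _ => int ((cw.mulf cR).mulf ((cc c).powf 2))
    have j2 : ∀ c ∈ (Finset.univ : Finset (Fin 4 × Bool)), Integrable fun x => χ x * χ x
          * (cpt c (f x) * ∑ j, pd j (flux p w (fun y => cpt c (f y)) j) x) :=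
      fun c _ => int ((cc c).mulf (continuous_finsetSum _ fun j _ =>
        ((G.smooth_flux (hf.cpt c) j).pd j).continuous))
    have j3 := int (cw.mulf (continuous_ip hf.continuous hf.continuous))
    rw [← integral_finsetSum _ j1, ← integral_finsetSum _ j2, ← integral_const_mul,
      ← integral_const_mul, ← integral_add (j3.const_mul _) ((integrable_finsetSum _ j1).const_mul _),
      ← integral_sub ((j3.const_mul _).fun_add ((integrable_finsetSum _ j1).const_mul _))
        (integrable_finsetSum _ j2)]
    refine integral_congr_ae (Filter.Eventually.of_forall fun x => ?_)
    have h := D.sum_flux_eq hf x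
    have hs : ip (f x) (f x) = ∑ c, cpt c (f x) ^ 2 := by
      simp only [ip, pow_two]
    simp only [← Finset.mul_sum]
    rw [h, ← hs]; ring
  have e4 : |∑ c, ∫ x, χ x * χ x * (w x * R x * cpt c (f x) ^ 2)|
      ≤ 64 * κ * (∫ x, χ x * χ x * gsq f x) + 40 * b * F := by
    have hs : ∫ x, χ x * χ x * gsq f x
        = ∑ c, ∫ x, χ x * χ x * gradN (fun y => cpt c (f y)) x ^ 2 := by
      rw [← integral_finsetSum _ fun c _ => int ((continuous_gradN (hf.cpt c)).powf 2)]
      simp only [gsq, Finset.mul_sum]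
    rw [hs, hFd, ← sum_integral_cpt_sq hf hF, Finset.mul_sum, Finset.mul_sum,
      ← Finset.sum_add_distrib]
    refine (Finset.abs_sum_le_sum_abs _ _).trans (Finset.sum_le_sum fun c _ => ?_)
    have := G.curvature_le (hf.cpt c) hζ hcζ hζ0 hbζ (integrable_cpt_sq hf hF c)
    linarith
  have e5 : |(∑ c, ∫ x, χ x * χ x
          * (cpt c (f x) * ∑ j, pd j (flux p w (fun y => cpt c (f y)) j) x))
      + ∑ c, ∫ x, χ x * χ x * ∑ j, pd j (fun y => cpt c (f y)) x
          * flux p w (fun y => cpt c (f y)) j x| ≤ 6 * b * (F + Gs) := by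
    rw [← Finset.sum_add_distrib, hFd, hGd, ← sum_integral_cpt_sq hf hF,
      ← sum_integral_gradN_sq hf hG, ← Finset.sum_add_distrib, Finset.mul_sum]
    refine (Finset.abs_sum_le_sum_abs _ _).trans (Finset.sum_le_sum fun c _ => ?_)
    have := G.integral_flux _ (hf.cpt c) hζ hcζ hbζ (integrable_cpt_sq hf hF c)
      (integrable_gradN_sq hf hG c)
    linarith
  have hb0 : 0 ≤ b := (abs_nonneg _).trans (hb 0 0)
  have hF0 : 0 ≤ F := integral_nonneg fun x => ip_self_nonneg
  have hG0 : 0 ≤ Gs := integral_nonneg fun x => gsq_nonneg f x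
  have := mul_nonneg hb0 hF0
  have := mul_nonneg hb0 hG0
  obtain ⟨e2, e2'⟩ := abs_le.1 e2
  obtain ⟨e4, e4'⟩ := abs_le.1 e4
  obtain ⟨e5, e5'⟩ := abs_le.1 e5
  rw [abs_le]
  constructor <;> linarith

lemma gradient_le (G : Geo κ σ p w ℓ V R) {f : Eu 3 → Fin 4 → ℂ} (hf : Smooth f)
    {χ : Eu 3 → ℝ} (hχ : Smooth χ) (hc : HasCompactSupport χ)
    (h0 : ∀ x, 0 ≤ χ x) (h1 : ∀ x, χ x ≤ 1) {b : ℝ} (hb : ∀ j x, |pd j χ x| ≤ b)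
    (hF : Integrable fun x => ip (f x) (f x)) (hG : Integrable (gsq f)) :
    ∫ x, χ x * χ x * gsq f x
      ≤ 3 * (1 + 6 * b) * (∫ x, χ x * χ x * (w x * ip (Hop A B f x) (Hop A B f x)))
        + 90 * b * ((∫ x, ip (f x) (f x)) + ∫ x, gsq f x) := by
  have h := (abs_le.1 (D.energy_identity G hf hχ hc h0 h1 hb hF hG)).1
  have hcζ : HasCompactSupport fun x => χ x * χ x := hc.mul_left
  have int : ∀ {g : Eu 3 → ℝ}, Continuous g → Integrable fun x => χ x * χ x * g x := fun hg =>
    integrable_cutoff_mul (hχ.mul hχ).continuous hcζ hg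
  have hlow : 1 / 2 * (∫ x, χ x * χ x * gsq f x) ≤ ∑ c, ∫ x, χ x * χ x *
      ∑ j, pd j (fun y => cpt c (f y)) x * flux p w (fun y => cpt c (f y)) j x := by
    have i1 : ∀ c, Integrable fun x => χ x * χ x *
      ∑ j, pd j (fun y => cpt c (f y)) x * flux p w (fun y => cpt c (f y)) j x := fun c =>
      int (continuous_finsetSum _ fun j _ => ((hf.cpt c).pd j).continuous.mul
        (G.smooth_flux (hf.cpt c) j).continuous)
    rw [← integral_const_mul, ← integral_finsetSum _ fun c _ => i1 c]
    refine integral_mono ((int (continuous_gsq hf)).const_mul _)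
      (integrable_finsetSum _ fun c _ => i1 c) fun x => ?_
    simp only [gsq, Finset.mul_sum]
    refine Finset.sum_le_sum fun c _ => ?_
    have := mul_le_mul_of_nonneg_left (G.flux_coercive (fun y => cpt c (f y)) x)
      (mul_self_nonneg (χ x))
    rw [← Finset.mul_sum]; linarith
  have hm : 0 ≤ m ^ 2 * (∫ x, χ x * χ x * (w x * ip (f x) (f x))) :=
    mul_nonneg (sq_nonneg _) (integral_nonneg fun x => mul_nonneg (mul_self_nonneg _)
      (mul_nonneg (by linarith [G.le_w x]) ip_self_nonneg))
  have hY : 0 ≤ ∫ x, χ x * χ x * gsq f x :=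
    integral_nonneg fun x => mul_nonneg (mul_self_nonneg _) (gsq_nonneg f x)
  have hκ := mul_le_mul_of_nonneg_right G.κ1 hY
  linarith

lemma Hop_le (G : Geo κ σ p w ℓ V R) {f : Eu 3 → Fin 4 → ℂ} (hf : Smooth f)
    {χ : Eu 3 → ℝ} (hχ : Smooth χ) (hc : HasCompactSupport χ)
    (h0 : ∀ x, 0 ≤ χ x) (h1 : ∀ x, χ x ≤ 1) {b : ℝ} (hb : ∀ j x, |pd j χ x| ≤ b)
    (hF : Integrable fun x => ip (f x) (f x)) (hG : Integrable (gsq f)) :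
    (1 - 6 * b) * (∫ x, χ x * χ x * (w x * ip (Hop A B f x) (Hop A B f x)))
      ≤ (2 * m ^ 2 + 7 + 30 * b) * ((∫ x, ip (f x) (f x)) + ∫ x, gsq f x) := by
  have h := (abs_le.1 (D.energy_identity G hf hχ hc h0 h1 hb hF hG)).2
  have hcζ : HasCompactSupport fun x => χ x * χ x := hc.mul_left
  have int : ∀ {g : Eu 3 → ℝ}, Continuous g → Integrable fun x => χ x * χ x * g x := fun hg =>
    integrable_cutoff_mul (hχ.mul hχ).continuous hcζ hg
  have hχ2 : ∀ x, χ x * χ x ≤ 1 := fun x => by nlinarith [h0 x, h1 x]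
  have hup : ∑ c, ∫ x, χ x * χ x *
      ∑ j, pd j (fun y => cpt c (f y)) x * flux p w (fun y => cpt c (f y)) j x
      ≤ 6 * ∫ x, gsq f x := by
    rw [← sum_integral_gradN_sq hf hG, Finset.mul_sum]
    refine Finset.sum_le_sum fun c _ => ?_
    rw [← integral_const_mul]
    refine integral_mono (int (continuous_finsetSum _ fun j _ =>
      ((hf.cpt c).pd j).continuous.mul (G.smooth_flux (hf.cpt c) j).continuous))
      ((integrable_gradN_sq hf hG c).const_mul _) fun x => ?_
    have hj : ∀ j, |pd j (fun y => cpt c (f y)) x * flux p w (fun y => cpt c (f y)) j x|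
        ≤ 2 * gradN (fun y => cpt c (f y)) x ^ 2 := fun j => by
      rw [abs_mul]
      have := mul_le_mul (abs_pd_le_gradN (fun y => cpt c (f y)) j x)
        (G.abs_flux_le (fun y => cpt c (f y)) j x) (abs_nonneg _) (gradN_nonneg _ _)
      linarith
    have h3 := le_of_abs_le (abs_sum3_le hj)
    have h4 := mul_le_mul_of_nonneg_left h3 (mul_self_nonneg (χ x))
    have h5 := mul_le_mul_of_nonneg_right (hχ2 x)
      (sq_nonneg (gradN (fun y => cpt c (f y)) x))
    simp only; linarith
  have hm : m ^ 2 * (∫ x, χ x * χ x * (w x * ip (f x) (f x)))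
      ≤ m ^ 2 * (2 * ∫ x, ip (f x) (f x)) := by
    refine mul_le_mul_of_nonneg_left ?_ (sq_nonneg _)
    rw [← integral_const_mul]
    refine integral_mono (int (G.sw.continuous.mulf (continuous_ip hf.continuous hf.continuous)))
      (hF.const_mul _) fun x => ?_
    have i0 : 0 ≤ ip (f x) (f x) := ip_self_nonneg
    have hw := G.le_w x
    calc χ x * χ x * (w x * ip (f x) (f x)) ≤ 1 * (w x * ip (f x) (f x)) :=
          mul_le_mul_of_nonneg_right (hχ2 x) (mul_nonneg (by linarith) i0)
      _ ≤ 2 * ip (f x) (f x) := by nlinarith [G.w_le x]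
  have hY : ∫ x, χ x * χ x * gsq f x ≤ ∫ x, gsq f x :=
    integral_mono (int (continuous_gsq hf)) hG fun x => by
      have := mul_le_mul_of_nonneg_right (hχ2 x) (gsq_nonneg f x)
      simpa using this
  have hY0 : 0 ≤ ∫ x, χ x * χ x * gsq f x :=
    integral_nonneg fun x => mul_nonneg (mul_self_nonneg _) (gsq_nonneg f x)
  have hκ := mul_le_mul_of_nonneg_right G.κ1 hY0
  have hF0 : 0 ≤ ∫ x, ip (f x) (f x) := integral_nonneg fun x => ip_self_nonneg
  have hm0 := mul_nonneg (sq_nonneg m) (hY0.trans hY)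
  linarith

end DOp

end Operator

/-- An exhaustion by cutoffs, with the rate at which their gradients vanish. -/
structure Cutoffs (M : ℝ) (χ : ℕ → Eu 3 → ℝ) : Prop where
  smooth : ∀ n, Smooth (χ n)
  compact : ∀ n, HasCompactSupport (χ n)
  nonneg : ∀ n x, 0 ≤ χ n x
  le_one : ∀ n x, χ n x ≤ 1
  pd_le : ∀ n j x, |pd j (χ n) x| ≤ M / (n + 1)
  tendsto : ∀ x, Filter.Tendsto (fun n => χ n x) Filter.atTop (nhds 1)

lemma tendsto_div_nat (M : ℝ) :
    Filter.Tendsto (fun n : ℕ => M / ((n : ℝ) + 1)) Filter.atTop (nhds 0) :=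
  tendsto_const_nhds.div_atTop (Filter.tendsto_atTop_add_const_right _ _
    tendsto_natCast_atTop_atTop)

lemma integrable_of_integral_cutoff_le {χ : ℕ → Eu 3 → ℝ} (hχ : ∀ n, Continuous (χ n))
    (hc : ∀ n, HasCompactSupport (χ n)) (h0 : ∀ n x, 0 ≤ χ n x)
    (h1 : ∀ x, Filter.Tendsto (fun n => χ n x) Filter.atTop (nhds 1)) {g : Eu 3 → ℝ}
    (hg : Continuous g) (hg0 : ∀ x, 0 ≤ g x) {K : ℕ → ℝ} {L : ℝ}
    (hK : Filter.Tendsto K Filter.atTop (nhds L))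
    (h : ∀ᶠ n in Filter.atTop, ∫ x, χ n x * g x ≤ K n) :
    Integrable g ∧ ∫ x, g x ≤ L := by
  have key : ∫⁻ x, ENNReal.ofReal (g x) ≤ ENNReal.ofReal L := by
    have hlim : ∀ x, Filter.liminf (fun n => ENNReal.ofReal (χ n x * g x)) Filter.atTop
        = ENNReal.ofReal (g x) := fun x => by
      refine Filter.Tendsto.liminf_eq (ENNReal.tendsto_ofReal ?_)
      simpa using (h1 x).mul_const (g x)
    calc ∫⁻ x, ENNReal.ofReal (g x)
        = ∫⁻ x, Filter.liminf (fun n => ENNReal.ofReal (χ n x * g x)) Filter.atTop := by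
          simp only [hlim]
      _ ≤ Filter.liminf (fun n => ∫⁻ x, ENNReal.ofReal (χ n x * g x)) Filter.atTop :=
          lintegral_liminf_le fun n => ((hχ n).mul hg).measurable.ennreal_ofReal
      _ ≤ Filter.liminf (fun n => ENNReal.ofReal (K n)) Filter.atTop := by
          refine Filter.liminf_le_liminf (h.mono fun n hn => ?_)
          rw [← ofReal_integral_eq_lintegral_ofReal (integrable_cutoff_mul (hχ n) (hc n) hg)
            (Filter.Eventually.of_forall fun x => mul_nonneg (h0 n x) (hg0 x))]
          exact ENNReal.ofReal_le_ofReal hn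
      _ = ENNReal.ofReal L := (ENNReal.tendsto_ofReal hK).liminf_eq
  have hi : Integrable g := ⟨hg.aestronglyMeasurable, by
    rw [hasFiniteIntegral_iff_ofReal (Filter.Eventually.of_forall hg0)]
    exact key.trans_lt ENNReal.ofReal_lt_top⟩
  refine ⟨hi, ?_⟩
  have hL : 0 ≤ L := ge_of_tendsto hK (h.mono fun n hn =>
    (integral_nonneg fun x => mul_nonneg (h0 n x) (hg0 x)).trans hn)
  rw [← ofReal_integral_eq_lintegral_ofReal hi (Filter.Eventually.of_forall hg0)] at key
  exact (ENNReal.ofReal_le_ofReal_iff hL).1 key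

namespace Cutoffs

variable {M : ℝ} {χ : ℕ → Eu 3 → ℝ} (K : Cutoffs M χ)
include K

lemma integrable_of_sq_le {g : Eu 3 → ℝ} (hg : Continuous g) (hg0 : ∀ x, 0 ≤ g x) {k : ℕ → ℝ}
    {L : ℝ} (hk : Filter.Tendsto k Filter.atTop (nhds L))
    (h : ∀ᶠ n in Filter.atTop, ∫ x, χ n x * χ n x * g x ≤ k n) :
    Integrable g ∧ ∫ x, g x ≤ L :=
  integrable_of_integral_cutoff_le (χ := fun n x => χ n x * χ n x)
    (fun n => (K.smooth n).continuous.mul (K.smooth n).continuous) (fun n => (K.compact n).mul_left)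
    (fun n x => mul_self_nonneg _) (fun x => by simpa using (K.tendsto x).mul (K.tendsto x))
    hg hg0 hk h

end Cutoffs

lemma integral_cutoff_le {χ g : Eu 3 → ℝ} (hχ : Continuous χ) (hc : HasCompactSupport χ)
    (h1 : ∀ x, χ x ≤ 1) (hg : Continuous g) (hg0 : ∀ x, 0 ≤ g x) (hi : Integrable g) :
    ∫ x, χ x * g x ≤ ∫ x, g x :=
  integral_mono (integrable_cutoff_mul hχ hc hg) hi fun x => by
    simpa using mul_le_mul_of_nonneg_right (h1 x) (hg0 x)

section Operator

variable {A : Fin 3 → Eu 3 → Fin 4 → Fin 4 → ℂ} {B : Eu 3 → Fin 4 → Fin 4 → ℂ}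
  {κ σ m : ℝ} {p : Fin 3 → Fin 3 → Eu 3 → ℝ} {w : Eu 3 → ℝ} {ℓ V : Fin 3 → Eu 3 → ℝ}
  {R : Eu 3 → ℝ}

namespace DOp

variable (D : DOp m p w R A B)
include D

lemma integrable_Hop (G : Geo κ σ p w ℓ V R) {f : Eu 3 → Fin 4 → ℂ} (hf : Smooth f)
    (hF : Integrable fun x => ip (f x) (f x)) (hG : Integrable (gsq f)) :
    Integrable fun x => w x * ip (Hop A B f x) (Hop A B f x) := by
  obtain ⟨M, hM, χ, k1, k2, k3, k4, k5, k6⟩ := exists_cutoffs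
  have K : Cutoffs M χ := ⟨k1, k2, k3, k4, k5, k6⟩
  have sH := D.smooth_Hop hf
  refine (K.integrable_of_sq_le (G.sw.continuous.mulf (continuous_ip sH.continuous sH.continuous))
    (fun x => mul_nonneg (by linarith [G.le_w x]) ip_self_nonneg) (tendsto_const_nhds
    (x := 2 * ((2 * m ^ 2 + 10) * ((∫ x, ip (f x) (f x)) + ∫ x, gsq f x)))) ?_).1
  filter_upwards [(tendsto_div_nat M).eventually_le_const (show (0 : ℝ) < 1 / 12 by norm_num)]
    with n hn
  have h := D.Hop_le G hf (K.smooth n) (K.compact n) (K.nonneg n) (K.le_one n) (K.pd_le n) hF hG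
  have hX : 0 ≤ ∫ x, χ n x * χ n x * (w x * ip (Hop A B f x) (Hop A B f x)) :=
    integral_nonneg fun x => mul_nonneg (mul_self_nonneg _)
      (mul_nonneg (by linarith [G.le_w x]) ip_self_nonneg)
  have hS : 0 ≤ (∫ x, ip (f x) (f x)) + ∫ x, gsq f x :=
    add_nonneg (integral_nonneg fun x => ip_self_nonneg) (integral_nonneg fun x => gsq_nonneg f x)
  have e1 := mul_le_mul_of_nonneg_right hn hX
  have e2 := mul_le_mul_of_nonneg_right hn hS
  linarith

lemma integral_gsq_le (G : Geo κ σ p w ℓ V R) {f : Eu 3 → Fin 4 → ℂ} (hf : Smooth f)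
    (hF : Integrable fun x => ip (f x) (f x)) (hG : Integrable (gsq f)) :
    ∫ x, gsq f x ≤ 3 * ∫ x, w x * ip (Hop A B f x) (Hop A B f x) := by
  obtain ⟨M, hM, χ, k1, k2, k3, k4, k5, k6⟩ := exists_cutoffs
  have K : Cutoffs M χ := ⟨k1, k2, k3, k4, k5, k6⟩
  have sH := D.smooth_Hop hf
  have lim : Filter.Tendsto (fun n : ℕ => 3 * (1 + 6 * (M / ((n : ℝ) + 1)))
        * (∫ x, w x * ip (Hop A B f x) (Hop A B f x))
        + 90 * (M / ((n : ℝ) + 1)) * ((∫ x, ip (f x) (f x)) + ∫ x, gsq f x))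
      Filter.atTop (nhds (3 * ∫ x, w x * ip (Hop A B f x) (Hop A B f x))) := by
    have h := tendsto_div_nat M
    have := (((h.const_mul 6).const_add 1).const_mul 3).mul_const
      (∫ x, w x * ip (Hop A B f x) (Hop A B f x)) |>.add
      ((h.const_mul 90).mul_const ((∫ x, ip (f x) (f x)) + ∫ x, gsq f x))
    simpa using this
  refine (K.integrable_of_sq_le (continuous_gsq hf) (gsq_nonneg f) lim ?_).2
  refine Filter.Eventually.of_forall fun n => ?_
  refine (D.gradient_le G hf (K.smooth n) (K.compact n) (K.nonneg n) (K.le_one n) (K.pd_le n) hF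
    hG).trans (add_le_add_left (mul_le_mul_of_nonneg_left ?_ ?_) _)
  · have hcζ : HasCompactSupport fun x => χ n x * χ n x := (K.compact n).mul_left
    refine integral_cutoff_le (χ := fun x => χ n x * χ n x)
      ((K.smooth n).mul (K.smooth n)).continuous hcζ
      (fun x => by nlinarith [K.nonneg n x, K.le_one n x])
      (G.sw.continuous.mulf (continuous_ip sH.continuous sH.continuous))
      (fun x => mul_nonneg (by linarith [G.le_w x]) ip_self_nonneg) (D.integrable_Hop G hf hF hG)
  · positivity

end DOp

end Operator

/-- Closed forward half of space-time. -/
abbrev fwd : Set (ℝ × Eu 3) := Ici (0 : ℝ) ×ˢ univ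

/-- Joint smoothness up to the initial time. -/
def JS {E : Type*} [NormedAddCommGroup E] [NormedSpace ℝ E] (F : ℝ → Eu 3 → E) : Prop :=
  ContDiffOn ℝ (⊤ : ℕ∞) (fun q : ℝ × Eu 3 => F q.1 q.2) fwd

/-- Derivative of a function on forward space-time in a fixed direction. -/
def DD {E : Type*} [NormedAddCommGroup E] [NormedSpace ℝ E] (v : ℝ × Eu 3) (F : ℝ → Eu 3 → E)
    (t : ℝ) (x : Eu 3) : E :=
  fderivWithin ℝ (fun q : ℝ × Eu 3 => F q.1 q.2) fwd (t, x) v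

lemma uniqueDiffOn_fwd : UniqueDiffOn ℝ fwd := (uniqueDiffOn_Ici 0).prod uniqueDiffOn_univ

section

variable {E E' : Type*} [NormedAddCommGroup E] [NormedSpace ℝ E] [NormedAddCommGroup E']
  [NormedSpace ℝ E'] {F : ℝ → Eu 3 → E}

lemma mem_fwd {t : ℝ} (ht : 0 ≤ t) (x : Eu 3) : (t, x) ∈ fwd := ⟨ht, mem_univ _⟩

lemma JS.differentiableWithinAt (h : JS F) {t : ℝ} (ht : 0 ≤ t) (x : Eu 3) :
    DifferentiableWithinAt ℝ (fun q : ℝ × Eu 3 => F q.1 q.2) fwd (t, x) :=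
  h.differentiableOn (by simp) _ (mem_fwd ht x)

lemma JS.continuousOn (h : JS F) : ContinuousOn (fun q : ℝ × Eu 3 => F q.1 q.2) fwd :=
  ContDiffOn.continuousOn h

lemma JS.congr {F' : ℝ → Eu 3 → E} (h : JS F) (hF : ∀ t, 0 ≤ t → ∀ x, F' t x = F t x) : JS F' :=
  ContDiffOn.congr h fun q hq => hF q.1 hq.1 q.2

lemma JS.of_smooth {f : Eu 3 → E} (hf : Smooth f) : JS fun _ => f :=
  (hf.comp contDiff_snd).contDiffOn

lemma JS.add {F' : ℝ → Eu 3 → E} (h : JS F) (h' : JS F') : JS fun t x => F t x + F' t x :=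
  ContDiffOn.add h h'

lemma JS.mul {f g : ℝ → Eu 3 → ℝ} (h : JS f) (h' : JS g) : JS fun t x => f t x * g t x :=
  ContDiffOn.mul h h'

lemma JS.sum {ι : Type*} {s : Finset ι} {f : ι → ℝ → Eu 3 → E} (h : ∀ i, JS (f i)) :
    JS fun t x => ∑ i ∈ s, f i t x := ContDiffOn.sum fun i _ => h i

lemma JS.clm (L : E →L[ℝ] E') (h : JS F) : JS fun t x => L (F t x) :=
  L.contDiff.comp_contDiffOn h

lemma JS.slice (h : JS F) {t : ℝ} (ht : 0 ≤ t) : Smooth (F t) := by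
  have h1 : ContDiffOn ℝ (⊤ : ℕ∞) (fun x : Eu 3 => (t, x)) univ :=
    (contDiff_const.prodMk contDiff_id).contDiffOn
  have h2 : ContDiffOn ℝ (⊤ : ℕ∞) ((fun q : ℝ × Eu 3 => F q.1 q.2) ∘ fun x => (t, x)) univ :=
    ContDiffOn.comp h h1 fun x _ => mem_fwd ht x
  exact contDiffOn_univ.1 h2

lemma JS.smooth_DD (h : JS F) (v : ℝ × Eu 3) : JS (DD v F) :=
  (ContDiffOn.fderivWithin h uniqueDiffOn_fwd (m := (⊤ : ℕ∞)) (by simp)).clm_apply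
    contDiffOn_const

lemma JS.pd_eq (h : JS F) (j : Fin 3) {t : ℝ} (ht : 0 ≤ t) (x : Eu 3) :
    pd j (F t) x = DD (0, EuclideanSpace.single j 1) F t x := by
  have h1 : HasFDerivAt (fun x : Eu 3 => (t, x)) ((0 : Eu 3 →L[ℝ] ℝ).prod (.id ℝ (Eu 3))) x :=
    (hasFDerivAt_const t x).prodMk (hasFDerivAt_id x)
  have h2 := (h.differentiableWithinAt ht x).hasFDerivWithinAt.comp x
    (h1.hasFDerivWithinAt (s := univ)) fun y _ => mem_fwd ht y
  have h3 := (hasFDerivWithinAt_univ.1 h2).fderiv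
  have h4 : pd j (F t) x = fderiv ℝ ((fun q : ℝ × Eu 3 => F q.1 q.2) ∘ fun x => (t, x)) x
    (EuclideanSpace.single j 1) := rfl
  rw [h4, h3]; simp [DD]

lemma JS.smooth_pd (h : JS F) (j : Fin 3) : JS fun t => pd j (F t) :=
  (h.smooth_DD (0, EuclideanSpace.single j 1)).congr fun _ ht x => h.pd_eq j ht x

lemma JS.hasDerivWithinAt (h : JS F) {t : ℝ} (ht : 0 ≤ t) (x : Eu 3) :
    HasDerivWithinAt (fun s => F s x) (DD (1, 0) F t x) (Ici 0) t := by
  have h1 : HasDerivAt (fun s : ℝ => (s, x)) ((1 : ℝ), (0 : Eu 3)) t :=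
    (hasDerivAt_id t).prodMk (hasDerivAt_const t x)
  exact (h.differentiableWithinAt ht x).hasFDerivWithinAt.comp_hasDerivWithinAt t
    h1.hasDerivWithinAt fun s hs => mem_fwd hs x

lemma JS.DD_time_eq (h : JS F) {t : ℝ} (ht : 0 ≤ t) {x : Eu 3} {F' : E}
    (hF : HasDerivWithinAt (fun s => F s x) F' (Ici 0) t) : DD (1, 0) F t x = F' :=
  (uniqueDiffOn_Ici (0 : ℝ) t ht).eq_deriv _ (h.hasDerivWithinAt ht x) hF

lemma JS.DD_comm (h : JS F) (v v' : ℝ × Eu 3) {t : ℝ} (ht : 0 ≤ t) (x : Eu 3) :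
    DD v (DD v' F) t x = DD v' (DD v F) t x := by
  have hd : DifferentiableWithinAt ℝ (fderivWithin ℝ (fun q : ℝ × Eu 3 => F q.1 q.2) fwd) fwd
      (t, x) :=
    (ContDiffOn.fderivWithin h uniqueDiffOn_fwd (m := (⊤ : ℕ∞)) (by simp)).differentiableOn
      (by simp) _ (mem_fwd ht x)
  have e : ∀ v v' : ℝ × Eu 3, DD v (DD v' F) t x
      = fderivWithin ℝ (fderivWithin ℝ (fun q : ℝ × Eu 3 => F q.1 q.2) fwd) fwd (t, x) v v' := by
    intro v v'
    have := fderivWithin_clm_apply (uniqueDiffOn_fwd _ (mem_fwd ht x)) hd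
      (differentiableWithinAt_const (c := v'))
    simp only [DD]
    rw [this]; simp
  rw [e, e]
  refine (ContDiffWithinAt.isSymmSndFDerivWithinAt (h _ (mem_fwd ht x)) ?_ uniqueDiffOn_fwd ?_
    (mem_fwd ht x)) v v'
  · rw [minSmoothness_of_isRCLikeNormedField]; exact WithTop.coe_le_coe.2 (le_top : (2 : ℕ∞) ≤ ⊤)
  · rw [interior_prod_eq, interior_Ici, interior_univ, closure_prod_eq, closure_Ioi, closure_univ]
    exact mem_fwd ht x

lemma JS.DD_pd (h : JS F) (j : Fin 3) {t : ℝ} (ht : 0 ≤ t) (x : Eu 3) :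
    DD (1, 0) (fun t => pd j (F t)) t x = pd j (DD (1, 0) F t) x := by
  rw [(h.smooth_DD (1, 0)).pd_eq j ht, h.DD_comm _ _ ht]
  exact (h.smooth_pd j).DD_time_eq ht (((h.smooth_DD _).hasDerivWithinAt ht x).congr
    (fun s hs => h.pd_eq j hs x) (h.pd_eq j ht x))

lemma JS.DD_clm (L : E →L[ℝ] E') (h : JS F) {t : ℝ} (ht : 0 ≤ t) (x : Eu 3) :
    DD (1, 0) (fun t x => L (F t x)) t x = L (DD (1, 0) F t x) :=
  (h.clm L).DD_time_eq ht (L.hasFDerivAt.comp_hasDerivWithinAt t (h.hasDerivWithinAt ht x))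

end

section Integral

variable {K : ℝ → Eu 3 → ℝ} {S : Set (Eu 3)}

lemma JS.continuousOn_integral (hS : IsCompact S) (hK : ContinuousOn (fun q : ℝ × Eu 3 => K q.1 q.2) fwd)
    (h0 : ∀ t, 0 ≤ t → ∀ x, x ∉ S → K t x = 0) : ContinuousOn (fun t => ∫ x, K t x) (Ici 0) :=
  continuousOn_integral_of_compact_support hS hK fun t x ht hx => h0 t ht x hx

lemma JS.hasDerivAt_integral (hK : JS K) (hS : IsCompact S)
    (h0 : ∀ t, 0 ≤ t → ∀ x, x ∉ S → K t x = 0) {t : ℝ} (ht : 0 < t) :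
    HasDerivAt (fun t => ∫ x, K t x) (∫ x, DD (1, 0) K t x) t := by
  have hD := hK.smooth_DD (1, 0)
  have hD0 : ∀ s, 0 ≤ s → ∀ x, x ∉ S → DD (1, 0) K s x = 0 := fun s hs x hx =>
    hK.DD_time_eq hs ((hasDerivWithinAt_const s (Ici 0) (0 : ℝ)).congr
      (fun r hr => h0 r hr x hx) (h0 s hs x hx))
  have hcpt : IsCompact (Icc (t / 2) (2 * t) ×ˢ S) := isCompact_Icc.prod hS
  have hsub : Icc (t / 2) (2 * t) ×ˢ S ⊆ fwd := fun q hq =>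
    mem_fwd (by linarith [hq.1.1]) q.2
  obtain ⟨C, hC⟩ := hcpt.exists_bound_of_continuousOn (hD.continuousOn.mono hsub)
  have hsup : ∀ {g : Eu 3 → ℝ}, (∀ x, x ∉ S → g x = 0) → HasCompactSupport g := fun hg =>
    HasCompactSupport.intro hS hg
  have hnhds : Ioo (t / 2) (2 * t) ∈ nhds t := Ioo_mem_nhds (by linarith) (by linarith)
  refine (hasDerivAt_integral_of_dominated_loc_of_deriv_le (bound := S.indicator fun _ => C)
    hnhds ?_ ?_ ?_ ?_ ?_ ?_).2
  · filter_upwards [hnhds] with s hs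
    exact (hK.slice (by linarith [hs.1])).continuous.aestronglyMeasurable
  · exact (hK.slice ht.le).continuous.integrable_of_hasCompactSupport (hsup (h0 t ht.le))
  · exact (hD.slice ht.le).continuous.aestronglyMeasurable
  · refine Filter.Eventually.of_forall fun x s hs => ?_
    by_cases hx : x ∈ S
    · rw [indicator_of_mem hx]
      exact hC (s, x) ⟨⟨hs.1.le, hs.2.le⟩, hx⟩
    · rw [indicator_of_notMem hx, hD0 s (by linarith [hs.1]) x hx, norm_zero]
  · exact (integrable_indicator_iff hS.measurableSet).2 (integrableOn_const hS.measure_ne_top)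
  · refine Filter.Eventually.of_forall fun x s hs => ?_
    have hs0 : 0 < s := by linarith [hs.1]
    exact (hK.hasDerivWithinAt hs0.le x).hasDerivAt (Ici_mem_nhds hs0)

end Integral

/-! ### Finite speed of propagation -/

lemma JS.smooth_Hop {A : Fin 3 → Eu 3 → Fin 4 → Fin 4 → ℂ} {B : Eu 3 → Fin 4 → Fin 4 → ℂ}
    (hA : ∀ j i k, Smooth fun x => A j x i k) (hB : ∀ i k, Smooth fun x => B x i k)
    {v : ℝ → Eu 3 → Fin 4 → ℂ} (hv : JS v) : JS fun t => Hop A B (v t) :=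
  contDiffOn_pi.2 fun i => ContDiffOn.add
    (ContDiffOn.sum fun j _ => ContDiffOn.sum fun k _ =>
      ContDiffOn.mul (𝔸 := ℂ) (JS.of_smooth (hA j i k)) (contDiffOn_pi.1 (hv.smooth_pd j) k))
    (ContDiffOn.sum fun k _ =>
      ContDiffOn.mul (𝔸 := ℂ) (JS.of_smooth (hB i k)) (contDiffOn_pi.1 hv k))

lemma JS.DD_Hop {A : Fin 3 → Eu 3 → Fin 4 → Fin 4 → ℂ} {B : Eu 3 → Fin 4 → Fin 4 → ℂ}
    (hA : ∀ j i k, Smooth fun x => A j x i k) (hB : ∀ i k, Smooth fun x => B x i k)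
    {v : ℝ → Eu 3 → Fin 4 → ℂ} (hv : JS v) {t : ℝ} (ht : 0 ≤ t) (x : Eu 3) :
    DD (1, 0) (fun t => Hop A B (v t)) t x = Hop A B (DD (1, 0) v t) x := by
  refine (JS.smooth_Hop hA hB hv).DD_time_eq ht (hasDerivWithinAt_pi.2 fun i => ?_)
  have h1 : ∀ j k, HasDerivWithinAt (fun s => pd j (v s) x k) (pd j (DD (1, 0) v t) x k)
      (Ici 0) t := fun j k => by
    rw [← hv.DD_pd j ht]
    exact hasDerivWithinAt_pi.1 ((hv.smooth_pd j).hasDerivWithinAt ht x) k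
  have h2 : ∀ k, HasDerivWithinAt (fun s => v s x k) (DD (1, 0) v t x k) (Ici 0) t :=
    hasDerivWithinAt_pi.1 (hv.hasDerivWithinAt ht x)
  exact (HasDerivWithinAt.fun_sum fun j _ => HasDerivWithinAt.fun_sum fun k _ =>
    (h1 j k).const_mul (A j x i k)).fun_add
      (HasDerivWithinAt.fun_sum fun k _ => (h2 k).const_mul (B x i k))

/-- Smooth solutions of `iφ∂ₜv = Hv`. -/
structure Evol (φ : ℝ → ℝ) (A : Fin 3 → Eu 3 → Fin 4 → Fin 4 → ℂ)
    (B : Eu 3 → Fin 4 → Fin 4 → ℂ) (v : ℝ → Eu 3 → Fin 4 → ℂ) : Prop where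
  smooth : JS v
  eq : ∀ t, 0 ≤ t → ∀ x, DD (1, 0) v t x = (-(φ t)⁻¹) • (Complex.I • Hop A B (v t) x)

/-- A decreasing cutoff. -/
def dcut (s : ℝ) : ℝ := Real.smoothTransition (1 - s)

lemma contDiff_dcut : ContDiff ℝ (⊤ : ℕ∞) dcut :=
  Real.smoothTransition.contDiff.comp (contDiff_const.sub contDiff_id)

lemma dcut_nonneg (s : ℝ) : 0 ≤ dcut s := Real.smoothTransition.nonneg _

lemma dcut_le_one (s : ℝ) : dcut s ≤ 1 := Real.smoothTransition.le_one _

lemma dcut_eq_one {s : ℝ} (hs : s ≤ 0) : dcut s = 1 :=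
  Real.smoothTransition.one_of_one_le (by linarith)

lemma dcut_eq_zero {s : ℝ} (hs : 1 ≤ s) : dcut s = 0 :=
  Real.smoothTransition.zero_of_nonpos (by linarith)

lemma deriv_dcut_nonpos (s : ℝ) : deriv dcut s ≤ 0 :=
  (show Antitone dcut from fun a b hab => Real.smoothTransition.monotone (by linarith)).deriv_nonpos

lemma hasDerivAt_dcut (s : ℝ) : HasDerivAt dcut (deriv dcut s) s :=
  (contDiff_dcut.differentiable (by simp) s).hasDerivAt

lemma abs_pd_jap_le (j : Fin 3) (x : Eu 3) : |pd j jap x| ≤ 1 := by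
  rw [pd_jap, abs_mul, abs_inv, abs_of_pos (jap_pos x), ← div_eq_mul_inv, div_le_one (jap_pos x)]
  exact (abs_coord_le x j).trans (norm_le_jap x)

lemma smooth_dcut_jap (c : ℝ) : Smooth fun x : Eu 3 => dcut (jap x + c) :=
  contDiff_dcut.comp (smooth_jap.add contDiff_const)

lemma pd_dcut_jap (c : ℝ) (j : Fin 3) (x : Eu 3) :
    pd j (fun x => dcut (jap x + c)) x = deriv dcut (jap x + c) * pd j jap x := by
  have h1 : HasFDerivAt (fun x : Eu 3 => jap x + c) (fderiv ℝ jap x) x :=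
    (smooth_jap.differentiable (by simp) x).hasFDerivAt.add_const c
  have h2 := (hasDerivAt_dcut (jap x + c)).comp_hasFDerivAt x h1
  have h3 : fderiv ℝ (fun x => dcut (jap x + c)) x = _ := h2.fderiv
  simp [pd, h3]

lemma dcut_jap_eq_zero {c : ℝ} {x : Eu 3} (hx : x ∉ Metric.closedBall (0 : Eu 3) (1 - c)) :
    dcut (jap x + c) = 0 := by
  have h := norm_le_jap x
  simp only [Metric.mem_closedBall, dist_zero_right, not_le] at hx
  exact dcut_eq_zero (by linarith)

lemma hasCompactSupport_dcut_jap (c : ℝ) : HasCompactSupport fun x : Eu 3 => dcut (jap x + c) :=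
  HasCompactSupport.intro (isCompact_closedBall 0 (1 - c)) fun _ hx => dcut_jap_eq_zero hx

lemma continuous_deriv_dcut_jap (c : ℝ) : Continuous fun x : Eu 3 => deriv dcut (jap x + c) :=
  (contDiff_dcut.continuous_deriv (by simp)).comp (smooth_jap.continuous.add continuous_const)

lemma hasCompactSupport_deriv_dcut_jap (c : ℝ) :
    HasCompactSupport fun x : Eu 3 => deriv dcut (jap x + c) := by
  refine HasCompactSupport.intro (isCompact_closedBall 0 (2 - c)) fun x hx => ?_
  have h := norm_le_jap x
  simp only [Metric.mem_closedBall, dist_zero_right, not_le] at hx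
  have h1 : dcut =ᶠ[nhds (jap x + c)] fun _ => 0 := by
    filter_upwards [Ioi_mem_nhds (show 1 < jap x + c by linarith)] with s hs
    exact dcut_eq_zero (le_of_lt hs)
  rw [h1.deriv_eq, deriv_const]

section

variable {A : Fin 3 → Eu 3 → Fin 4 → Fin 4 → ℂ} {B : Eu 3 → Fin 4 → Fin 4 → ℂ}
  {κ σ m : ℝ} {p : Fin 3 → Fin 3 → Eu 3 → ℝ} {w : Eu 3 → ℝ} {ℓ V : Fin 3 → Eu 3 → ℝ}
  {R : Eu 3 → ℝ} {φ : ℝ → ℝ} {v : ℝ → Eu 3 → Fin 4 → ℂ}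

lemma Evol.comp_Hop (D : DOp m p w R A B) (hv : Evol φ A B v) : Evol φ A B fun t => Hop A B (v t) where
  smooth := JS.smooth_Hop D.sA D.sB hv.smooth
  eq t ht x := by
    have h : DD (1, 0) v t = fun y => (-(φ t)⁻¹) • (Complex.I • Hop A B (v t) y) :=
      funext (hv.eq t ht)
    have hs := D.smooth_Hop (hv.smooth.slice ht)
    rw [JS.DD_Hop D.sA D.sB hv.smooth ht, h, Hop_smul (Smooth.const _) (hs.const_smul Complex.I),
      Hop_I_smul hs]
    simp [pd_const]

namespace DOp

variable (D : DOp m p w R A B)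
include D

lemma integral_cutoff_I_Hop (sw : Smooth w) {f : Eu 3 → Fin 4 → ℂ} {χ : Eu 3 → ℝ}
    (hf : Smooth f) (hχ : Smooth χ) (hc : HasCompactSupport χ) :
    2 * ∫ x, χ x * (w x * ip (Complex.I • Hop A B f x) (f x))
      = -∫ x, w x * ∑ j, pd j χ x * ip (f x) (symb A j x (Complex.I • f x)) := by
  have h := D.symm_cutoff sw (g := fun y => Complex.I • f y) hf (hf.const_smul Complex.I) hχ hc
  have e1 : ∀ x, ip (Hop A B f x) (Complex.I • f x) = -ip (Complex.I • Hop A B f x) (f x) :=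
    fun x => by rw [ip_I_smul_left, neg_neg]
  have e2 : ∀ x, ip (f x) (Hop A B (fun y => Complex.I • f y) x)
      = ip (Complex.I • Hop A B f x) (f x) := fun x => by rw [Hop_I_smul hf, ip_comm]
  simp only [e1, e2, mul_neg, integral_neg] at h
  linarith

lemma energy_dcut_nonpos (G : Geo κ σ p w ℓ V R) {f : Eu 3 → Fin 4 → ℂ} (hf : Smooth f)
    {a k : ℝ} (ha : 0 ≤ a) (hk : 5 * a ≤ k) (c : ℝ) :
    k * (∫ x, deriv dcut (jap x + c) * (w x * ip (f x) (f x)))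
      - 2 * a * (∫ x, dcut (jap x + c) * (w x * ip (Complex.I • Hop A B f x) (f x))) ≤ 0 := by
  have hχ := smooth_dcut_jap c
  have hc := hasCompactSupport_dcut_jap c
  have h := D.integral_cutoff_I_Hop G.sw hf hχ hc
  have e : ∀ x, w x * ∑ j, pd j (fun x => dcut (jap x + c)) x
      * ip (f x) (symb A j x (Complex.I • f x)) = deriv dcut (jap x + c) *
        (w x * ∑ j, pd j jap x * ip (f x) (symb A j x (Complex.I • f x))) := fun x => by
    simp only [pd_dcut_jap, Finset.mul_sum]
    exact Finset.sum_congr rfl fun j _ => by ring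
  simp only [e] at h
  have hd := continuous_deriv_dcut_jap c
  have hdc := hasCompactSupport_deriv_dcut_jap c
  have i1 := integrable_cutoff_mul hd hdc
    (G.sw.continuous.mulf (continuous_ip hf.continuous hf.continuous))
  have i2 := integrable_cutoff_mul hd hdc (G.sw.continuous.mulf (continuous_finsetSum Finset.univ
    fun j _ => (smooth_jap.pd j).continuous.mulf (continuous_ip hf.continuous
      (D.smooth_symb j (hf.const_smul Complex.I)).continuous)))
  have key : k * (∫ x, deriv dcut (jap x + c) * (w x * ip (f x) (f x)))
      + a * (∫ x, deriv dcut (jap x + c) *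
        (w x * ∑ j, pd j jap x * ip (f x) (symb A j x (Complex.I • f x)))) ≤ 0 := by
    rw [← integral_const_mul, ← integral_const_mul,
      ← integral_add (i1.const_mul k) (i2.const_mul a)]
    refine integral_nonpos fun x => ?_
    have hw := G.le_w x
    have hn : 0 ≤ ip (f x) (f x) := ip_self_nonneg
    have h1 : |∑ j, pd j jap x * ip (f x) (symb A j x (Complex.I • f x))|
        ≤ 9 / 2 * ip (f x) (f x) := by
      have h3 : ∀ j, |pd j jap x * ip (f x) (symb A j x (Complex.I • f x))|
          ≤ 3 / 2 * ip (f x) (f x) := fun j => by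
        have := D.abs_ip_symb_le G j x (f x) (Complex.I • f x)
        rw [ip_I_smul_self] at this
        rw [abs_mul]
        have := mul_le_mul (abs_pd_jap_le j x) this (abs_nonneg _) zero_le_one
        linarith
      refine (Finset.abs_sum_le_sum_abs _ _).trans ((Finset.sum_le_sum fun j _ => h3 j).trans ?_)
      simp; linarith
    have h2 := (abs_le.1 h1).1
    have h4 : 0 ≤ k * ip (f x) (f x)
        + a * ∑ j, pd j jap x * ip (f x) (symb A j x (Complex.I • f x)) := by
      have := mul_le_mul_of_nonneg_left h2 ha
      have := mul_le_mul_of_nonneg_right hk hn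
      nlinarith [mul_nonneg ha hn]
    have h5 := mul_nonneg (show 0 ≤ w x by linarith) h4
    have h6 := mul_nonneg (neg_nonneg.2 (deriv_dcut_nonpos (jap x + c))) h5
    simp only [Pi.zero_apply]
    linarith
  linear_combination key - a * h

end DOp

/-- The charge of a solution does not increase. -/
lemma Evol.charge_le (D : DOp m p w R A B) (G : Geo κ σ p w ℓ V R) (hv : Evol φ A B v)
    (hφ : ContinuousOn φ (Ici 0)) (hφ0 : ∀ t, 0 ≤ t → 0 < φ t)
    (h0 : Integrable fun x => w x * ip (v 0 x) (v 0 x)) {T : ℝ} (hT : 0 ≤ T) :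
    (Integrable fun x => w x * ip (v T x) (v T x)) ∧
      ∫ x, w x * ip (v T x) (v T x) ≤ ∫ x, w x * ip (v 0 x) (v 0 x) := by
  obtain ⟨a, ha⟩ : ∃ a, ∀ t ∈ Icc 0 T, ‖(φ t)⁻¹‖ ≤ a :=
    isCompact_Icc.exists_bound_of_continuousOn
      ((hφ.mono fun t ht => ht.1).inv₀ fun t ht => (hφ0 t ht.1).ne')
  have hw : ∀ x, 0 ≤ w x := fun x => by linarith [G.le_w x]
  set k := 5 * a with hk
  have ha0 : 0 ≤ a := (norm_nonneg _).trans (ha 0 ⟨le_rfl, hT⟩)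
  have sip : JS fun t x => ip (v t x) (v t x) :=
    ContDiffOn.sum fun c _ => (hv.smooth.clm (cpt c)).mul (hv.smooth.clm (cpt c))
  have main : ∀ n : ℕ, ∫ x, dcut (jap x + -(n : ℝ)) * (w x * ip (v T x) (v T x))
      ≤ ∫ x, w x * ip (v 0 x) (v 0 x) := by
    intro n
    set ρ := n + k * T with hρ
    set K : ℝ → Eu 3 → ℝ := fun t x => dcut (jap x + (k * t - ρ)) * (w x * ip (v t x) (v t x))
      with hK
    have sK : JS K := by
      refine JS.mul ?_ ((JS.of_smooth G.sw).mul sip)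
      exact (contDiff_dcut.comp ((smooth_jap.comp contDiff_snd).add
        ((contDiff_const.mul contDiff_fst).sub contDiff_const))).contDiffOn
    have zK : ∀ t, 0 ≤ t → ∀ x, x ∉ Metric.closedBall (0 : Eu 3) (1 + ρ) → K t x = 0 := by
      intro t ht x hx
      have : dcut (jap x + (k * t - ρ)) = 0 := dcut_jap_eq_zero fun hx' => hx <|
        Metric.closedBall_subset_closedBall
          (by linarith [mul_nonneg (show 0 ≤ k by positivity) ht]) hx'
      simp [hK, this]
    have dK : ∀ t, 0 ≤ t → ∀ x, DD (1, 0) K t x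
        = k * (deriv dcut (jap x + (k * t - ρ)) * (w x * ip (v t x) (v t x)))
          - 2 * (φ t)⁻¹ * (dcut (jap x + (k * t - ρ))
            * (w x * ip (Complex.I • Hop A B (v t) x) (v t x))) := by
      intro t ht x
      have e1 : HasDerivAt (fun s => jap x + (k * s - ρ)) k t := by
        simpa using (((hasDerivAt_id t).const_mul k).sub_const ρ).const_add (jap x)
      have e2 := (hasDerivAt_dcut (jap x + (k * t - ρ))).comp t e1
      have e3 : ∀ c, HasDerivWithinAt (fun s => cpt c (v s x))
          (cpt c (DD (1, 0) v t x)) (Ici 0) t := fun c =>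
        (cpt c).hasFDerivAt.comp_hasDerivWithinAt t (hv.smooth.hasDerivWithinAt ht x)
      have e4 : HasDerivWithinAt (fun s => ip (v s x) (v s x))
          (2 * ip (DD (1, 0) v t x) (v t x)) (Ici 0) t := by
        refine (HasDerivWithinAt.fun_sum (u := Finset.univ) fun c _ => (e3 c).mul (e3 c)).congr_deriv
          ?_
        simp only [ip, Finset.mul_sum]
        exact Finset.sum_congr rfl fun c _ => by ring
      rw [sK.DD_time_eq ht (e2.hasDerivWithinAt.mul (e4.const_mul (w x))), hv.eq t ht,
        ip_smul_left]
      simp only [Function.comp]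
      ring
    have hanti : AntitoneOn (fun t => ∫ x, K t x) (Icc 0 T) := by
      have hd : ∀ t, 0 < t → HasDerivAt (fun t => ∫ x, K t x) (∫ x, DD (1, 0) K t x) t :=
        fun t ht => sK.hasDerivAt_integral (isCompact_closedBall 0 (1 + ρ)) zK ht
      refine antitoneOn_of_deriv_nonpos (convex_Icc 0 T)
        ((JS.continuousOn_integral (isCompact_closedBall 0 (1 + ρ)) sK.continuousOn zK).mono
          fun t ht => ht.1) (fun t ht => ?_) fun t ht => ?_ <;> rw [interior_Icc] at ht
      · exact (hd t ht.1).differentiableAt.differentiableWithinAt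
      · rw [(hd t ht.1).deriv]
        have hs := hv.smooth.slice ht.1.le
        have hφt := ha t ⟨ht.1.le, ht.2.le⟩
        have hi := inv_pos.2 (hφ0 t ht.1.le)
        rw [Real.norm_of_nonneg hi.le] at hφt
        refine le_trans (le_of_eq ?_) (D.energy_dcut_nonpos G hs hi.le
          (show 5 * (φ t)⁻¹ ≤ k by linarith) (k * t - ρ))
        simp only [dK t ht.1.le]
        have sd := smooth_dcut_jap (k * t - ρ)
        have hc := hasCompactSupport_dcut_jap (k * t - ρ)
        have i2 := integrable_cutoff_mul sd.continuous hc (G.sw.continuous.mulf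
          (continuous_ip ((D.smooth_Hop hs).const_smul Complex.I).continuous hs.continuous))
        have i3 := integrable_cutoff_mul (continuous_deriv_dcut_jap (k * t - ρ))
          (hasCompactSupport_deriv_dcut_jap (k * t - ρ))
          (G.sw.continuous.mulf (continuous_ip hs.continuous hs.continuous))
        rw [integral_sub (i3.const_mul _) (i2.const_mul _), integral_const_mul, integral_const_mul]
    have h1 := hanti ⟨le_rfl, hT⟩ ⟨hT, le_rfl⟩ hT
    have e1 : ∀ x, K T x = dcut (jap x + -(n : ℝ)) * (w x * ip (v T x) (v T x)) := fun x => by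
      simp only [hK, hρ]; congr 2; ring
    simp only [e1] at h1
    refine h1.trans (integral_mono_of_nonneg (Filter.Eventually.of_forall fun x =>
      mul_nonneg (dcut_nonneg _) (mul_nonneg (hw x) ip_self_nonneg)) h0
      (Filter.Eventually.of_forall fun x => ?_))
    exact mul_le_of_le_one_left (mul_nonneg (hw x) ip_self_nonneg) (dcut_le_one _)
  have hs := hv.smooth.slice hT
  refine integrable_of_integral_cutoff_le (fun n => (smooth_dcut_jap (-(n : ℝ))).continuous)
    (fun n => hasCompactSupport_dcut_jap _) (fun n x => dcut_nonneg _) (fun x => ?_)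
    (G.sw.continuous.mulf (continuous_ip hs.continuous hs.continuous))
    (fun x => mul_nonneg (hw x) ip_self_nonneg) tendsto_const_nhds (Filter.Eventually.of_forall main)
  refine tendsto_const_nhds.congr' ?_
  filter_upwards [Filter.eventually_ge_atTop ⌈jap x⌉₊] with n hn
  exact (dcut_eq_one (by linarith [Nat.le_ceil (jap x), (Nat.cast_le (α := ℝ)).2 hn])).symm

/-! ### The virial estimate along the flow -/

/-- The weighted density of `f` and its gradient. -/
def spS (δ : ℝ) (f : Eu 3 → Fin 4 → ℂ) (x : Eu 3) : ℝ := ∑ c, morS δ (fun y => cpt c (f y)) x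

lemma spS_eq (δ : ℝ) (f : Eu 3 → Fin 4 → ℂ) (x : Eu 3) :
    spS δ f x = ji x * jd δ x * gsq f x + ji x ^ 3 * jd δ x * ip (f x) (f x) := by
  simp only [spS, morS, gsq, ip, Finset.mul_sum, Finset.sum_add_distrib, sq]

lemma spS_nonneg (δ : ℝ) (f : Eu 3 → Fin 4 → ℂ) (x : Eu 3) : 0 ≤ spS δ f x :=
  Finset.sum_nonneg fun _ _ => morS_nonneg _ _ _

lemma continuous_spS (δ : ℝ) {f : Eu 3 → Fin 4 → ℂ} (hf : Smooth f) : Continuous (spS δ f) :=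
  continuous_finsetSum _ fun c _ => continuous_morS δ (hf.cpt c)

lemma spS_le {δ : ℝ} (h0 : 0 ≤ δ) (f : Eu 3 → Fin 4 → ℂ) (x : Eu 3) :
    spS δ f x ≤ gsq f x + ip (f x) (f x) := by
  rw [spS_eq]
  have h1 := ji_le_one x
  have h2 := jd_le_one h0 x
  have h3 := (ji_pos x).le
  have h4 := (jd_pos δ x).le
  exact add_le_add
    (mul_le_of_le_one_left (gsq_nonneg f x) (mul_le_one₀ h1 h4 h2))
    (mul_le_of_le_one_left ip_self_nonneg (mul_le_one₀ (pow_le_one₀ h3 h1) h4 h2))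

section

variable {A : Fin 3 → Eu 3 → Fin 4 → Fin 4 → ℂ} {B : Eu 3 → Fin 4 → Fin 4 → ℂ}
  {κ σ m : ℝ} {p : Fin 3 → Fin 3 → Eu 3 → ℝ} {w : Eu 3 → ℝ} {ℓ V : Fin 3 → Eu 3 → ℝ}
  {R : Eu 3 → ℝ} {φ : ℝ → ℝ} {u : ℝ → Eu 3 → Fin 4 → ℂ}

lemma sum_integral_cutoff_morS (δ : ℝ) {f : Eu 3 → Fin 4 → ℂ} {χ : Eu 3 → ℝ} (hf : Smooth f)
    (hχ : Continuous χ) (hc : HasCompactSupport χ) :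
    ∑ c, ∫ x, χ x * morS δ (fun y => cpt c (f y)) x = ∫ x, χ x * spS δ f x := by
  rw [← integral_finsetSum _ fun c _ => integrable_cutoff_mul hχ hc (continuous_morS δ (hf.cpt c))]
  simp only [spS, Finset.mul_sum]

namespace Geo

variable (G : Geo κ σ p w ℓ V R)
include G

lemma integrable_weight_cpt_sq {g : Eu 3 → Fin 4 → ℂ} (hg : Smooth g)
    (hF : Integrable fun x => w x * ip (g x) (g x)) (c : Fin 4 × Bool) :
    Integrable fun x => w x * cpt c (g x) ^ 2 := by
  refine hF.mono' (G.sw.continuous.mulf ((hg.cpt c).continuous.powf 2)).aestronglyMeasurable <|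
    Filter.Eventually.of_forall fun x => ?_
  have hw : 0 ≤ w x := by linarith [G.le_w x]
  rw [Real.norm_of_nonneg (mul_nonneg hw (sq_nonneg _)), sq]
  exact mul_le_mul_of_nonneg_left (Finset.single_le_sum (f := fun c => cpt c (g x) * cpt c (g x))
    (fun _ _ => mul_self_nonneg _) (Finset.mem_univ c)) hw

lemma sum_integral_weight_cpt_sq {g : Eu 3 → Fin 4 → ℂ} (hg : Smooth g)
    (hF : Integrable fun x => w x * ip (g x) (g x)) :
    ∑ c, ∫ x, w x * cpt c (g x) ^ 2 = ∫ x, w x * ip (g x) (g x) := by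
  rw [← integral_finsetSum _ fun c _ => G.integrable_weight_cpt_sq hg hF c]
  simp only [ip, sq, Finset.mul_sum]

lemma abs_spinor_pairing_le {δ : ℝ} (h0 : 0 ≤ δ) (h1 : δ ≤ 1) {f g : Eu 3 → Fin 4 → ℂ}
    {χ : Eu 3 → ℝ} (hf : Smooth f) (hg : Smooth g) (hχ : Smooth χ) (hc : HasCompactSupport χ)
    (hχ0 : ∀ x, 0 ≤ χ x) (hχ1 : ∀ x, χ x ≤ 1) {b : ℝ} (hb : ∀ j x, |pd j χ x| ≤ b)
    (hF : Integrable fun x => ip (f x) (f x)) (hG : Integrable (gsq f))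
    (hg2 : Integrable fun x => w x * ip (g x) (g x)) :
    |∑ c, ∫ x, χ x * w x * cpt c (g x) * morB δ ℓ (fun y => cpt c (f y)) x|
      ≤ (∫ x, w x * ip (g x) (g x)) + 4000 * (∫ x, gsq f x)
        + 5000 * b * ∫ x, ip (f x) (f x) := by
  rw [← G.sum_integral_weight_cpt_sq hg hg2, ← sum_integral_gradN_sq hf hG,
    ← sum_integral_cpt_sq hf hF, Finset.mul_sum, Finset.mul_sum, ← Finset.sum_add_distrib,
    ← Finset.sum_add_distrib]
  refine (Finset.abs_sum_le_sum_abs _ _).trans (Finset.sum_le_sum fun c _ => ?_)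
  have h := G.abs_pairing_le h0 h1 (hf.cpt c) (hg.cpt c) hχ hc hχ0 hb (integrable_cpt_sq hf hF c)
  have h2 := integral_cutoff_le hχ.continuous hc hχ1
    (G.sw.continuous.mulf ((hg.cpt c).continuous.powf 2))
    (fun x => mul_nonneg (by linarith [G.le_w x]) (sq_nonneg _))
    (G.integrable_weight_cpt_sq hg hg2 c)
  have h3 := integral_cutoff_le hχ.continuous hc hχ1 ((continuous_gradN (hf.cpt c)).powf 2)
    (fun x => sq_nonneg _) (integrable_gradN_sq hf hG c)
  linarith

lemma spinor_virial {δ : ℝ} (h0 : 0 ≤ δ) (h1 : δ ≤ 1) (m : ℝ) {f g : Eu 3 → Fin 4 → ℂ}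
    {χ : Eu 3 → ℝ} (hf : Smooth f) (hg : Smooth g) (hχ : Smooth χ) (hc : HasCompactSupport χ)
    (hχ0 : ∀ x, 0 ≤ χ x) {b : ℝ} (hb : ∀ j x, |pd j χ x| ≤ b)
    (hF : Integrable fun x => ip (f x) (f x)) (hG : Integrable (gsq f))
    (hg2 : Integrable fun x => w x * ip (g x) (g x)) :
    ∑ c, ((∫ x, χ x * ((∑ j, pd j (flux p w (fun y => cpt c (f y)) j) x)
          - w x * (m ^ 2 + R x / 4) * cpt c (f x)) * morB δ ℓ (fun y => cpt c (f y)) x)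
        + ∫ x, χ x * w x * cpt c (g x) * morB δ ℓ (fun y => cpt c (g y)) x)
      ≤ -(δ / 4) * (∫ x, χ x * spS δ f x) + 2000 * κ * (∫ x, χ x * spS σ f x)
        + b * (1000 * ((1 + m ^ 2) * (∫ x, ip (f x) (f x)) + ∫ x, gsq f x)
          + 6 * ∫ x, w x * ip (g x) (g x)) := by
  rw [← G.sum_integral_weight_cpt_sq hg hg2, ← sum_integral_gradN_sq hf hG,
    ← sum_integral_cpt_sq hf hF, ← sum_integral_cutoff_morS δ hf hχ.continuous hc,
    ← sum_integral_cutoff_morS σ hf hχ.continuous hc]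
  simp only [Finset.mul_sum, ← Finset.sum_add_distrib]
  refine Finset.sum_le_sum fun c _ => ?_
  have a1 := G.virial h0 h1 m (hf.cpt c) hχ hc hχ0 hb (integrable_cpt_sq hf hF c)
    (integrable_gradN_sq hf hG c)
  have a2 := G.morB_skew h0 (hg.cpt c) hχ hc hb (G.integrable_weight_cpt_sq hg hg2 c)
  linarith

end Geo

lemma JS.spS (δ : ℝ) (hu : JS u) : JS fun t => spS δ (u t) := by
  have h1 : JS fun t x => ∑ c, ∑ j, cpt c (pd j (u t) x) * cpt c (pd j (u t) x) :=
    JS.sum fun c => JS.sum fun j => ((hu.smooth_pd j).clm (cpt c)).mul ((hu.smooth_pd j).clm (cpt c))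
  have h2 : JS fun t x => ∑ c, cpt c (u t x) * cpt c (u t x) :=
    JS.sum fun c => (hu.clm (cpt c)).mul (hu.clm (cpt c))
  refine (((JS.of_smooth (smooth_ji.mul (smooth_jd δ))).mul h1).add
    ((JS.of_smooth ((smooth_ji.pow 3).mul (smooth_jd δ))).mul h2)).congr fun t ht x => ?_
  rw [spS_eq, gsq_eq (hu.slice ht)]
  simp only [ip]
  rw [Finset.sum_comm]

/-- Bounds along the flow. -/
structure FlowBounds (w : Eu 3 → ℝ) (A : Fin 3 → Eu 3 → Fin 4 → Fin 4 → ℂ)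
    (B : Eu 3 → Fin 4 → Fin 4 → ℂ) (u : ℝ → Eu 3 → Fin 4 → ℂ) (E F : ℝ) : Prop where
  iF : ∀ t, 0 ≤ t → Integrable fun x => ip (u t x) (u t x)
  iG : ∀ t, 0 ≤ t → Integrable (gsq (u t))
  iH : ∀ t, 0 ≤ t → Integrable fun x => w x * ip (Hop A B (u t) x) (Hop A B (u t) x)
  bF : ∀ t, 0 ≤ t → ∫ x, ip (u t x) (u t x) ≤ F
  bG : ∀ t, 0 ≤ t → ∫ x, gsq (u t) x ≤ 3 * E
  bH : ∀ t, 0 ≤ t → ∫ x, w x * ip (Hop A B (u t) x) (Hop A B (u t) x) ≤ E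

lemma Evol.flowBounds (D : DOp m p w R A B) (G : Geo κ σ p w ℓ V R) (hu : Evol φ A B u)
    (hφ : ContinuousOn φ (Ici 0)) (hφ0 : ∀ t, 0 ≤ t → 0 < φ t)
    (iF : ∀ t, 0 ≤ t → Integrable fun x => ip (u t x) (u t x))
    (iG : ∀ t, 0 ≤ t → Integrable (gsq (u t))) :
    FlowBounds w A B u (∫ x, w x * ip (Hop A B (u 0) x) (Hop A B (u 0) x))
      (2 * ∫ x, w x * ip (u 0 x) (u 0 x)) := by
  have s := fun t ht => hu.smooth.slice (t := t) ht
  have hH := fun t ht => (hu.comp_Hop D).charge_le D G hφ hφ0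
    (D.integrable_Hop G (s 0 le_rfl) (iF 0 le_rfl) (iG 0 le_rfl)) (T := t) ht
  have i0 : Integrable fun x => w x * ip (u 0 x) (u 0 x) := by
    have hc := (s 0 le_rfl).continuous
    refine ((iF 0 le_rfl).const_mul 2).mono'
      (G.sw.continuous.mulf (continuous_ip hc hc)).aestronglyMeasurable
      (Filter.Eventually.of_forall fun x => ?_)
    rw [Real.norm_of_nonneg (mul_nonneg (by linarith [G.le_w x]) ip_self_nonneg)]
    exact mul_le_mul_of_nonneg_right (G.w_le x) ip_self_nonneg
  refine ⟨iF, iG, fun t ht => (hH t ht).1, fun t ht => ?_, fun t ht => ?_, fun t ht => (hH t ht).2⟩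
  · obtain ⟨h1, h2⟩ := hu.charge_le D G hφ hφ0 i0 ht
    refine le_trans ?_ (mul_le_mul_of_nonneg_left h2 zero_le_two)
    rw [← integral_const_mul]
    refine integral_mono (iF t ht) (h1.const_mul 2) fun x => ?_
    have := mul_le_mul_of_nonneg_right (G.le_w x) (ip_self_nonneg (v := u t x))
    simp only; linarith
  · exact (D.integral_gsq_le G (s t ht) (iF t ht) (iG t ht)).trans
      (mul_le_mul_of_nonneg_left (hH t ht).2 (by norm_num))

lemma continuousOn_cutoff_spS (δ : ℝ) (hu : JS u) {χ : Eu 3 → ℝ} (hχ : Smooth χ)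
    (hc : HasCompactSupport χ) : ContinuousOn (fun t => ∫ x, χ x * spS δ (u t) x) (Ici 0) :=
  JS.continuousOn_integral hc ((JS.of_smooth hχ).mul (hu.spS δ)).continuousOn fun t _ x hx => by
    simp [image_eq_zero_of_notMem_tsupport hx]

lemma Evol.virial (D : DOp m p w R A B) (G : Geo κ σ p w ℓ V R) (hu : Evol φ A B u)
    (hφ : ContinuousOn φ (Ici 0)) (hφ0 : ∀ t, 0 ≤ t → 0 < φ t) {E F : ℝ}
    (K : FlowBounds w A B u E F) {δ : ℝ} (h0 : 0 ≤ δ) (h1 : δ ≤ 1) {χ : Eu 3 → ℝ} (hχ : Smooth χ)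
    (hc : HasCompactSupport χ) (hχ0 : ∀ x, 0 ≤ χ x) (hχ1 : ∀ x, χ x ≤ 1) {b : ℝ} (hb0 : 0 ≤ b)
    (hb : ∀ j x, |pd j χ x| ≤ b) {T : ℝ} (hT : 0 ≤ T) :
    δ / 4 * (∫ t in (0)..T, (φ t)⁻¹ * ∫ x, χ x * spS δ (u t) x)
      ≤ 2000 * κ * (∫ t in (0)..T, (φ t)⁻¹ * ∫ x, χ x * spS σ (u t) x) + 24002 * E
        + b * (10000 * F + (1000 * ((1 + m ^ 2) * F + 3 * E) + 6 * E)
          * ∫ t in (0)..T, (φ t)⁻¹) := by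
  set g : ℝ → Eu 3 → Fin 4 → ℂ := fun t x => -(Complex.I • Hop A B (u t) x) with hg
  set C := 1000 * ((1 + m ^ 2) * F + 3 * E) + 6 * E with hC
  have s := fun t ht => hu.smooth.slice (t := t) ht
  have jH := JS.smooth_Hop D.sA D.sB hu.smooth
  let J : (Fin 4 → ℂ) →L[ℝ] (Fin 4 → ℂ) := -(Complex.I • ContinuousLinearMap.id ℝ (Fin 4 → ℂ))
  have jg : JS g := jH.clm J
  have sg := fun t ht => jg.slice (t := t) ht
  have ipg : ∀ t x, ip (g t x) (g t x) = ip (Hop A B (u t) x) (Hop A B (u t) x) := fun t x => by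
    have : g t x = (-1 : ℝ) • (Complex.I • Hop A B (u t) x) := by simp [hg]
    rw [this, ip_smul_left, ip_smul_right, ip_I_smul_self]; ring
  have ig : ∀ t, 0 ≤ t → Integrable fun x => w x * ip (g t x) (g t x) := fun t ht => by
    simpa only [ipg] using K.iH t ht
  have bg : ∀ t, 0 ≤ t → ∫ x, w x * ip (g t x) (g t x) ≤ E := fun t ht => by
    simpa only [ipg] using K.bH t ht
  have du : ∀ t, 0 ≤ t → ∀ x, DD (1, 0) u t x = (φ t)⁻¹ • g t x := fun t ht x => by
    rw [hu.eq t ht, hg, neg_smul, smul_neg]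
  have dg : ∀ t, 0 ≤ t → ∀ x, DD (1, 0) g t x = -((φ t)⁻¹ • Hop A B (Hop A B (u t)) x) := by
    intro t ht x
    have h : DD (1, 0) g t x = J (DD (1, 0) (fun t => Hop A B (u t)) t x) :=
      jH.DD_clm J ht x
    rw [h, (hu.comp_Hop D).eq t ht]
    simp only [J, _root_.neg_apply, _root_.smul_apply,
      ContinuousLinearMap.id_apply, smul_comm Complex.I, smul_smul Complex.I, Complex.I_mul_I]
    simp
  set Kf : Fin 4 × Bool → ℝ → Eu 3 → ℝ := fun c t x =>
    χ x * w x * cpt c (g t x) * morB δ ℓ (fun y => cpt c (u t y)) x with hKf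
  have jB : ∀ c, JS fun t => morB δ ℓ (fun y => cpt c (u t y)) := fun c =>
    (JS.sum fun l => (JS.of_smooth (smooth_morA δ l)).mul
      ((hu.smooth.clm (cpt c)).smooth_pd l)).add
        ((JS.of_smooth (G.smooth_morQE δ)).mul (hu.smooth.clm (cpt c)))
  have jK : ∀ c, JS (Kf c) := fun c =>
    ((JS.of_smooth (hχ.mul G.sw)).mul (jg.clm (cpt c))).mul (jB c)
  have zK : ∀ c t, 0 ≤ t → ∀ x, x ∉ tsupport χ → Kf c t x = 0 := fun c t _ x hx => by
    simp [hKf, image_eq_zero_of_notMem_tsupport hx]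
  have dB : ∀ c t, 0 ≤ t → ∀ x, DD (1, 0) (fun t => morB δ ℓ (fun y => cpt c (u t y))) t x
      = (φ t)⁻¹ * morB δ ℓ (fun y => cpt c (g t y)) x := by
    intro c t ht x
    have jc := hu.smooth.clm (cpt c)
    have dc : DD (1, 0) (fun t y => cpt c (u t y)) t = fun y => (φ t)⁻¹ * cpt c (g t y) :=
      funext fun y => by rw [hu.smooth.DD_clm _ ht, du t ht, map_smul, smul_eq_mul]
    refine (jB c).DD_time_eq ht (((HasDerivWithinAt.fun_sum (u := Finset.univ) fun l _ =>
      ((jc.smooth_pd l).hasDerivWithinAt ht x).const_mul (morA δ l x)).fun_add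
        ((jc.hasDerivWithinAt ht x).const_mul (morQE δ ℓ x))).congr_deriv ?_)
    simp only [jc.DD_pd _ ht, dc, pd_const_mul ((sg t ht).cpt c), morB, mul_add, Finset.mul_sum]
    congr 1
    · exact Finset.sum_congr rfl fun l _ => by ring
    · ring
  have dK : ∀ c t, 0 ≤ t → ∀ x, DD (1, 0) (Kf c) t x = (φ t)⁻¹ *
      (χ x * ((∑ j, pd j (flux p w (fun y => cpt c (u t y)) j) x)
          - w x * (m ^ 2 + R x / 4) * cpt c (u t x)) * morB δ ℓ (fun y => cpt c (u t y)) x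
        + χ x * w x * cpt c (g t x) * morB δ ℓ (fun y => cpt c (g t y)) x) := by
    intro c t ht x
    have e1 := (jg.clm (cpt c)).hasDerivWithinAt ht x
    have e2 := (jB c).hasDerivWithinAt ht x
    rw [jg.DD_clm _ ht, dg t ht] at e1
    rw [dB c t ht] at e2
    rw [(jK c).DD_time_eq ht ((e1.const_mul (χ x * w x)).mul e2), map_neg, map_smul, smul_eq_mul]
    have h := D.sq (u t) (s t ht) c x
    linear_combination (-(χ x * (φ t)⁻¹ * morB δ ℓ (fun y => cpt c (u t y)) x)) * h
  have cS := fun δ => continuousOn_cutoff_spS δ hu.smooth hχ hc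
  have cφ : ContinuousOn (fun t => (φ t)⁻¹) (Ici 0) := hφ.inv₀ fun t ht => (hφ0 t ht).ne'
  have cφS : ∀ δ, ContinuousOn (fun t => (φ t)⁻¹ * ∫ x, χ x * spS δ (u t) x) (Ici 0) := fun δ =>
    cφ.mul (cS δ)
  have sub : Icc 0 T ⊆ Ici (0 : ℝ) := fun t ht => ht.1
  have cΦ : ContinuousOn (fun t => -(δ / 4) * ((φ t)⁻¹ * ∫ x, χ x * spS δ (u t) x)
      + 2000 * κ * ((φ t)⁻¹ * ∫ x, χ x * spS σ (u t) x) + b * C * (φ t)⁻¹) (Icc 0 T) :=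
    (((cφS δ).const_smul (-(δ / 4))).add
      ((cφS σ).const_smul (2000 * κ)) |>.add (cφ.const_smul (b * C))).mono sub
  have key := intervalIntegral.sub_le_integral_of_hasDeriv_right_of_le hT
    (g := fun t => ∑ c, ∫ x, Kf c t x)
    (g' := fun t => ∑ c, ∫ x, DD (1, 0) (Kf c) t x)
    ((continuousOn_finsetSum _ fun c _ =>
      JS.continuousOn_integral hc (jK c).continuousOn (zK c)).mono sub)
    (fun t ht => (HasDerivAt.fun_sum fun c _ =>
      (jK c).hasDerivAt_integral hc (zK c) ht.1).hasDerivWithinAt)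
    cΦ.integrableOn_Icc fun t ht => ?_
  · have bd : ∀ t, 0 ≤ t → |∑ c, ∫ x, Kf c t x| ≤ 12001 * E + 5000 * b * F := fun t ht => by
      refine (G.abs_spinor_pairing_le h0 h1 (s t ht) (sg t ht) hχ hc hχ0 hχ1 hb (K.iF t ht)
        (K.iG t ht) (ig t ht)).trans ?_
      have := mul_le_mul_of_nonneg_left (K.bF t ht) (show 0 ≤ 5000 * b by positivity)
      linarith [K.bG t ht, bg t ht]
    have b0 := (abs_le.1 (bd 0 le_rfl)).2
    have bT := (abs_le.1 (bd T hT)).1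
    have ii : ∀ {f : ℝ → ℝ}, ContinuousOn f (Ici 0) → IntervalIntegrable f volume 0 T :=
      fun hf => (hf.mono (by rw [uIcc_of_le hT]; exact sub)).intervalIntegrable
    rw [intervalIntegral.integral_add (((ii (cφS δ)).const_mul _).add
        ((ii (cφS σ)).const_mul _)) ((ii cφ).const_mul _),
      intervalIntegral.integral_add ((ii (cφS δ)).const_mul _)
        ((ii (cφS σ)).const_mul _), intervalIntegral.integral_const_mul,
      intervalIntegral.integral_const_mul, intervalIntegral.integral_const_mul] at key
    linarith
  · have ht0 := ht.1.le
    have hs := s t ht0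
    have v := G.spinor_virial h0 h1 m hs (sg t ht0) hχ hc hχ0 hb (K.iF t ht0)
      (K.iG t ht0) (ig t ht0)
    have hi := inv_pos.2 (hφ0 t ht0)
    have e : ∑ c, ∫ x, DD (1, 0) (Kf c) t x = (φ t)⁻¹ *
        ∑ c, ((∫ x, χ x * ((∑ j, pd j (flux p w (fun y => cpt c (u t y)) j) x)
          - w x * (m ^ 2 + R x / 4) * cpt c (u t x)) * morB δ ℓ (fun y => cpt c (u t y)) x)
        + ∫ x, χ x * w x * cpt c (g t x) * morB δ ℓ (fun y => cpt c (g t y)) x) := by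
      rw [Finset.mul_sum]
      refine Finset.sum_congr rfl fun c _ => ?_
      have c1 := (G.smooth_morB δ (hs.cpt c)).continuous
      have c2 := (G.smooth_morB δ ((sg t ht0).cpt c)).continuous
      have c3 : Continuous fun x => (∑ j, pd j (flux p w (fun y => cpt c (u t y)) j) x)
          - w x * (m ^ 2 + R x / 4) * cpt c (u t x) := by
        have c4 : Continuous fun x => ∑ j, pd j (flux p w (fun y => cpt c (u t y)) j) x :=
          continuous_finsetSum _ fun j _ => ((G.smooth_flux (hs.cpt c) j).pd j).continuous
        have := G.cR
        have := G.sw.continuous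
        have := (hs.cpt c).continuous
        fun_prop
      simp only [dK c t ht0]
      rw [integral_const_mul, integral_add]
      · simpa only [mul_assoc] using integrable_cutoff_mul hχ.continuous hc (c3.mulf c1)
      · simpa only [mul_assoc] using integrable_cutoff_mul hχ.continuous hc
          (G.sw.continuous.mulf (((sg t ht0).cpt c).continuous.mulf c2))
    simp only [e]
    have hB : b * (1000 * ((1 + m ^ 2) * (∫ x, ip (u t x) (u t x)) + ∫ x, gsq (u t) x)
          + 6 * ∫ x, w x * ip (g t x) (g t x)) ≤ b * C := by
      refine mul_le_mul_of_nonneg_left ?_ hb0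
      have := mul_le_mul_of_nonneg_left (K.bF t ht0) (show 0 ≤ 1 + m ^ 2 by positivity)
      linarith [K.bG t ht0, bg t ht0]
    have := mul_le_mul_of_nonneg_left (v.trans (add_le_add_right hB _)) hi.le
    linarith

/-! ### Removing the cutoff -/

section

variable {A : Fin 3 → Eu 3 → Fin 4 → Fin 4 → ℂ} {B : Eu 3 → Fin 4 → Fin 4 → ℂ}
  {κ σ m : ℝ} {p : Fin 3 → Fin 3 → Eu 3 → ℝ} {w : Eu 3 → ℝ} {ℓ V : Fin 3 → Eu 3 → ℝ}
  {R : Eu 3 → ℝ} {φ : ℝ → ℝ} {u : ℝ → Eu 3 → Fin 4 → ℂ}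

lemma FlowBounds.integrable_spS {E F : ℝ} (K : FlowBounds w A B u E F) (hu : JS u) {δ : ℝ}
    (h0 : 0 ≤ δ) {t : ℝ} (ht : 0 ≤ t) : Integrable (spS δ (u t)) :=
  ((K.iG t ht).add (K.iF t ht)).mono' (continuous_spS δ (hu.slice ht)).aestronglyMeasurable
    (.of_forall fun x => by
      rw [norm_of_nonneg (spS_nonneg δ _ x)]; exact spS_le h0 _ x)

lemma Evol.integral_spS_le (D : DOp m p w R A B) (G : Geo κ σ p w ℓ V R) (hu : Evol φ A B u)
    (hφ : ContinuousOn φ (Ici 0)) (hφ0 : ∀ t, 0 ≤ t → 0 < φ t) {E F : ℝ}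
    (K : FlowBounds w A B u E F) (hκ : 2000 * κ ≤ σ / 8) {δ : ℝ} (h0 : 0 < δ) (h1 : δ ≤ 1)
    {T : ℝ} (hT : 0 ≤ T) :
    IntervalIntegrable (fun t => (φ t)⁻¹ * ∫ x, spS δ (u t) x) volume 0 T ∧
      ∫ t in (0)..T, (φ t)⁻¹ * ∫ x, spS δ (u t) x ≤ 4 / δ * (48004 * E) := by
  obtain ⟨M, hM, χ, k1, k2, k3, k4, k5, k6⟩ := exists_cutoffs
  have cφ : ContinuousOn (fun t => (φ t)⁻¹) (Ici 0) := hφ.inv₀ fun t ht => (hφ0 t ht).ne'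
  have sub : Icc 0 T ⊆ Ici (0 : ℝ) := Icc_subset_Ici_self
  have ii : ∀ {f : ℝ → ℝ}, ContinuousOn f (Ici 0) → IntervalIntegrable f volume 0 T :=
    fun hf => (hf.mono (by rw [uIcc_of_le hT]; exact sub)).intervalIntegrable
  have cI : ∀ n, ContinuousOn (fun t => (φ t)⁻¹ * ∫ x, χ n x * spS δ (u t) x) (Ici 0) :=
    fun n => cφ.mul (continuousOn_cutoff_spS δ hu.smooth (k1 n) (k2 n))
  have hpos : ∀ t ∈ uIoc 0 T, 0 ≤ t := fun t ht => by
    rw [uIoc_of_le hT] at ht; exact ht.1.le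
  have hdom : ∀ n, ∀ t, 0 ≤ t → ‖(φ t)⁻¹ * ∫ x, χ n x * spS δ (u t) x‖ ≤
      (φ t)⁻¹ * (3 * E + F) := fun n t ht => by
    have hi := inv_pos.2 (hφ0 t ht)
    have hn : 0 ≤ ∫ x, χ n x * spS δ (u t) x :=
      integral_nonneg fun x => mul_nonneg (k3 n x) (spS_nonneg δ _ x)
    rw [norm_of_nonneg (mul_nonneg hi.le hn)]
    refine mul_le_mul_of_nonneg_left ?_ hi.le
    calc ∫ x, χ n x * spS δ (u t) x ≤ ∫ x, (gsq (u t) x + ip (u t x) (u t x)) :=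
          integral_mono_of_nonneg (.of_forall fun x => mul_nonneg (k3 n x) (spS_nonneg δ _ x))
            ((K.iG t ht).fun_add (K.iF t ht)) (.of_forall fun x =>
              (mul_le_of_le_one_left (spS_nonneg δ _ x) (k4 n x)).trans (spS_le h0.le _ x))
      _ = (∫ x, gsq (u t) x) + ∫ x, ip (u t x) (u t x) :=
          integral_add (K.iG t ht) (K.iF t ht)
      _ ≤ _ := add_le_add (K.bG t ht) (K.bF t ht)
  have hlim : ∀ t, 0 ≤ t → Filter.Tendsto (fun n => (φ t)⁻¹ * ∫ x, χ n x * spS δ (u t) x)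
      Filter.atTop (nhds ((φ t)⁻¹ * ∫ x, spS δ (u t) x)) := fun t ht => by
    refine Filter.Tendsto.const_mul _ ?_
    have cS := continuous_spS δ (hu.smooth.slice ht)
    refine tendsto_integral_of_dominated_convergence (spS δ (u t))
      (fun n => ((k1 n).continuous.mulf cS).aestronglyMeasurable)
      (K.integrable_spS hu.smooth h0.le ht) (fun n => .of_forall fun x => ?_)
      (.of_forall fun x => ?_)
    · rw [norm_of_nonneg (mul_nonneg (k3 n x) (spS_nonneg δ _ x))]
      exact mul_le_of_le_one_left (spS_nonneg δ _ x) (k4 n x)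
    · simpa using (k6 x).mul_const (spS δ (u t) x)
  have iB : IntervalIntegrable (fun t => (φ t)⁻¹ * (3 * E + F)) volume 0 T :=
    ii (cφ.mul continuousOn_const)
  have hI := intervalIntegral.tendsto_integral_filter_of_dominated_convergence
    (a := 0) (b := T) (μ := volume) (l := Filter.atTop)
    (F := fun (n : ℕ) t => (φ t)⁻¹ * ∫ x, χ n x * spS δ (u t) x)
    (f := fun t => (φ t)⁻¹ * ∫ x, spS δ (u t) x) (fun t => (φ t)⁻¹ * (3 * E + F))
    (.of_forall fun n => (intervalIntegrable_iff.1 (ii (cI n))).aestronglyMeasurable)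
    (.of_forall fun n => .of_forall fun t ht => hdom n t (hpos t ht)) iB
    (.of_forall fun t ht => hlim t (hpos t ht))
  refine ⟨?_, ?_⟩
  · refine iB.mono_fun' (aestronglyMeasurable_of_tendsto_ae Filter.atTop
      (fun n => (intervalIntegrable_iff.1 (ii (cI n))).aestronglyMeasurable) ?_) ?_
    · exact (ae_restrict_iff' measurableSet_uIoc).2 (.of_forall fun t ht => hlim t (hpos t ht))
    · exact (ae_restrict_iff' measurableSet_uIoc).2 (.of_forall fun t ht =>
        le_of_tendsto (hlim t (hpos t ht)).norm (.of_forall fun n => hdom n t (hpos t ht)))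
  · set Cc := 10000 * F + (1000 * ((1 + m ^ 2) * F + 3 * E) + 6 * E) * ∫ t in (0)..T, (φ t)⁻¹
      with hCc
    have hn : ∀ n : ℕ, (∫ t in (0)..T, (φ t)⁻¹ * ∫ x, χ n x * spS δ (u t) x)
        ≤ 4 / δ * (48004 * E + 2 * (M / ((n : ℝ) + 1) * Cc)) := fun n => by
      have hb0 : 0 ≤ M / ((n : ℝ) + 1) := by positivity
      have vσ := hu.virial D G hφ hφ0 K G.σ0.le G.σ1.le (k1 n) (k2 n) (k3 n) (k4 n) hb0 (k5 n) hT
      have vδ := hu.virial D G hφ hφ0 K h0.le h1 (k1 n) (k2 n) (k3 n) (k4 n) hb0 (k5 n) hT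
      have hpσ : 0 ≤ ∫ t in (0)..T, (φ t)⁻¹ * ∫ x, χ n x * spS σ (u t) x :=
        intervalIntegral.integral_nonneg hT fun t ht => mul_nonneg (inv_pos.2 (hφ0 t ht.1)).le
          (integral_nonneg fun x => mul_nonneg (k3 n x) (spS_nonneg σ _ x))
      have := mul_le_mul_of_nonneg_right hκ hpσ
      rw [div_mul_eq_mul_div, le_div_iff₀ h0]
      linarith
    have hR : Filter.Tendsto (fun n : ℕ => 4 / δ * (48004 * E + 2 * (M / ((n : ℝ) + 1) * Cc)))
        Filter.atTop (nhds (4 / δ * (48004 * E))) := by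
      have := ((((tendsto_div_nat M).mul_const Cc).const_mul 2).const_add (48004 * E)).const_mul
        (4 / δ)
      simpa using this
    exact le_of_tendsto_of_tendsto' hI hR hn

/-- A nonnegative function of time whose integrals over bounded intervals are controlled. -/
lemma integral_Ioi_le_of_interval {f g : ℝ → ℝ} {C : ℝ} (hC : 0 ≤ C)
    (hf : ∀ t, 0 < t → f t ≤ g t)
    (hg : ∀ T, 0 ≤ T → IntervalIntegrable g volume 0 T ∧ ∫ t in (0)..T, g t ≤ C) :
    ∫ t in Ioi (0 : ℝ), f t ≤ C := by
  by_cases hi : IntegrableOn f (Ioi 0)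
  · refine le_of_tendsto (intervalIntegral_tendsto_integral_Ioi 0 hi Filter.tendsto_id) ?_
    filter_upwards [Filter.eventually_ge_atTop 0] with T hT
    refine le_trans ?_ (hg T hT).2
    refine intervalIntegral.integral_mono_on_of_le_Ioo hT ?_ (hg T hT).1 fun t ht => hf t ht.1
    rw [intervalIntegrable_iff_integrableOn_Ioc_of_le (by exact hT)]
    exact hi.mono_set Ioc_subset_Ioi_self
  · rw [integral_undef hi]; exact hC

/-- The integrand of the smoothing estimate is dominated by `spS`. -/
lemma weight_le_spS (hw : ∀ x, w x ≤ 2) (hw0 : ∀ x, 0 ≤ w x) {δ a b : ℝ} (ha : δ ≤ a)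
    (hb : δ ≤ b) {f : Eu 3 → Fin 4 → ℂ} (hf : Smooth f) (x : Eu 3) :
    (jap x ^ (-(3 + a)) * (∑ i, ‖f x i‖ ^ 2)
      + jap x ^ (-(1 + b)) * (∑ j, ∑ i, ‖pd j (fun y => f y i) x‖ ^ 2)) * w x
      ≤ 2 * spS δ f x := by
  have e1 : ∑ i, ‖f x i‖ ^ 2 = ip (f x) (f x) := ip_self.symm
  have e2 : ∑ j, ∑ i, ‖pd j (fun y => f y i) x‖ ^ 2 = gsq f x := by
    rw [gsq_eq hf]
    refine Finset.sum_congr rfl fun j _ => ?_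
    rw [ip_self]
    refine Finset.sum_congr rfl fun i _ => ?_
    exact congrArg (‖·‖ ^ 2) (pd_clm (ContinuousLinearMap.proj i : (Fin 4 → ℂ) →L[ℝ] ℂ) hf j x)
  have j1 := one_le_jap x
  have i1 : jap x ^ (-(3 + a)) ≤ ji x ^ 3 * jd δ x := by
    rw [← jap_rpow_sub]
    refine rpow_le_rpow_of_exponent_le j1 ?_
    push_cast; linarith
  have i2 : jap x ^ (-(1 + b)) ≤ ji x * jd δ x := by
    have := jap_rpow_sub 1 δ x
    rw [pow_one] at this
    rw [← this]
    refine rpow_le_rpow_of_exponent_le j1 ?_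
    push_cast; linarith
  rw [e1, e2, spS_eq]
  have h1 := mul_le_mul_of_nonneg_right i1 (ip_self_nonneg (v := f x))
  have h2 := mul_le_mul_of_nonneg_right i2 (gsq_nonneg f x)
  have p1 := mul_nonneg (mul_nonneg (pow_nonneg (ji_pos x).le 3) (jd_pos δ x).le)
    (ip_self_nonneg (v := f x))
  have p2 := mul_nonneg (mul_nonneg (ji_pos x).le (jd_pos δ x).le) (gsq_nonneg f x)
  calc _ ≤ (ji x ^ 3 * jd δ x * ip (f x) (f x) + ji x * jd δ x * gsq f x) * w x :=
        mul_le_mul_of_nonneg_right (add_le_add h1 h2) (hw0 x)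
    _ ≤ (ji x ^ 3 * jd δ x * ip (f x) (f x) + ji x * jd δ x * gsq f x) * 2 :=
        mul_le_mul_of_nonneg_left (hw x) (by linarith)
    _ = _ := by ring

/-- The smoothing estimate for an abstract Dirac-type evolution. -/
lemma Evol.smoothing (D : DOp m p w R A B) (G : Geo κ σ p w ℓ V R) (hu : Evol φ A B u)
    (hφ : ContinuousOn φ (Ici 0)) (hφ0 : ∀ t, 0 ≤ t → 0 < φ t)
    (iF : ∀ t, 0 ≤ t → Integrable fun x => ip (u t x) (u t x))
    (iG : ∀ t, 0 ≤ t → Integrable (gsq (u t))) (hκ : 2000 * κ ≤ σ / 8) {δ a b : ℝ}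
    (h0 : 0 < δ) (h1 : δ ≤ 1) (ha : δ ≤ a) (hb : δ ≤ b) :
    (∫ t in Ioi (0 : ℝ), (φ t)⁻¹ * ∫ x : Eu 3,
        (jap x ^ (-(3 + a)) * (∑ i, ‖u t x i‖ ^ 2)
          + jap x ^ (-(1 + b)) * (∑ j, ∑ i, ‖pd j (fun y => u t y i) x‖ ^ 2)) * w x)
      ≤ 2 * (4 / δ * 48004) * ∫ x, w x * ip (Hop A B (u 0) x) (Hop A B (u 0) x) := by
  have K := hu.flowBounds D G hφ hφ0 iF iG
  set E := ∫ x, w x * ip (Hop A B (u 0) x) (Hop A B (u 0) x)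
  have hw0 : ∀ x, 0 ≤ w x := fun x => by linarith [G.le_w x]
  have hE : 0 ≤ E := integral_nonneg fun x => mul_nonneg (hw0 x) ip_self_nonneg
  refine integral_Ioi_le_of_interval
    (g := fun t => 2 * ((φ t)⁻¹ * ∫ x, spS δ (u t) x)) (by positivity) (fun t ht => ?_)
    fun T hT => ?_
  · have hi := inv_pos.2 (hφ0 t ht.le)
    rw [mul_left_comm]
    refine mul_le_mul_of_nonneg_left ?_ hi.le
    rw [← integral_const_mul]
    refine integral_mono_of_nonneg (.of_forall fun x => ?_)
      ((K.integrable_spS hu.smooth h0.le ht.le).const_mul 2) (.of_forall fun x =>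
        weight_le_spS G.w_le hw0 ha hb (hu.smooth.slice ht.le) x)
    have := (jap_pos x).le
    exact mul_nonneg (add_nonneg (by positivity) (by positivity)) (hw0 x)
  · have h := hu.integral_spS_le D G hφ hφ0 K hκ h0 h1 hT
    refine ⟨h.1.const_mul 2, ?_⟩
    rw [intervalIntegral.integral_const_mul]
    linarith [h.2]

end

/-! ### From the Dirac operator and the flow to their real form -/

section

variable {h : Eu 3 → Matrix (Fin 3) (Fin 3) ℝ} {A : Fin 3 → Eu 3 → Fin 4 → Fin 4 → ℂ}
  {B : Eu 3 → Fin 4 → Fin 4 → ℂ}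

lemma smooth_det (sh : ∀ j k, Smooth fun x => h x j k) : Smooth fun x => (h x).det := by
  simp only [Matrix.det_fin_three]
  unfold Smooth at *
  fun_prop

lemma smooth_inv (sh : ∀ j k, Smooth fun x => h x j k) (hd : ∀ x, (h x).det ≠ 0) (j k : Fin 3) :
    Smooth fun x => (h x)⁻¹ j k := by
  have h1 : Smooth fun x => (h x).adjugate j k := by
    simp only [Matrix.adjugate_fin_three]
    unfold Smooth at *
    fin_cases j <;> fin_cases k <;> simp <;> fun_prop
  have h2 : Smooth fun x => ((h x).det)⁻¹ := (smooth_det sh).inv hd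
  simpa only [Matrix.inv_def, Ring.inverse_eq_inv', Matrix.smul_apply, smul_eq_mul] using h2.mul h1

lemma smooth_sdet (sh : ∀ j k, Smooth fun x => h x j k) (hd : ∀ x, 0 < (h x).det) :
    Smooth (sdet h) := (smooth_det sh).sqrt fun x => (hd x).ne'

lemma sdet_pos (hd : ∀ x, 0 < (h x).det) (x : Eu 3) : 0 < sdet h x := Real.sqrt_pos.2 (hd x)

lemma smooth_Hop' (sA : ∀ j i k, Smooth fun x => A j x i k) (sB : ∀ i k, Smooth fun x => B x i k)
    {f : Eu 3 → Fin 4 → ℂ} (hf : Smooth f) : Smooth (Hop A B f) :=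
  contDiff_pi.2 fun i => ContDiff.add
    (ContDiff.sum fun j _ => ContDiff.sum fun k _ => (sA j i k).mul (contDiff_pi.1 (hf.pd j) k))
    (ContDiff.sum fun k _ => (sB i k).mul (contDiff_pi.1 hf k))

lemma re_innC4 (sw : Continuous (sdet h)) {f g : Eu 3 → Fin 4 → ℂ} (hf : Continuous f)
    (hg : Continuous g) (hc : HasCompactSupport g) :
    (innC4 h f g).re = ∫ x, sdet h x * ip (f x) (g x) := by
  have c : Continuous fun x =>
      (∑ i, (starRingEnd ℂ) (f x i) * g x i) * ((sdet h x : ℝ) : ℂ) := by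
    have h1 := fun i => (continuous_pi_iff.1 hf) i
    have h2 := fun i => (continuous_pi_iff.1 hg) i
    refine (continuous_finsetSum _ fun i _ => ?_).mul (Complex.continuous_ofReal.comp sw)
    exact (Complex.continuous_conj.comp (h1 i)).mul (h2 i)
  have i1 : Integrable fun x => (∑ i, (starRingEnd ℂ) (f x i) * g x i) * ((sdet h x : ℝ) : ℂ) :=
    c.integrable_of_hasCompactSupport (HasCompactSupport.intro hc fun x hx => by
      simp [image_eq_zero_of_notMem_tsupport hx])
  unfold innC4
  refine (integral_re i1).symm.trans (integral_congr_ae (.of_forall fun x => ?_))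
  simp only [ip_eq_re]
  exact (Complex.re_mul_ofReal _ _).trans (mul_comm _ _)

lemma symm_of_innC4 (sh : ∀ j k, Smooth fun x => h x j k) (hd : ∀ x, 0 < (h x).det)
    (sA : ∀ j i k, Smooth fun x => A j x i k) (sB : ∀ i k, Smooth fun x => B x i k)
    (hs : ∀ f g : Eu 3 → Fin 4 → ℂ, Smooth f → Smooth g →
      HasCompactSupport f → HasCompactSupport g →
      innC4 h (Hop A B f) g = innC4 h f (Hop A B g))
    {f g : Eu 3 → Fin 4 → ℂ} (hf : Smooth f) (hg : Smooth g) (hc : HasCompactSupport g) :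
    ∫ x, sdet h x * ip (Hop A B f x) (g x) = ∫ x, sdet h x * ip (f x) (Hop A B g x) := by
  obtain ⟨r, hr0, hr⟩ := hc.isCompact.isBounded.subset_ball_lt 0 0
  let ψ : ContDiffBump (0 : Eu 3) := ⟨r, r + 1, hr0, by linarith⟩
  have sψ : Smooth ψ := ψ.contDiff
  set f' : Eu 3 → Fin 4 → ℂ := fun y => ψ y • f y with hf'
  have sf' : Smooth f' := sψ.smul hf
  have hcf : HasCompactSupport f' := HasCompactSupport.intro ψ.hasCompactSupport fun x hx => by
    simp [hf', image_eq_zero_of_notMem_tsupport hx]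
  have heq : ∀ x ∈ tsupport g, f' =ᶠ[nhds x] f := fun x hx => by
    filter_upwards [Metric.isOpen_ball.mem_nhds (hr hx)] with y hy
    rw [hf']
    simp only
    rw [ψ.one_of_mem_closedBall (Metric.ball_subset_closedBall hy), one_smul]
  have sw := (smooth_sdet sh hd).continuous
  have cH := (smooth_Hop' sA sB hg)
  have hcH : HasCompactSupport (Hop A B g) := HasCompactSupport.intro hc fun x hx =>
    Hop_eq_zero_of_notMem_tsupport g hx
  have key := congrArg Complex.re (hs f' g sf' hg hcf hc)
  rw [re_innC4 sw (smooth_Hop' sA sB sf').continuous hg.continuous hc,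
    re_innC4 sw sf'.continuous cH.continuous hcH] at key
  have e1 : ∀ x, sdet h x * ip (Hop A B f' x) (g x) = sdet h x * ip (Hop A B f x) (g x) := by
    intro x
    by_cases hx : x ∈ tsupport g
    · have : Hop A B f' x = Hop A B f x := by
        unfold Hop pd
        rw [(heq x hx).fderiv_eq, (heq x hx).eq_of_nhds]
      rw [this]
    · simp [image_eq_zero_of_notMem_tsupport hx, ip]
  have e2 : ∀ x, sdet h x * ip (f' x) (Hop A B g x) = sdet h x * ip (f x) (Hop A B g x) := by
    intro x
    by_cases hx : x ∈ tsupport g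
    · rw [(heq x hx).eq_of_nhds]
    · simp [Hop_eq_zero_of_notMem_tsupport g hx, ip]
  simpa only [e1, e2] using key

lemma clm_ofReal_mul (L : ℂ →L[ℝ] ℝ) (r : ℝ) (z : ℂ) : L ((r : ℂ) * z) = r * L z := by
  rw [← Complex.real_smul, map_smul, smul_eq_mul]

lemma clm_lapC (sh : ∀ j k, Smooth fun x => h x j k) (hd : ∀ x, 0 < (h x).det) (L : ℂ →L[ℝ] ℝ)
    {g : Eu 3 → ℂ} (hg : Smooth g) (x : Eu 3) :
    sdet h x * L (lapC h g x)
      = ∑ j, pd j (flux (fun j k x => (h x)⁻¹ j k) (sdet h) (fun y => L (g y)) j) x := by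
  have si := smooth_inv sh fun x => (hd x).ne'
  have cs : ∀ {r : Eu 3 → ℝ}, Smooth r → Smooth fun x => ((r x : ℝ) : ℂ) := fun hr =>
    Complex.ofRealCLM.contDiff.comp hr
  rw [lapC, ← Complex.ofReal_inv, clm_ofReal_mul, mul_inv_cancel_left₀ (sdet_pos hd x).ne', map_sum]
  refine Finset.sum_congr rfl fun j _ => ?_
  rw [← pd_clm L]
  · refine congrArg (fun q : Eu 3 → ℝ => pd j q x) (funext fun y => ?_)
    rw [clm_ofReal_mul, map_sum, flux]
    simp only [clm_ofReal_mul, pd_clm L hg]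
  · exact (cs (smooth_sdet sh hd)).mul (Smooth.sum fun k => (cs (si j k)).mul (hg.pd k))

lemma cpt_eq_clm (c : Fin 4 × Bool) : ∃ L : ℂ →L[ℝ] ℝ, ∀ v, cpt c v = L (v c.1) :=
  ⟨if c.2 then Complex.reCLM else Complex.imCLM, fun _ => rfl⟩

lemma dop_of_dirac {m : ℝ} (sh : ∀ j k, Smooth fun x => h x j k) (hd : ∀ x, 0 < (h x).det)
    (sA : ∀ j i k, Smooth fun x => A j x i k) (sB : ∀ i k, Smooth fun x => B x i k)
    (hs : ∀ f g : Eu 3 → Fin 4 → ℂ, Smooth f → Smooth g →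
      HasCompactSupport f → HasCompactSupport g →
      innC4 h (Hop A B f) g = innC4 h f (Hop A B g))
    (hsq : ∀ f : Eu 3 → Fin 4 → ℂ, Smooth f → ∀ (x : Eu 3) (i : Fin 4),
      Hop A B (Hop A B f) x i = ((m : ℂ) ^ 2) * f x i - lapC h (fun y => f y i) x
        + ((Rscal h x / 4 : ℝ) : ℂ) * f x i) :
    DOp m (fun j k x => (h x)⁻¹ j k) (sdet h) (Rscal h) A B where
  sA := sA
  sB := sB
  symm f g hf hg hc := symm_of_innC4 sh hd sA sB hs hf hg hc
  sq f hf c x := by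
    obtain ⟨L, hL⟩ := cpt_eq_clm c
    have e := clm_lapC sh hd L (contDiff_pi.1 hf c.1) x
    simp only [hL]
    rw [hsq f hf x c.1, map_add, map_sub, clm_ofReal_mul, ← Complex.ofReal_pow, clm_ofReal_mul, ← e]
    ring

lemma evol_of_eq {φ : ℝ → ℝ} {u : ℝ → Eu 3 → Fin 4 → ℂ} (hφ0 : ∀ t, 0 ≤ t → 0 < φ t) (hu : JS u)
    (he : ∀ t, 0 ≤ t → ∀ (x : Eu 3) (i : Fin 4),
      Complex.I * ((φ t : ℝ) : ℂ) * derivWithin (fun s => u s x i) (Ici 0) t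
        = Hop A B (u t) x i) : Evol φ A B u := by
  refine ⟨hu, fun t ht x => funext fun i => ?_⟩
  have h1 := (hasDerivWithinAt_pi.1 (hu.hasDerivWithinAt ht x) i).derivWithin
    (uniqueDiffOn_Ici (0 : ℝ) t ht)
  have h2 := he t ht x i
  rw [h1] at h2
  have h3 : ((φ t : ℝ) : ℂ) ≠ 0 := by exact_mod_cast (hφ0 t ht).ne'
  simp only [Pi.smul_apply, smul_eq_mul, ← h2, Complex.real_smul]
  push_cast
  field_simp
  rw [Complex.I_sq]; ring

lemma ip_self_le_norm (v : Fin 4 → ℂ) : ip v v ≤ 4 * ‖v‖ ^ 2 := by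
  rw [ip_self]
  calc ∑ i, ‖v i‖ ^ 2 ≤ ∑ _i : Fin 4, ‖v‖ ^ 2 := Finset.sum_le_sum fun i _ =>
        pow_le_pow_left₀ (norm_nonneg _) (norm_le_pi_norm v i) 2
    _ = _ := by simp

lemma integrable_norm_sq {E : Type*} [NormedAddCommGroup E] [NormedSpace ℝ E]
    (F : SchwartzMap (Eu 3) E) : Integrable fun x => ‖F x‖ ^ 2 := by
  have := (F.memLp 2 (volume : Measure (Eu 3))).integrable_norm_pow (by norm_num)
  simpa using this

lemma integrable_ip_schwartz (F : SchwartzMap (Eu 3) (Fin 4 → ℂ)) :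
    Integrable fun x => ip (F x) (F x) :=
  ((integrable_norm_sq F).const_mul 4).mono'
    (continuous_ip F.continuous F.continuous).aestronglyMeasurable (.of_forall fun x => by
      rw [norm_of_nonneg ip_self_nonneg]; exact ip_self_le_norm _)

lemma integrable_gsq_schwartz (F : SchwartzMap (Eu 3) (Fin 4 → ℂ)) : Integrable (gsq F) := by
  have hF : Smooth (F : Eu 3 → Fin 4 → ℂ) := F.smooth _
  refine ((integrable_norm_sq (SchwartzMap.fderivCLM ℝ (Eu 3) (Fin 4 → ℂ) F)).const_mul 12).mono'
    (continuous_gsq hF).aestronglyMeasurable (.of_forall fun x => ?_)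
  rw [norm_of_nonneg (gsq_nonneg _ x), gsq_eq hF]
  calc ∑ j, ip (pd j F x) (pd j F x) ≤ ∑ _j : Fin 3, 4 * ‖fderiv ℝ F x‖ ^ 2 :=
        Finset.sum_le_sum fun j _ => (ip_self_le_norm _).trans
          (mul_le_mul_of_nonneg_left (pow_le_pow_left₀ (norm_nonneg _) (norm_pd_le _ j x) 2)
            (by norm_num))
    _ = 12 * ‖fderiv ℝ F x‖ ^ 2 := by simp; ring
    _ = _ := rfl

end

/-! ### Geometric bounds from asymptotic flatness -/

/-- The decay rate of the first derivatives of the metric. -/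
def er (ε σ : ℝ) (x : Eu 3) : ℝ := ε * (ji x * jd σ x)

section

variable {ε σ : ℝ}

lemma er_nonneg (h0 : 0 ≤ ε) (x : Eu 3) : 0 ≤ er ε σ x :=
  mul_nonneg h0 (mul_nonneg (ji_pos x).le (jd_pos σ x).le)

lemma norm_mul_er_le (h1 : ε ≤ 1) (hσ : 0 ≤ σ) (x : Eu 3) : ‖x‖ * er ε σ x ≤ 1 := by
  have e : ‖x‖ * er ε σ x = ε * ((‖x‖ * ji x) * jd σ x) := by unfold er; ring
  rw [e]
  have a := norm_mul_ji_le x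
  have b := jd_le_one hσ x
  have c := (jd_pos σ x).le
  exact mul_le_one₀ h1 (mul_nonneg (mul_nonneg (norm_nonneg x) (ji_pos x).le) c)
    (mul_le_one₀ a c b)

lemma er_sq_le (h0 : 0 ≤ ε) (h1 : ε ≤ 1) (hσ : 0 ≤ σ) (x : Eu 3) :
    er ε σ x ^ 2 ≤ ε * (ji x ^ 2 * jd σ x) := by
  have e : er ε σ x ^ 2 = (ε * jd σ x) * (ε * (ji x ^ 2 * jd σ x)) := by unfold er; ring
  rw [e]
  have b := jd_le_one hσ x
  have c := (jd_pos σ x).le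
  exact mul_le_of_le_one_left (by positivity) (mul_le_one₀ h1 c b)

/-- Bounded functions whose first derivatives decay like `er`. -/
structure S0 (ε σ : ℝ) (f : Eu 3 → ℝ) (c a : ℝ) : Prop where
  smooth : Smooth f
  le : ∀ x, |f x| ≤ c
  pd_le : ∀ j x, |pd j f x| ≤ a * er ε σ x

/-- Functions decaying like `er`, with a gain of one power of `‖x‖` for first derivatives. -/
structure S1 (ε σ : ℝ) (f : Eu 3 → ℝ) (a b : ℝ) : Prop where
  smooth : Smooth f
  le : ∀ x, |f x| ≤ a * er ε σ x
  pd_le : ∀ j x, ‖x‖ * |pd j f x| ≤ b * er ε σ x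

lemma S1.add {f g : Eu 3 → ℝ} {a b a' b' : ℝ} (hf : S1 ε σ f a b) (hg : S1 ε σ g a' b') :
    S1 ε σ (fun x => f x + g x) (a + a') (b + b') where
  smooth := hf.smooth.add hg.smooth
  le x := by
    have := abs_add_le (f x) (g x)
    linarith [hf.le x, hg.le x]
  pd_le j x := by
    rw [pd_add hf.smooth hg.smooth]
    have := mul_le_mul_of_nonneg_left (abs_add_le (pd j f x) (pd j g x)) (norm_nonneg x)
    linarith [hf.pd_le j x, hg.pd_le j x]

lemma S1.const_mul {f : Eu 3 → ℝ} {a b : ℝ} (hf : S1 ε σ f a b) (r : ℝ) :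
    S1 ε σ (fun x => r * f x) (|r| * a) (|r| * b) where
  smooth := (Smooth.const r).mul hf.smooth
  le x := by
    rw [abs_mul, mul_assoc]
    exact mul_le_mul_of_nonneg_left (hf.le x) (abs_nonneg r)
  pd_le j x := by
    rw [pd_const_mul hf.smooth, abs_mul, mul_left_comm, mul_assoc]
    exact mul_le_mul_of_nonneg_left (hf.pd_le j x) (abs_nonneg r)

lemma S1.sub {f g : Eu 3 → ℝ} {a b a' b' : ℝ} (hf : S1 ε σ f a b) (hg : S1 ε σ g a' b') :
    S1 ε σ (fun x => f x - g x) (a + a') (b + b') := by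
  simpa [sub_eq_add_neg] using hf.add (hg.const_mul (-1))

lemma S1.sum {f : Fin 3 → Eu 3 → ℝ} {a b : ℝ} (hf : ∀ i, S1 ε σ (f i) a b) :
    S1 ε σ (fun x => ∑ i, f i x) (3 * a) (3 * b) := by
  simp only [Fin.sum_univ_three]
  have := ((hf 0).add (hf 1)).add (hf 2)
  rwa [show 3 * a = a + a + a by ring, show 3 * b = b + b + b by ring]

lemma S0.mul (h0 : 0 ≤ ε) (h1 : ε ≤ 1) (hσ : 0 ≤ σ) {f g : Eu 3 → ℝ} {c a a' b' : ℝ}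
    (hf : S0 ε σ f c a) (hg : S1 ε σ g a' b') :
    S1 ε σ (fun x => f x * g x) (c * a') (|a * a'| + c * b') where
  smooth := hf.smooth.mul hg.smooth
  le x := (abs_mul_le' (hf.le x) (hg.le x)).trans (mul_assoc _ _ _).ge
  pd_le j x := by
    rw [pd_mul hf.smooth hg.smooth]
    have e0 := er_nonneg (σ := σ) h0 x
    have c0 : 0 ≤ c := (abs_nonneg _).trans (hf.le x)
    have t1 := abs_mul_le' (hf.pd_le j x) (hg.le x)
    have t2 : ‖x‖ * |f x * pd j g x| ≤ c * (b' * er ε σ x) := by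
      rw [abs_mul, mul_left_comm]
      exact mul_le_mul (hf.le x) (hg.pd_le j x) (by positivity) c0
    have t3 : ‖x‖ * |pd j f x * g x| ≤ |a * a'| * er ε σ x := by
      calc ‖x‖ * |pd j f x * g x| ≤ ‖x‖ * (a * er ε σ x * (a' * er ε σ x)) :=
            mul_le_mul_of_nonneg_left t1 (norm_nonneg x)
        _ = (a * a') * ((‖x‖ * er ε σ x) * er ε σ x) := by ring
        _ ≤ |a * a'| * (1 * er ε σ x) :=
            mul_le_mul (le_abs_self _)
              (mul_le_mul_of_nonneg_right (norm_mul_er_le h1 hσ x) e0)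
              (mul_nonneg (mul_nonneg (norm_nonneg x) e0) e0) (abs_nonneg _)
        _ = _ := by ring
    have := mul_le_mul_of_nonneg_left (abs_add_le (pd j f x * g x) (f x * pd j g x))
      (norm_nonneg x)
    linarith

/-- A smooth metric whose inverse is close to the identity. -/
structure NearFlat (ε σ : ℝ) (h : Eu 3 → Matrix (Fin 3) (Fin 3) ℝ) : Prop where
  ε0 : 0 ≤ ε
  ε1 : ε ≤ 1 / 100
  σ0 : 0 ≤ σ
  smooth : ∀ j k, Smooth fun x => h x j k
  symm : ∀ x, (h x).IsSymm
  det_pos : ∀ x, 0 < (h x).det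
  near : ∀ j k x, |(h x)⁻¹ j k - if j = k then 1 else 0| ≤ ε * jd σ x
  pd_le : ∀ l j k x, |pd l (fun y => (h y)⁻¹ j k) x| ≤ er ε σ x
  pd_pd_le : ∀ i l j k x, ‖x‖ * |pd i (fun y => pd l (fun z => (h z)⁻¹ j k) y) x| ≤ er ε σ x

namespace NearFlat

variable {h : Eu 3 → Matrix (Fin 3) (Fin 3) ℝ} (N : NearFlat ε σ h)
include N

lemma smooth_q (j k : Fin 3) : Smooth fun x => (h x)⁻¹ j k :=
  smooth_inv N.smooth (fun x => (N.det_pos x).ne') j k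

lemma mul_q (x : Eu 3) : h x * (h x)⁻¹ = 1 :=
  Matrix.mul_nonsing_inv _ (isUnit_iff_ne_zero.2 (N.det_pos x).ne')

lemma q_mul (x : Eu 3) : (h x)⁻¹ * h x = 1 :=
  Matrix.nonsing_inv_mul _ (isUnit_iff_ne_zero.2 (N.det_pos x).ne')

lemma near_le (j k : Fin 3) (x : Eu 3) : |(h x)⁻¹ j k - if j = k then 1 else 0| ≤ ε :=
  (N.near j k x).trans (mul_le_of_le_one_right N.ε0 (jd_le_one N.σ0 x))

lemma S0_q (j k : Fin 3) : S0 ε σ (fun x => (h x)⁻¹ j k) 2 1 where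
  smooth := N.smooth_q j k
  le x := by
    have h1 := N.near_le j k x
    have h2 := N.ε1
    split_ifs at h1 <;> rw [abs_le] at * <;> constructor <;> linarith [h1.1, h1.2]
  pd_le l x := by rw [one_mul]; exact N.pd_le l j k x

lemma S1_pd_q (l j k : Fin 3) : S1 ε σ (fun x => pd l (fun y => (h y)⁻¹ j k) x) 1 1 where
  smooth := (N.smooth_q j k).pd l
  le x := by rw [one_mul]; exact N.pd_le l j k x
  pd_le i x := by rw [one_mul]; exact N.pd_pd_le i l j k x

lemma abs_h_le (j k : Fin 3) (x : Eu 3) : |h x j k| ≤ 2 := by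
  have hS : ∑ k, |h x j k| ≤ 1 + 3 * ε * ∑ k, |h x j k| := by
    have e : ∀ k, h x j k = (if j = k then 1 else 0)
        - ∑ l, h x j l * ((h x)⁻¹ l k - if l = k then 1 else 0) := fun k => by
      have h1 := congrFun (congrFun (N.mul_q x) j) k
      rw [Matrix.mul_apply, Matrix.one_apply] at h1
      simp [mul_sub, Finset.sum_sub_distrib, h1]
    have b : ∀ k, |h x j k| ≤ (if j = k then 1 else 0) + ε * ∑ l, |h x j l| := fun k => by
      nth_rewrite 1 [e k]
      refine (abs_sub _ _).trans (add_le_add (by split_ifs <;> simp) ?_)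
      rw [Finset.mul_sum]
      refine (Finset.abs_sum_le_sum_abs _ _).trans (Finset.sum_le_sum fun l _ => ?_)
      rw [abs_mul, mul_comm]
      exact mul_le_mul_of_nonneg_right (N.near_le l k x) (abs_nonneg _)
    refine (Finset.sum_le_sum fun k _ => b k).trans ?_
    rw [Finset.sum_add_distrib]
    simp
    linarith
  have hk : |h x j k| ≤ ∑ k, |h x j k| :=
    Finset.single_le_sum (f := fun k => |h x j k|) (fun _ _ => abs_nonneg _) (Finset.mem_univ k)
  have h0 : 0 ≤ ∑ k, |h x j k| := Finset.sum_nonneg fun _ _ => abs_nonneg _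
  have := mul_le_mul_of_nonneg_right N.ε1 h0
  linarith

lemma pd_h_eq (l a b : Fin 3) (x : Eu 3) : pd l (fun y => h y a b) x
    = -∑ c, ∑ d, h x a c * (h x d b * pd l (fun y => (h y)⁻¹ c d) x) := by
  have e : ∀ d, (∑ c, pd l (fun y => h y a c) x * (h x)⁻¹ c d)
      = -∑ c, h x a c * pd l (fun y => (h y)⁻¹ c d) x := fun d => by
    have h1 : pd l (fun y => ∑ c, h y a c * (h y)⁻¹ c d) x = 0 := by
      have : (fun y => ∑ c, h y a c * (h y)⁻¹ c d) = fun _ => (1 : Matrix (Fin 3) (Fin 3) ℝ) a d := by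
        ext y; rw [← N.mul_q y, Matrix.mul_apply]
      rw [this, pd_const]
    rw [pd_sum fun c => (N.smooth a c).mul (N.smooth_q c d)] at h1
    simp only [pd_mul (N.smooth a _) (N.smooth_q _ d)] at h1
    rw [Finset.sum_add_distrib] at h1
    linarith
  calc pd l (fun y => h y a b) x
      = ∑ c, pd l (fun y => h y a c) x * (∑ d, (h x)⁻¹ c d * h x d b) := by
        simp only [← Matrix.mul_apply, N.q_mul x, Matrix.one_apply]
        simp
    _ = ∑ d, (∑ c, pd l (fun y => h y a c) x * (h x)⁻¹ c d) * h x d b := by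
        simp only [Finset.mul_sum, Finset.sum_mul, mul_assoc]
        exact Finset.sum_comm
    _ = _ := by
        simp only [e, neg_mul, Finset.sum_mul, Finset.sum_neg_distrib]
        rw [Finset.sum_comm]
        refine congrArg _ (Finset.sum_congr rfl fun c _ => Finset.sum_congr rfl fun d _ => ?_)
        ring

lemma S0_h (a b : Fin 3) : S0 ε σ (fun x => h x a b) 2 36 where
  smooth := N.smooth a b
  le := N.abs_h_le a b
  pd_le l x := by
    rw [N.pd_h_eq, abs_neg]
    refine (abs_sum3_le fun c => abs_sum3_le fun d =>
      abs_mul_le' (N.abs_h_le a c x) (abs_mul_le' (N.abs_h_le d b x) (N.pd_le l c d x))).trans ?_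
    linarith

lemma S0_mul {f g : Eu 3 → ℝ} {c a a' b' A B : ℝ} (hf : S0 ε σ f c a) (hg : S1 ε σ g a' b')
    (hA : c * a' = A) (hB : |a * a'| + c * b' = B) : S1 ε σ (fun x => f x * g x) A B := by
  subst hA hB
  exact hf.mul N.ε0 (N.ε1.trans (by norm_num)) N.σ0 hg

lemma S1_pd_h (l a b : Fin 3) : S1 ε σ (fun x => pd l (fun y => h y a b) x) 36 1332 := by
  have h1 : ∀ c d, S1 ε σ
      (fun x => h x a c * (h x d b * pd l (fun y => (h y)⁻¹ c d) x)) 4 148 := fun c d =>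
    N.S0_mul (N.S0_h a c) (N.S0_mul (N.S0_h d b) (N.S1_pd_q l c d) (A := 2) (B := 38)
      (by norm_num) (by norm_num)) (by norm_num) (by norm_num)
  have h2 := (S1.sum fun c => S1.sum (h1 c)).const_mul (-1)
  simp only [neg_mul, one_mul, ← N.pd_h_eq] at h2
  norm_num at h2
  exact h2

lemma S1_Chr (i j k : Fin 3) : S1 ε σ (fun x => Chr h i j k x) 324 12150 := by
  have h1 : ∀ l, S1 ε σ (fun x => (h x)⁻¹ i l * (pd j (fun y => h y l k) x
      + pd k (fun y => h y j l) x - pd l (fun y => h y j k) x)) 216 8100 := fun l =>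
    N.S0_mul (N.S0_q i l) (((N.S1_pd_h j l k).add (N.S1_pd_h k j l)).sub (N.S1_pd_h l j k))
      (by norm_num) (by norm_num)
  have h2 := (S1.sum h1).const_mul (1 / 2)
  norm_num at h2
  simpa [Chr] using h2

end NearFlat

end

/-- The logarithmic derivative of the volume density. -/
def logVol (h : Eu 3 → Matrix (Fin 3) (Fin 3) ℝ) (k : Fin 3) (x : Eu 3) : ℝ :=
  -(1 / 2) * ∑ a, ∑ b, h x b a * pd k (fun y => (h y)⁻¹ a b) x

/-- The field whose divergence is the leading part of the scalar curvature. -/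
def curvField (h : Eu 3 → Matrix (Fin 3) (Fin 3) ℝ) (i : Fin 3) (x : Eu 3) : ℝ :=
  (∑ j, ∑ k, (h x)⁻¹ j k * Chr h i j k x) - ∑ j, ∑ k, (h x)⁻¹ j i * Chr h k j k x

/-- Jacobi's formula in dimension three. -/
lemma pd_det {M : Eu 3 → Matrix (Fin 3) (Fin 3) ℝ} (s : ∀ j k, Smooth fun x => M x j k) (k : Fin 3)
    (x : Eu 3) : pd k (fun y => (M y).det) x
      = ∑ a, ∑ b, (M x).adjugate b a * pd k (fun y => M y a b) x := by
  have m3 : ∀ a b c d e f : Fin 3, Smooth fun x => M x a b * M x c d * M x e f :=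
    fun a b c d e f => ((s a b).mul (s c d)).mul (s e f)
  have p3 : ∀ a b c d e f : Fin 3, pd k (fun x => M x a b * M x c d * M x e f) x
      = (pd k (fun x => M x a b) x * M x c d + M x a b * pd k (fun x => M x c d) x) * M x e f
        + M x a b * M x c d * pd k (fun x => M x e f) x := fun a b c d e f => by
    rw [pd_mul ((s a b).mul (s c d)) (s e f), pd_mul (s a b) (s c d)]
  have s2 := (m3 0 0 1 1 2 2).sub (m3 0 0 1 2 2 1)
  have s3 := s2.sub (m3 0 1 1 0 2 2)
  have s4 := s3.add (m3 0 1 1 2 2 0)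
  have s5 := s4.add (m3 0 2 1 0 2 1)
  simp only [Matrix.det_fin_three]
  rw [pd_sub s5 (m3 0 2 1 1 2 0), pd_add s4 (m3 0 2 1 0 2 1), pd_add s3 (m3 0 1 1 2 2 0),
    pd_sub s2 (m3 0 1 1 0 2 2), pd_sub (m3 0 0 1 1 2 2) (m3 0 0 1 2 2 1)]
  simp only [p3, Matrix.adjugate_fin_three, Fin.sum_univ_three, Matrix.of_apply]
  simp
  ring

namespace NearFlat

variable {ε σ : ℝ} {h : Eu 3 → Matrix (Fin 3) (Fin 3) ℝ} (N : NearFlat ε σ h)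
include N

lemma S1_logVol (k : Fin 3) : S1 ε σ (logVol h k) 9 171 := by
  have h1 : ∀ a b, S1 ε σ (fun x => h x b a * pd k (fun y => (h y)⁻¹ a b) x) 2 38 := fun a b =>
    N.S0_mul (N.S0_h b a) (N.S1_pd_q k a b) (by norm_num) (by norm_num)
  have h2 := (S1.sum fun a => S1.sum (h1 a)).const_mul (-(1 / 2))
  rw [show |-(1 / 2 : ℝ)| * (3 * (3 * 2)) = 9 by norm_num [abs_neg],
    show |-(1 / 2 : ℝ)| * (3 * (3 * 38)) = 171 by norm_num [abs_neg]] at h2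
  exact h2

lemma S1_curvField (i : Fin 3) : S1 ε σ (curvField h i) 11664 443232 := by
  have h1 : ∀ j k i' k' l', S1 ε σ (fun x => (h x)⁻¹ j k * Chr h i' k' l' x) 648 24624 :=
    fun j k i' k' l' => N.S0_mul (N.S0_q j k) (N.S1_Chr i' k' l') (by norm_num) (by norm_num)
  have h2 := (S1.sum fun j => S1.sum fun k => h1 j k i j k).sub
    (S1.sum fun j => S1.sum fun k => h1 j i k j k)
  norm_num at h2
  exact h2

lemma det_q_mul (x : Eu 3) : (h x).det * (h x)⁻¹.det = 1 := by
  rw [← Matrix.det_mul, N.mul_q, Matrix.det_one]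

lemma sdet_sq_mul (x : Eu 3) : sdet h x * sdet h x * (h x)⁻¹.det = 1 := by
  rw [sdet, Real.mul_self_sqrt (N.det_pos x).le, N.det_q_mul]

lemma pd_det_q (k : Fin 3) (x : Eu 3) : pd k (fun y => (h y)⁻¹.det) x
    = (h x)⁻¹.det * ∑ a, ∑ b, h x b a * pd k (fun y => (h y)⁻¹ a b) x := by
  have s := N.smooth_q
  have hadj : ∀ a b, (h x)⁻¹.det * h x b a = (h x)⁻¹.adjugate b a := fun a b => by
    have h1 : (h x)⁻¹.adjugate * ((h x)⁻¹ * h x) = (h x)⁻¹.det • h x := by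
      rw [← mul_assoc, Matrix.adjugate_mul, smul_mul_assoc, one_mul]
    rw [N.q_mul, mul_one] at h1
    rw [h1]; rfl
  simp only [Finset.mul_sum, ← mul_assoc, hadj]
  exact pd_det s k x

lemma pd_sdet (k : Fin 3) (x : Eu 3) : pd k (sdet h) x = sdet h x * logVol h k x := by
  have sw := smooth_sdet N.smooth N.det_pos
  have sd : Smooth fun y => (h y)⁻¹.det := smooth_det N.smooth_q
  have e : (fun y => sdet h y * sdet h y * (h y)⁻¹.det) = fun _ => 1 := funext N.sdet_sq_mul
  have h1 : pd k (fun y => sdet h y * sdet h y * (h y)⁻¹.det) x = 0 := by rw [e, pd_const]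
  have hw := sdet_pos N.det_pos x
  have h2 := N.sdet_sq_mul x
  rw [pd_mul (sw.mul sw) sd, pd_mul sw sw, N.pd_det_q] at h1
  set q := (h x)⁻¹.det
  set T := ∑ a, ∑ b, h x b a * pd k (fun y => (h y)⁻¹ a b) x
  have hq : sdet h x * q ≠ 0 := fun h0 => by
    rw [mul_assoc, h0, mul_zero] at h2; exact zero_ne_one h2
  have h3 : sdet h x * q * (2 * pd k (sdet h) x + sdet h x * T) = 0 := by linarith
  have h4 := (mul_eq_zero.1 h3).resolve_left hq
  rw [logVol]
  linarith

lemma abs_det_q_sub_one_le (x : Eu 3) : |(h x)⁻¹.det - 1| ≤ 4 * (ε * jd σ x) := by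
  set b := ε * jd σ x with hb
  have b0 : 0 ≤ b := mul_nonneg N.ε0 (jd_pos σ x).le
  have b1 : b ≤ 1 / 100 := (mul_le_of_le_one_right N.ε0 (jd_le_one N.σ0 x)).trans N.ε1
  have n : ∀ j k, |(h x)⁻¹ j k - if j = k then 1 else 0| ≤ b := fun j k => N.near j k x
  generalize (h x)⁻¹ = q at *
  set s : Fin 3 → Fin 3 → ℝ := fun j k => q j k - if j = k then 1 else 0 with hs
  have m2 : ∀ j k j' k', |s j k * s j' k'| ≤ b * b := fun j k j' k' =>
    abs_mul_le' (n j k) (n j' k')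
  have m3 : ∀ j k j' k' i l, |s j k * s j' k' * s i l| ≤ b * b * b := fun j k j' k' i l =>
    abs_mul_le' (m2 j k j' k') (n i l)
  have e : q.det - 1 = (s 0 0 + s 1 1 + s 2 2)
      + (s 0 0 * s 1 1 + s 0 0 * s 2 2 + s 1 1 * s 2 2 - s 0 1 * s 1 0 - s 0 2 * s 2 0
        - s 1 2 * s 2 1)
      + (s 0 0 * s 1 1 * s 2 2 - s 0 0 * s 1 2 * s 2 1 - s 0 1 * s 1 0 * s 2 2
        + s 0 1 * s 1 2 * s 2 0 + s 0 2 * s 1 0 * s 2 1 - s 0 2 * s 1 1 * s 2 0) := by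
    simp only [hs, Matrix.det_fin_three]
    simp
    ring
  have q2 : b * b ≤ b / 100 := by nlinarith
  have q3 : b * b * b ≤ b / 100 := by nlinarith
  rw [e]
  simp only [abs_le] at n m2 m3 ⊢
  constructor
  · linarith [(n 0 0).1, (n 1 1).1, (n 2 2).1, (m2 0 0 1 1).1, (m2 0 0 2 2).1, (m2 1 1 2 2).1,
      (m2 0 1 1 0).2, (m2 0 2 2 0).2, (m2 1 2 2 1).2, (m3 0 0 1 1 2 2).1, (m3 0 0 1 2 2 1).2,
      (m3 0 1 1 0 2 2).2, (m3 0 1 1 2 2 0).1, (m3 0 2 1 0 2 1).1, (m3 0 2 1 1 2 0).2]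
  · linarith [(n 0 0).2, (n 1 1).2, (n 2 2).2, (m2 0 0 1 1).2, (m2 0 0 2 2).2, (m2 1 1 2 2).2,
      (m2 0 1 1 0).1, (m2 0 2 2 0).1, (m2 1 2 2 1).1, (m3 0 0 1 1 2 2).2, (m3 0 0 1 2 2 1).1,
      (m3 0 1 1 0 2 2).1, (m3 0 1 1 2 2 0).2, (m3 0 2 1 0 2 1).2, (m3 0 2 1 1 2 0).1]

lemma abs_sdet_sub_one_le (x : Eu 3) : |sdet h x - 1| ≤ 8 * (ε * jd σ x) := by
  have hd := N.abs_det_q_sub_one_le x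
  have b1 : ε * jd σ x ≤ 1 / 100 :=
    (mul_le_of_le_one_right N.ε0 (jd_le_one N.σ0 x)).trans N.ε1
  have hw := sdet_pos N.det_pos x
  have h2 := N.sdet_sq_mul x
  set w := sdet h x
  set q := (h x)⁻¹.det
  have hq : 1 / 2 ≤ q := by linarith [(abs_le.1 hd).1]
  have e : (w - 1) * ((w + 1) * q) = 1 - q := by linarith
  have h3 : |w - 1| * ((w + 1) * q) = |q - 1| := by
    rw [abs_sub_comm q, ← e, abs_mul, abs_of_pos (a := (w + 1) * q) (by positivity)]
  have h4 : 1 / 2 ≤ (w + 1) * q := by nlinarith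
  have := mul_le_mul_of_nonneg_left h4 (abs_nonneg (w - 1))
  linarith

/-- The quadratic remainder of the scalar curvature. -/
lemma Rscal_eq (x : Eu 3) : Rscal h x - ∑ i, pd i (curvField h i) x
    = (∑ j, ∑ k, (h x)⁻¹ j k * ((∑ i, ∑ l, Chr h l j k x * Chr h i i l x)
        - ∑ i, ∑ l, Chr h l j i x * Chr h i k l x))
      - (∑ i, ∑ j, ∑ k, pd i (fun y => (h y)⁻¹ j k) x * Chr h i j k x)
      + ∑ i, ∑ j, ∑ k, pd i (fun y => (h y)⁻¹ j i) x * Chr h k j k x := by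
  have s := N.smooth_q
  have sC := fun i j k => (N.S1_Chr i j k).smooth
  have e : ∀ i, pd i (curvField h i) x
      = (∑ j, ∑ k, (pd i (fun y => (h y)⁻¹ j k) x * Chr h i j k x
          + (h x)⁻¹ j k * pd i (fun y => Chr h i j k y) x))
        - ∑ j, ∑ k, (pd i (fun y => (h y)⁻¹ j i) x * Chr h k j k x
          + (h x)⁻¹ j i * pd i (fun y => Chr h k j k y) x) := fun i => by
    unfold curvField
    rw [pd_sub (Smooth.sum fun j => Smooth.sum fun k => (s j k).mul (sC i j k))
        (Smooth.sum fun j => Smooth.sum fun k => (s j i).mul (sC k j k)),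
      pd_sum fun j => Smooth.sum fun k => (s j k).mul (sC i j k),
      pd_sum fun j => Smooth.sum fun k => (s j i).mul (sC k j k)]
    simp only [pd_sum fun k => (s _ k).mul (sC i _ k), pd_sum fun k => (s _ i).mul (sC k _ k),
      pd_mul (s _ _) (sC _ _ _)]
  have c1 : ∑ i, ∑ j, ∑ k, (h x)⁻¹ j k * pd i (fun y => Chr h i j k y) x
      = ∑ j, ∑ k, (h x)⁻¹ j k * ∑ i, pd i (fun y => Chr h i j k y) x := by
    rw [Finset.sum_comm]
    refine Finset.sum_congr rfl fun j _ => ?_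
    rw [Finset.sum_comm]
    simp only [Finset.mul_sum]
  have c2 : ∑ i, ∑ j, ∑ k, (h x)⁻¹ j i * pd i (fun y => Chr h k j k y) x
      = ∑ j, ∑ k, (h x)⁻¹ j k * ∑ i, pd k (fun y => Chr h i j i y) x := by
    rw [Finset.sum_comm]
    simp only [Finset.mul_sum]
  simp only [e, Finset.sum_sub_distrib, Finset.sum_add_distrib, c1, c2, Rscal, mul_add, mul_sub]
  ring

lemma curv_quad_le (x : Eu 3) :
    |∑ j, ∑ k, (h x)⁻¹ j k * ((∑ i, ∑ l, Chr h l j k x * Chr h i i l x)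
        - ∑ i, ∑ l, Chr h l j i x * Chr h i k l x)| ≤ 35000000 * er ε σ x ^ 2 := by
  have g := fun i j k => (N.S1_Chr i j k).le x
  refine (abs_sum3_le fun j => abs_sum3_le fun k => abs_mul_le' ((N.S0_q j k).le x)
    ((abs_sub _ _).trans (add_le_add
      (abs_sum3_le fun i => abs_sum3_le fun l => abs_mul_le' (g l j k) (g i i l))
      (abs_sum3_le fun i => abs_sum3_le fun l => abs_mul_le' (g l j i) (g i k l))))).trans ?_
  nlinarith [pow_two_nonneg (er ε σ x)]

lemma abs_Rscal_sub_le (x : Eu 3) :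
    |Rscal h x - ∑ i, pd i (curvField h i) x| ≤ 36000000 * er ε σ x ^ 2 := by
  have g := fun i j k => (N.S1_Chr i j k).le x
  rw [N.Rscal_eq]
  refine (abs_add_le _ _).trans ((add_le_add ((abs_sub _ _).trans (add_le_add (N.curv_quad_le x)
    (abs_sum3_le fun i => abs_sum3_le fun j => abs_sum3_le fun k =>
      abs_mul_le' (N.pd_le i j k x) (g i j k))))
    (abs_sum3_le fun i => abs_sum3_le fun j => abs_sum3_le fun k =>
      abs_mul_le' (N.pd_le i j i x) (g k j k))).trans ?_)
  nlinarith [pow_two_nonneg (er ε σ x)]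

lemma norm_mul_abs_Rscal_le (x : Eu 3) : ‖x‖ * |Rscal h x| ≤ 38000000 * er ε σ x := by
  have e0 := er_nonneg (σ := σ) N.ε0 x
  have h1 := N.abs_Rscal_sub_le x
  have h2 : ‖x‖ * |∑ i, pd i (curvField h i) x| ≤ 1329696 * er ε σ x := by
    refine (mul_le_mul_of_nonneg_left (Finset.abs_sum_le_sum_abs _ _) (norm_nonneg x)).trans ?_
    rw [Finset.mul_sum, Fin.sum_univ_three]
    have := fun i => (N.S1_curvField i).pd_le i x
    linarith [this 0, this 1, this 2]
  have h3 : ‖x‖ * er ε σ x ^ 2 ≤ er ε σ x := by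
    rw [pow_two, ← mul_assoc]
    exact mul_le_of_le_one_left e0 (norm_mul_er_le (N.ε1.trans (by norm_num)) N.σ0 x)
  have h4 : |Rscal h x| ≤ 36000000 * er ε σ x ^ 2 + |∑ i, pd i (curvField h i) x| := by
    have := abs_sub_abs_le_abs_sub (Rscal h x) (∑ i, pd i (curvField h i) x)
    linarith
  have := mul_le_mul_of_nonneg_left h4 (norm_nonneg x)
  nlinarith

lemma continuous_Rscal : Continuous (Rscal h) := by
  have s := fun j k => (N.smooth_q j k).continuous
  have sC := fun i j k => (N.S1_Chr i j k).smooth.continuous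
  have sD := fun l i j k => ((N.S1_Chr i j k).smooth.pd l).continuous
  have c2 : ∀ f g : Fin 3 → Fin 3 → Eu 3 → ℝ, (∀ i l, Continuous (f i l)) →
      (∀ i l, Continuous (g i l)) → Continuous fun x => ∑ i, ∑ l, f i l x * g i l x :=
    fun f g hf hg => continuous_finsetSum _ fun i _ => continuous_finsetSum _ fun l _ =>
      (hf i l).mul (hg i l)
  exact continuous_finsetSum _ fun j _ => continuous_finsetSum _ fun k _ => (s j k).mul
    ((((continuous_finsetSum _ fun i _ => sD i i j k).sub
      (continuous_finsetSum _ fun i _ => sD k i j i)).add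
      (c2 (fun _ l => Chr h l j k) (fun i l => Chr h i i l) (fun _ l => sC l j k)
        fun i l => sC i i l)).sub
      (c2 (fun i l => Chr h l j i) (fun i l => Chr h i k l) (fun i l => sC l j i)
        fun i l => sC i k l))

lemma geo (σ0 : 0 < σ) (σ1 : σ < 1) (hε : 40000000 * ε ≤ 1 / 100) :
    Geo (40000000 * ε) σ (fun j k x => (h x)⁻¹ j k) (sdet h) (logVol h) (curvField h)
      (Rscal h) := by
  have b0 : ∀ x, 0 ≤ ε * jd σ x := fun x => mul_nonneg N.ε0 (jd_pos σ x).le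
  have e0 := fun x => er_nonneg (σ := σ) N.ε0 x
  have ee : ∀ x, 40000000 * ε * (ji x * jd σ x) = 40000000 * er ε σ x := fun x => by
    unfold er; ring
  exact
    { κ0 := by linarith [N.ε0]
      κ1 := hε
      σ0 := σ0
      σ1 := σ1
      sp := N.smooth_q
      sw := smooth_sdet N.smooth N.det_pos
      sℓ := fun j => (N.S1_logVol j).smooth
      sV := fun j => (N.S1_curvField j).smooth
      cR := N.continuous_Rscal
      symm := fun j k x => ((N.symm x).inv.apply k j)
      p_near := fun j k x => (N.near j k x).trans (by linarith [b0 x])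
      pd_p := fun l j k x => (N.pd_le l j k x).trans (by rw [ee]; linarith [e0 x])
      w_near := fun x => (N.abs_sdet_sub_one_le x).trans (by linarith [b0 x])
      pd_w := N.pd_sdet
      ℓ_le := fun k x => ((N.S1_logVol k).le x).trans (by rw [ee]; linarith [e0 x])
      pd_ℓ_le := fun j k x => ((N.S1_logVol k).pd_le j x).trans (by rw [ee]; linarith [e0 x])
      V_le := fun k x => ((N.S1_curvField k).le x).trans (by rw [ee]; linarith [e0 x])
      R_le := fun x => (N.norm_mul_abs_Rscal_le x).trans (by rw [ee]; linarith [e0 x])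
      R_div := fun x => (N.abs_Rscal_sub_le x).trans (by
        have := er_sq_le N.ε0 (N.ε1.trans (by norm_num)) N.σ0 x
        nlinarith [mul_nonneg N.ε0 (mul_nonneg (pow_nonneg (ji_pos x).le 2) (jd_pos σ x).le)]) }

end NearFlat

lemma abs_entry_le_opNorm (M : Matrix (Fin 3) (Fin 3) ℝ) (a b : Fin 3) : |M a b| ≤ opNorm M := by
  have h1 := ContinuousLinearMap.le_opNorm
    (LinearMap.toContinuousLinearMap (Matrix.toEuclideanLin M)) (EuclideanSpace.single b (1 : ℝ))
  have h2 := PiLp.norm_apply_le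
    (LinearMap.toContinuousLinearMap (Matrix.toEuclideanLin M) (EuclideanSpace.single b (1 : ℝ))) a
  have h3 : LinearMap.toContinuousLinearMap (Matrix.toEuclideanLin M)
      (EuclideanSpace.single b (1 : ℝ)) a = M a b := by
    simp [Matrix.toEuclideanLin, Matrix.toLpLin_apply]
  rw [h3] at h2
  rw [PiLp.norm_single, norm_one, mul_one] at h1
  exact h2.trans h1

lemma opNorm_nonneg {n : ℕ} (M : Matrix (Fin n) (Fin n) ℝ) : 0 ≤ opNorm M := norm_nonneg _

lemma nearFlat_of_aFlat {ε σ CI Ch : ℝ} {h : Eu 3 → Matrix (Fin 3) (Fin 3) ℝ} (ε0 : 0 ≤ ε)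
    (ε1 : ε ≤ 1 / 100) (σ0 : 0 ≤ σ) (sh : ∀ j k, Smooth fun x => h x j k)
    (hs : ∀ x, (h x).IsSymm) (hp : ∀ x, (h x).PosDef) (hI : CI ≤ ε) (hC : Ch ≤ ε)
    (hA : AFlat h σ CI Ch) : NearFlat ε σ h := by
  have b : ∀ x, (∑ j, opNorm (pdM j (fun y => (h y)⁻¹) x))
      + ‖x‖ * (∑ j, ∑ k, opNorm (pdM j (pdM k (fun y => (h y)⁻¹)) x)) ≤ er ε σ x := fun x => by
    have h1 := hA.2 x
    have h2 : 0 ≤ ‖x‖ ^ 2 *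
        (∑ j, ∑ k, ∑ l, opNorm (pdM j (pdM k (pdM l (fun y => (h y)⁻¹))) x)) :=
      mul_nonneg (by positivity) (Finset.sum_nonneg fun _ _ => Finset.sum_nonneg fun _ _ =>
        Finset.sum_nonneg fun _ _ => opNorm_nonneg _)
    have h3 : jap x ^ (-(1 + σ)) = ji x * jd σ x := by
      have := jap_rpow_sub 1 σ x
      rw [pow_one] at this
      rw [← this]
      congr 1
      push_cast; ring
    have h4 : Ch * jap x ^ (-(1 + σ)) ≤ er ε σ x := by
      rw [h3]
      exact mul_le_mul_of_nonneg_right hC (mul_nonneg (ji_pos x).le (jd_pos σ x).le)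
    linarith
  have n1 : ∀ x, 0 ≤ ∑ j, opNorm (pdM j (fun y => (h y)⁻¹) x) := fun x =>
    Finset.sum_nonneg fun _ _ => opNorm_nonneg _
  have n2 : ∀ x, 0 ≤ ∑ j, ∑ k, opNorm (pdM j (pdM k (fun y => (h y)⁻¹)) x) := fun x =>
    Finset.sum_nonneg fun _ _ => Finset.sum_nonneg fun _ _ => opNorm_nonneg _
  refine ⟨ε0, ε1, σ0, sh, hs, fun x => (hp x).det_pos, fun j k x => ?_, fun l j k x => ?_,
    fun i l j k x => ?_⟩
  · have h1 := abs_entry_le_opNorm ((h x)⁻¹ - 1) j k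
    rw [Matrix.sub_apply, Matrix.one_apply] at h1
    exact (h1.trans (hA.1 x)).trans (mul_le_mul_of_nonneg_right hI (jd_pos σ x).le)
  · have h1 := abs_entry_le_opNorm (pdM l (fun y => (h y)⁻¹) x) j k
    have h2 := Finset.single_le_sum (f := fun l => opNorm (pdM l (fun y => (h y)⁻¹) x))
      (fun _ _ => opNorm_nonneg _) (Finset.mem_univ l)
    have h3 := mul_nonneg (norm_nonneg x) (n2 x)
    exact h1.trans (by linarith [b x])
  · have h1 := abs_entry_le_opNorm (pdM i (pdM l (fun y => (h y)⁻¹)) x) j k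
    have h2 := Finset.single_le_sum (f := fun l => opNorm (pdM i (pdM l (fun y => (h y)⁻¹)) x))
      (fun _ _ => opNorm_nonneg _) (Finset.mem_univ l)
    have h3 := Finset.single_le_sum
      (f := fun i => ∑ l, opNorm (pdM i (pdM l (fun y => (h y)⁻¹)) x))
      (fun _ _ => Finset.sum_nonneg fun _ _ => opNorm_nonneg _) (Finset.mem_univ i)
    have h4 := mul_le_mul_of_nonneg_left (h1.trans (h2.trans h3)) (norm_nonneg x)
    exact h4.trans (by linarith [b x, n1 x])

/-- **Local smoothing for the Dirac equation on asymptotically flat manifolds**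
(weighted version of Theorem 1 of Cacciafesta–de Suzzoni). -/
theorem stmt0 (σ ν N : ℝ) (hσ : σ ∈ Set.Ioo (0 : ℝ) 1) (hν : 0 < ν) (hνN : ν ≤ N) :
    ∃ ε > (0 : ℝ), ∀ η₁ : ℝ, 0 < η₁ → ∀ η₂ : ℝ, 0 < η₂ → ∃ C > (0 : ℝ),
      ∀ h : Eu 3 → Matrix (Fin 3) (Fin 3) ℝ,
        (∀ j k : Fin 3, ContDiff ℝ (⊤ : ℕ∞) fun x => h x j k) →
        (∀ x, (h x).IsSymm) → (∀ x, (h x).PosDef) →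
        Elliptic h ν N →
        ∀ CI Ch : ℝ, 0 ≤ CI → 0 ≤ Ch → CI ≤ ε → Ch ≤ ε → AFlat h σ CI Ch →
        ∀ m : ℝ, 0 ≤ m →
        ∀ φ : ℝ → ℝ, ContinuousOn φ (Set.Ici 0) → (∀ t, 0 ≤ t → 0 < φ t) →
        ∀ (A : Fin 3 → Eu 3 → Fin 4 → Fin 4 → ℂ) (B : Eu 3 → Fin 4 → Fin 4 → ℂ),
          (∀ j i k, ContDiff ℝ (⊤ : ℕ∞) fun x => A j x i k) →
          (∀ i k, ContDiff ℝ (⊤ : ℕ∞) fun x => B x i k) →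
          (∀ f g : Eu 3 → Fin 4 → ℂ, ContDiff ℝ (⊤ : ℕ∞) f → ContDiff ℝ (⊤ : ℕ∞) g →
            HasCompactSupport f → HasCompactSupport g →
            innC4 h (Hop A B f) g = innC4 h f (Hop A B g)) →
          (∀ f : Eu 3 → Fin 4 → ℂ, ContDiff ℝ (⊤ : ℕ∞) f → ∀ (x : Eu 3) (i : Fin 4),
            Hop A B (Hop A B f) x i
              = ((m : ℂ) ^ 2) * f x i - lapC h (fun y => f y i) x
                + ((Rscal h x / 4 : ℝ) : ℂ) * f x i) →
          ∀ (u : ℝ → Eu 3 → Fin 4 → ℂ) (u₀ : Eu 3 → Fin 4 → ℂ),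
            ContDiffOn ℝ (⊤ : ℕ∞) (fun p : ℝ × Eu 3 => u p.1 p.2)
              (Set.Ici (0 : ℝ) ×ˢ (Set.univ : Set (Eu 3))) →
            (∀ t, 0 ≤ t → ∃ F : SchwartzMap (Eu 3) (Fin 4 → ℂ), ⇑F = u t) →
            (∀ t, 0 ≤ t → ∀ (x : Eu 3) (i : Fin 4),
              Complex.I * ((φ t : ℝ) : ℂ) * derivWithin (fun s => u s x i) (Set.Ici 0) t
                = Hop A B (u t) x i) →
            (∀ x, u 0 x = u₀ x) →
            (∫ t in Set.Ioi (0 : ℝ), (φ t)⁻¹ *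
                ∫ x : Eu 3,
                  (jap x ^ (-(3 + 2 * η₁)) * (∑ i, ‖u t x i‖ ^ 2)
                    + jap x ^ (-(1 + 2 * η₂)) *
                        (∑ j, ∑ i, ‖pd j (fun y => u t y i) x‖ ^ 2)) * sdet h x)
              ≤ C * ∫ x : Eu 3, (∑ i, ‖Hop A B u₀ x i‖ ^ 2) * sdet h x := by
  obtain ⟨σ0, σ1⟩ := hσ
  have ε0 : 0 < σ / 10 ^ 12 := by positivity
  refine ⟨σ / 10 ^ 12, ε0, fun η₁ h₁ η₂ h₂ => ?_⟩
  set δ := min (min (2 * η₁) (2 * η₂)) σ with hδ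
  have δ0 : 0 < δ := lt_min (lt_min (by linarith) (by linarith)) σ0
  have δσ : δ ≤ σ := min_le_right _ _
  have δa : δ ≤ 2 * η₁ := (min_le_left _ _).trans (min_le_left _ _)
  have δb : δ ≤ 2 * η₂ := (min_le_left _ _).trans (min_le_right _ _)
  refine ⟨2 * (4 / δ * 48004), by positivity, ?_⟩
  intro h sh hs hp _ CI Ch _ _ hI hC hA m _ φ hφ hφ0 A B sA sB hsym hsq u u₀ hu hS he h0
  have N := nearFlat_of_aFlat ε0.le (by linarith) σ0.le sh hs hp hI hC hA
  have G := N.geo σ0 σ1 (by linarith)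
  have D := dop_of_dirac sh N.det_pos sA sB hsym hsq
  have U := evol_of_eq hφ0 hu he
  have e0 : u 0 = u₀ := funext h0
  have key := U.smoothing D G hφ hφ0
    (fun t ht => by obtain ⟨F, hF⟩ := hS t ht; rw [← hF]; exact integrable_ip_schwartz F)
    (fun t ht => by obtain ⟨F, hF⟩ := hS t ht; rw [← hF]; exact integrable_gsq_schwartz F)
    (by linarith) δ0 (δσ.trans σ1.le) δa δb
  simpa only [e0, ip_self, mul_comm (sdet h _)] using key
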